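/- arXiv:1706.04101 — 2 statements merged into one kernel-verified Lean document; each statement's English description precedes it below -/
import Mathlib

section
/- There is an absolute constant γ > 0 (one may take γ = 0.098) with the following property: for every ε > 0 there exists Q₀ such that for all real Q ≥ Q₀ and all nonempty finite sets A, B of positive integers contained in the interval [1, Q], the quotient set A/B = {a/b ∈ ℚ : a ∈ A, b ∈ B} satisfies |A/B| ≥ |A|·|B|·exp((−2·log 2 + 0.098 − ε)·(log Q)/(log log Q)). -/
open Finset

lemma geom_bd (r : ℝ) (h0 : 0 ≤ r) (h1 : r < 1) (N : ℕ) :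
    ∑ k ∈ range N, r ^ k ≤ 1 / (1 - r) := by
  rw [le_div_iff₀ (by linarith), geom_sum_mul_neg]
  linarith [pow_nonneg h0 N]

lemma offdiag_bd (N : ℕ) (d : ℤ) (hd : d ≠ 0) :
    ∑ p ∈ (range N ×ˢ range N).filter (fun p => ((p.1 : ℤ) - p.2) = d),
      ((0.53 : ℝ)) ^ (p.1 + p.2) ≤ 0.738 := by
  set F := (range N ×ˢ range N).filter (fun p => ((p.1 : ℤ) - p.2) = d) with hF
  have h1 : ∑ p ∈ F, ((0.53 : ℝ)) ^ (p.1 + p.2)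
      ≤ ∑ p ∈ F, (fun k : ℕ => (0.53 : ℝ) * ((0.53 : ℝ) ^ 2) ^ k) (min p.1 p.2) := by
    apply sum_le_sum
    intro p hp
    have hp2 := (mem_filter.1 hp).2
    have : 2 * min p.1 p.2 + 1 ≤ p.1 + p.2 := by omega
    calc (0.53 : ℝ) ^ (p.1 + p.2) ≤ (0.53 : ℝ) ^ (2 * min p.1 p.2 + 1) :=
          pow_le_pow_of_le_one (by norm_num) (by norm_num) this
      _ = _ := by rw [pow_succ, pow_mul]; ring
  have hinj : Set.InjOn (fun p : ℕ × ℕ => min p.1 p.2) (F : Set (ℕ × ℕ)) := by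
    intro p hp q hq h
    have hp2 := (mem_filter.1 (mem_coe.1 hp)).2
    have hq2 := (mem_filter.1 (mem_coe.1 hq)).2
    simp only at h
    ext <;> omega
  have h2 : ∑ p ∈ F, (fun k : ℕ => (0.53 : ℝ) * ((0.53 : ℝ) ^ 2) ^ k) (min p.1 p.2)
      = ∑ k ∈ F.image (fun p => min p.1 p.2), (0.53 : ℝ) * ((0.53 : ℝ) ^ 2) ^ k :=
    (sum_image (f := fun k : ℕ => (0.53 : ℝ) * ((0.53 : ℝ) ^ 2) ^ k) hinj).symm
  have h3 : ∑ k ∈ F.image (fun p => min p.1 p.2), (0.53 : ℝ) * ((0.53 : ℝ) ^ 2) ^ k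
      ≤ ∑ k ∈ range N, (0.53 : ℝ) * ((0.53 : ℝ) ^ 2) ^ k := by
    apply sum_le_sum_of_subset_of_nonneg
    · intro k hk
      obtain ⟨p, hp, rfl⟩ := mem_image.1 hk
      have := mem_product.1 (mem_filter.1 hp).1
      simp only [mem_range] at this ⊢
      omega
    · intros; positivity
  have h4 := geom_bd ((0.53 : ℝ) ^ 2) (by norm_num) (by norm_num) N
  rw [← mul_sum (range N)] at h3
  have h5 := (h1.trans (h2.trans_le h3)).trans (mul_le_mul_of_nonneg_left h4 (by norm_num))
  refine h5.trans (by norm_num)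

lemma key (N : ℕ) (a b : ℕ → ℝ) (M : ℤ → ℝ) (ha : ∀ i, 0 ≤ a i) (hb : ∀ i, 0 ≤ b i)
    (hM : ∀ i < N, ∀ j < N, a i * b j ≤ M ((i : ℤ) - j)) (hM0 : ∀ d, 0 ≤ M d) :
    (∑ i ∈ range N, (0.53 : ℝ) ^ i * a i) * (∑ j ∈ range N, (0.53 : ℝ) ^ j * b j)
      ≤ ∑ d ∈ Icc (-(N : ℤ)) N, M d := by
  rcases Nat.eq_zero_or_pos N with rfl | hN
  · simp; exact hM0 0
  have hexp : (∑ i ∈ range N, (0.53 : ℝ) ^ i * a i) * (∑ j ∈ range N, (0.53 : ℝ) ^ j * b j)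
      = ∑ d ∈ Icc (-(N : ℤ)) N,
        ∑ p ∈ (range N ×ˢ range N).filter (fun p => ((p.1 : ℤ) - p.2) = d),
          (0.53 : ℝ) ^ (p.1 + p.2) * (a p.1 * b p.2) := by
    rw [sum_fiberwise_of_maps_to, sum_mul_sum, sum_product]
    · apply sum_congr rfl; intros; apply sum_congr rfl; intros
      rw [pow_add]; ring
    · intro p hp
      simp only [mem_product, mem_range, mem_Icc] at hp ⊢
      omega
  rw [hexp]
  have h0 : (0 : ℤ) ∈ Icc (-(N : ℤ)) N := by simp
  rw [← add_sum_erase _ _ h0, ← add_sum_erase _ M h0]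
  set E := (Icc (-(N : ℤ)) N).erase 0 with hE
  set P := ∑ d ∈ E, M d with hP
  have hoff : ∑ d ∈ E, ∑ p ∈ (range N ×ˢ range N).filter (fun p => ((p.1 : ℤ) - p.2) = d),
          (0.53 : ℝ) ^ (p.1 + p.2) * (a p.1 * b p.2) ≤ 0.738 * P := by
    rw [hP, mul_sum]
    apply sum_le_sum
    intro d hd
    have hd0 : d ≠ 0 := (mem_erase.1 hd).1
    calc _ ≤ ∑ p ∈ (range N ×ˢ range N).filter (fun p => ((p.1 : ℤ) - p.2) = d),
          (0.53 : ℝ) ^ (p.1 + p.2) * M d := by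
            apply sum_le_sum
            intro p hp
            rw [mem_filter, mem_product, mem_range, mem_range] at hp
            have := hM p.1 hp.1.1 p.2 hp.1.2
            rw [hp.2] at this
            gcongr
      _ ≤ _ := by
        rw [← sum_mul]
        exact mul_le_mul_of_nonneg_right (offdiag_bd N d hd0) (hM0 d)
  have hdiag : ∑ p ∈ (range N ×ˢ range N).filter (fun p => ((p.1 : ℤ) - p.2) = 0),
          (0.53 : ℝ) ^ (p.1 + p.2) * (a p.1 * b p.2)
      = ∑ k ∈ range N, ((0.53 : ℝ) ^ 2) ^ k * (a k * b k) := by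
    apply sum_nbij' (fun p => p.1) (fun k => (k, k))
    · intro p hp; simp at hp ⊢; omega
    · intro p hp; simp at hp ⊢; omega
    · intro p hp; simp at hp ⊢; ext <;> simp; omega
    · intro p hp; rfl
    · intro p hp; simp at hp
      have : p.2 = p.1 := by omega
      rw [this, ← pow_mul, two_mul]
  rw [hdiag]
  have hPpos : 0 ≤ P := sum_nonneg fun d _ => hM0 d
  obtain ⟨m, hm, hmax⟩ := exists_max_image (range N) (fun k => a k * b k) ⟨0, by simpa using hN⟩
  rw [mem_range] at hm
  have hx0 : ∀ k, 0 ≤ a k * b k := fun k => mul_nonneg (ha k) (hb k)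
  have hxM : ∀ k < N, a k * b k ≤ M 0 := fun k hk => by simpa using hM k hk k hk
  have hcs : ∀ k < N, a k * b k ≤ (M ((k : ℤ) - m) + M ((m : ℤ) - k)) / 2 := by
    intro k hk
    have h1 := hM k hk m hm
    have h2 := hM m hm k hk
    have h3 := hmax k (mem_range.2 hk)
    apply le_of_sq_le_sq _ (by linarith [hM0 ((k : ℤ) - m), hM0 ((m : ℤ) - k)])
    have h4 : (a k * b m) * (a m * b k) ≤ M ((k : ℤ) - m) * M ((m : ℤ) - k) :=
      mul_le_mul h1 h2 (mul_nonneg (ha _) (hb _)) (hM0 _)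
    have h5 := mul_le_mul_of_nonneg_left h3 (hx0 k)
    nlinarith [sq_nonneg (M ((k : ℤ) - m) - M ((m : ℤ) - k))]
  obtain ⟨n, rfl⟩ : ∃ n, N = n + 1 := ⟨N - 1, by omega⟩
  rw [sum_range_succ']
  have hsub : ∀ k ∈ range n, (0.53 : ℝ) ^ 2 * (M ((k : ℤ) + 1) + M (-((k : ℤ) + 1))) ≥ 0 := by
    intro k _
    have := hM0 ((k : ℤ) + 1); have := hM0 (-((k : ℤ) + 1)); positivity
  rcases Nat.eq_zero_or_pos m with rfl | hmpos
  · have hS : ∑ k ∈ range n, ((0.53 : ℝ) ^ 2) ^ (k + 1) * (a (k + 1) * b (k + 1))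
        ≤ ∑ k ∈ range n, (0.53 : ℝ) ^ 2 / 2 * (M ((k : ℤ) + 1) + M (-((k : ℤ) + 1))) := by
      apply sum_le_sum
      intro k hk
      have h1 := hcs (k + 1) (by rw [mem_range] at hk; omega)
      push_cast at h1
      rw [sub_zero, zero_sub] at h1
      have h2 : ((0.53 : ℝ) ^ 2) ^ (k + 1) ≤ (0.53 : ℝ) ^ 2 :=
        pow_le_of_le_one (by norm_num) (by norm_num) (by omega)
      calc _ ≤ (0.53 : ℝ) ^ 2 * (a (k + 1) * b (k + 1)) :=
            mul_le_mul_of_nonneg_right h2 (hx0 _)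
        _ ≤ (0.53 : ℝ) ^ 2 * ((M ((k : ℤ) + 1) + M (-((k : ℤ) + 1))) / 2) := by gcongr
        _ = _ := by ring
    have hT : ∑ k ∈ range n, (M ((k : ℤ) + 1) + M (-((k : ℤ) + 1))) ≤ P := by
      rw [sum_add_distrib]
      have e1 : ∑ k ∈ range n, M ((k : ℤ) + 1)
          = ∑ d ∈ (range n).image (fun k : ℕ => (k : ℤ) + 1), M d := by
        rw [sum_image]; intro x _ y _ h; simpa using h
      have e2 : ∑ k ∈ range n, M (-((k : ℤ) + 1))
          = ∑ d ∈ (range n).image (fun k : ℕ => -((k : ℤ) + 1)), M d := by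
        rw [sum_image]; intro x _ y _ h; simpa using h
      rw [e1, e2, ← sum_union]
      · apply sum_le_sum_of_subset_of_nonneg
        · intro d hd
          simp only [mem_union, mem_image, mem_range] at hd
          simp only [hE, mem_erase, mem_Icc]
          rcases hd with ⟨k, hk, rfl⟩ | ⟨k, hk, rfl⟩ <;> push_cast <;> omega
        · intros; exact hM0 _
      · rw [disjoint_left]
        intro d hd hd'
        simp only [mem_image, mem_range] at hd hd'
        obtain ⟨k, hk, rfl⟩ := hd
        obtain ⟨l, hl, h⟩ := hd'
        omega
    rw [← mul_sum] at hS
    have h7 := hxM 0 (by omega)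
    norm_num at hS hT hoff h7 ⊢
    linarith
  · have h1 := hcs 0 (by omega)
    have h2 : M (((0 : ℕ) : ℤ) - m) + M ((m : ℤ) - (0 : ℕ)) ≤ P := by
      have : ∑ d ∈ ({((0 : ℕ) : ℤ) - m, (m : ℤ) - (0 : ℕ)} : Finset ℤ), M d ≤ P := by
        apply sum_le_sum_of_subset_of_nonneg
        · intro d hd
          simp only [mem_insert, mem_singleton] at hd
          simp only [hE, mem_erase, mem_Icc]
          push_cast at hd ⊢
          omega
        · intros; exact hM0 _
      rwa [sum_pair (by push_cast; omega)] at this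
    have hS : ∑ k ∈ range n, ((0.53 : ℝ) ^ 2) ^ (k + 1) * (a (k + 1) * b (k + 1))
        ≤ ∑ k ∈ range n, ((0.53 : ℝ) ^ 2) ^ k * (0.53 ^ 2 * M 0) := by
      apply sum_le_sum
      intro k hk
      have := hxM (k + 1) (by rw [mem_range] at hk; omega)
      rw [pow_succ, mul_assoc]
      gcongr
    rw [← sum_mul] at hS
    have h4 := geom_bd ((0.53 : ℝ) ^ 2) (by norm_num) (by norm_num) n
    have h5 := mul_le_mul_of_nonneg_right h4 (show 0 ≤ (0.53 : ℝ) ^ 2 * M 0 by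
      have := hM0 0; positivity)
    have h7 := hxM 0 (by omega)
    have h8 := hM0 0
    have h6 := hS.trans h5
    rw [pow_zero, one_mul]
    clear hS h5 h4 hdiag hexp
    have h9 : a 0 * b 0 ≤ P / 2 :=
      h1.trans (div_le_div_of_nonneg_right h2 (by norm_num))
    clear h1 h2
    refine (add_le_add (add_le_add_left h6 _) hoff).trans ?_
    generalize a 0 * b 0 = z at *
    generalize M 0 = w at *
    norm_num
    linarith

/-- weight -/
noncomputable def wt (S : Finset ℕ) (a : ℕ) : ℝ := (0.53 : ℝ) ^ (∑ q ∈ S, a.factorization q)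

lemma main_ind (S : Finset ℕ) : (∀ q ∈ S, q.Prime) → ∀ A B : Finset ℕ,
    (∀ a ∈ A, a ≠ 0) → (∀ b ∈ B, b ≠ 0) →
    (∀ a ∈ A, ∀ a' ∈ A, ∀ q ∉ S, a.factorization q = a'.factorization q) →
    (∀ a ∈ B, ∀ a' ∈ B, ∀ q ∉ S, a.factorization q = a'.factorization q) →
    (∑ a ∈ A, wt S a) * (∑ b ∈ B, wt S b) ≤
      (((A ×ˢ B).image (fun p => (p.1 : ℚ) / (p.2 : ℚ))).card : ℝ) := by
  induction S using Finset.induction_on with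
  | empty =>
    intro _ A B hA hB hA' hB'
    have sub : ∀ A : Finset ℕ, (∀ a ∈ A, a ≠ 0) →
      (∀ a ∈ A, ∀ a' ∈ A, ∀ q ∉ (∅ : Finset ℕ), a.factorization q = a'.factorization q) →
        A.card ≤ 1 := by
      intro A hA h
      rw [card_le_one]
      intro a ha b hb
      exact Nat.eq_of_factorization_eq (hA a ha) (hA b hb) (fun q => h a ha b hb q (by simp))
    have cA := sub A hA hA'
    have cB := sub B hB hB'
    rcases A.eq_empty_or_nonempty with rfl | neA
    · simp
    rcases B.eq_empty_or_nonempty with rfl | neB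
    · simp
    have : 1 ≤ ((A ×ˢ B).image (fun p => (p.1 : ℚ) / (p.2 : ℚ))).card :=
      card_pos.2 ((neA.product neB).image _)
    have cA' : (A.card : ℝ) ≤ 1 := by exact_mod_cast cA
    have cB' : (B.card : ℝ) ≤ 1 := by exact_mod_cast cB
    have : (1 : ℝ) ≤ ((A ×ˢ B).image (fun p => (p.1 : ℚ) / (p.2 : ℚ))).card := by
      exact_mod_cast this
    simp only [wt, sum_empty, pow_zero, sum_const, nsmul_eq_mul, mul_one]
    have : (A.card : ℝ) * B.card ≤ 1 := mul_le_one₀ cA' (by positivity) cB'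
    linarith
  | insert p S hp ih =>
    intro hS A B hA hB hA' hB'
    have ih := ih (fun q hq => hS q (mem_insert_of_mem hq))
    have pp : p.Prime := hS p (mem_insert_self _ _)
    have : Fact p.Prime := ⟨pp⟩
    set N := ((A ∪ B).sup (fun a => a.factorization p)) + 1 with hN
    have bd : ∀ a ∈ A ∪ B, a.factorization p < N := fun a ha =>
      Nat.lt_succ_of_le (le_sup (f := fun a : ℕ => a.factorization p) ha)
    set fA : ℕ → Finset ℕ := fun i => A.filter (fun a => a.factorization p = i) with hfA
    set fB : ℕ → Finset ℕ := fun i => B.filter (fun a => a.factorization p = i) with hfB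
    set R := (A ×ˢ B).image (fun p => (p.1 : ℚ) / (p.2 : ℚ)) with hR
    have hw : ∀ C : Finset ℕ, (∀ a ∈ C, a.factorization p < N) →
        ∑ a ∈ C, wt (insert p S) a = ∑ i ∈ range N, (0.53 : ℝ) ^ i *
          ∑ a ∈ C.filter (fun a => a.factorization p = i), wt S a := by
      intro C hC
      rw [← sum_fiberwise_of_maps_to (s := C) (t := range N) (g := fun a => a.factorization p)
        (fun a ha => mem_range.2 (hC a ha))]
      apply sum_congr rfl
      intro i _
      rw [mul_sum]
      apply sum_congr rfl
      intro a ha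
      rw [wt, sum_insert hp, (mem_filter.1 ha).2, pow_add, wt]
    rw [hw A (fun a ha => bd a (mem_union_left _ ha)), hw B (fun a ha => bd a (mem_union_right _ ha))]
    have wn : ∀ S a, 0 ≤ wt S a := fun S a => by unfold wt; positivity
    have hval : ∀ a b : ℕ, a ≠ 0 → b ≠ 0 → padicValRat p ((a : ℚ) / b)
        = (a.factorization p : ℤ) - b.factorization p := by
      intro a b ha hb
      rw [padicValRat.div (by exact_mod_cast ha) (by exact_mod_cast hb), padicValRat.of_nat,
        padicValRat.of_nat, Nat.factorization_def _ pp, Nat.factorization_def _ pp]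
    refine (key N _ _ (fun d => ((R.filter (fun r => padicValRat p r = d)).card : ℝ))
      (fun i => sum_nonneg fun a _ => wn S a) (fun i => sum_nonneg fun a _ => wn S a)
      ?_ (fun d => by positivity)).trans ?_
    · intro i hi j hj
      refine (ih (fA i) (fB j) ?_ ?_ ?_ ?_).trans ?_
      · intro a ha; exact hA a (mem_filter.1 ha).1
      · intro a ha; exact hB a (mem_filter.1 ha).1
      · intro a ha a' ha' q hq
        by_cases hqp : q = p
        · rw [hqp, (mem_filter.1 ha).2, (mem_filter.1 ha').2]
        · exact hA' a (mem_filter.1 ha).1 a' (mem_filter.1 ha').1 q (by simp [hqp, hq])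
      · intro a ha a' ha' q hq
        by_cases hqp : q = p
        · rw [hqp, (mem_filter.1 ha).2, (mem_filter.1 ha').2]
        · exact hB' a (mem_filter.1 ha).1 a' (mem_filter.1 ha').1 q (by simp [hqp, hq])
      · refine Nat.cast_le.2 ?_
        apply card_le_card
        intro r hr
        obtain ⟨⟨x, y⟩, hxy, rfl⟩ := mem_image.1 hr
        obtain ⟨hx, hy⟩ := mem_product.1 hxy
        obtain ⟨hx1, hx2⟩ := mem_filter.1 hx
        obtain ⟨hy1, hy2⟩ := mem_filter.1 hy
        simp only at hx1 hx2 hy1 hy2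
        rw [mem_filter]
        refine ⟨mem_image.2 ⟨(x, y), mem_product.2 ⟨hx1, hy1⟩, rfl⟩, ?_⟩
        rw [hval x y (hA x hx1) (hB y hy1), hx2, hy2]
    · norm_cast
      apply le_of_eq
      refine (card_eq_sum_card_fiberwise ?_).symm
      intro r hr
      obtain ⟨⟨x, y⟩, hxy, rfl⟩ := mem_image.1 (mem_coe.1 hr)
      obtain ⟨hx, hy⟩ := mem_product.1 hxy
      simp only at hx hy
      have h1 := bd x (mem_union_left _ hx)
      have h2 := bd y (mem_union_right _ hy)
      simp only [hval x y (hA x hx) (hB y hy), coe_Icc, Set.mem_Icc]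
      omega

/-- pigeonhole -/
lemma pigeon (Y K : ℕ) (A : Finset ℕ) (hA : ∀ a ∈ A, ∀ q, a.factorization q < K) (hK : 0 < K) :
    ∃ A' ⊆ A, (∀ a ∈ A', ∀ a' ∈ A', ∀ q ≤ Y, a.factorization q = a'.factorization q) ∧
      (A.card : ℝ) ≤ (K : ℝ) ^ (Y + 1) * A'.card := by
  let f : ℕ → (Fin (Y + 1) → ℕ) := fun a q => a.factorization q
  let T : Finset (Fin (Y + 1) → ℕ) := Fintype.piFinset (fun _ => range K)
  have hT : T.card = K ^ (Y + 1) := by simp [T]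
  have hT0 : T.Nonempty := by
    rw [← card_pos, hT]; positivity
  obtain ⟨v, hv, h⟩ := exists_le_card_fiber_of_nsmul_le_card_of_maps_to
    (s := A) (t := T) (f := f) (b := (A.card : ℝ) / T.card)
    (fun a ha => by simp only [T, Fintype.mem_piFinset, mem_range]; exact fun q => hA a ha q) hT0
    (by
      have : (T.card : ℝ) ≠ 0 := by exact_mod_cast (card_pos.2 hT0).ne'
      rw [nsmul_eq_mul]; field_simp; exact le_rfl)
  refine ⟨A.filter (fun a => f a = v), filter_subset _ _, ?_, ?_⟩
  · intro a ha a' ha' q hq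
    have h1 := (mem_filter.1 ha).2.trans (mem_filter.1 ha').2.symm
    exact congrFun h1 ⟨q, by omega⟩
  · rw [div_le_iff₀ (by exact_mod_cast card_pos.2 hT0), hT] at h
    push_cast at h
    linarith

lemma wt_lower (Q : ℝ) (Y : ℕ) (hY : 1 ≤ Y) (S : Finset ℕ) (hS : ∀ q ∈ S, q.Prime ∧ Y < q)
    (a : ℕ) (ha : 0 < a) (haQ : (a : ℝ) ≤ Q) :
    Real.exp (Real.log 0.53 * (Real.log Q / Real.log (Y + 1))) ≤ wt S a := by
  set s := ∑ q ∈ S, a.factorization q with hs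
  have h1 : (Y + 1) ^ s ≤ a := by
    calc (Y + 1) ^ s = ∏ q ∈ S, (Y + 1) ^ a.factorization q := by
          rw [hs, prod_pow_eq_pow_sum]
      _ ≤ ∏ q ∈ S, q ^ a.factorization q := by
          apply prod_le_prod'
          intro q hq
          exact Nat.pow_le_pow_left (hS q hq).2 _
      _ = ∏ q ∈ S.filter (fun q => q ∈ a.primeFactors), q ^ a.factorization q := by
          symm
          apply prod_subset (filter_subset _ _)
          intro q hq hq'
          have : q ∉ a.factorization.support := by
            intro h; exact hq' (mem_filter.2 ⟨hq, by simpa using h⟩)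
          rw [Finsupp.notMem_support_iff.1 this, pow_zero]
      _ ≤ ∏ q ∈ a.primeFactors, q ^ a.factorization q := by
          apply prod_le_prod_of_subset_of_one_le'
          · intro q hq; exact (mem_filter.1 hq).2
          · intro q hq _
            exact Nat.one_le_pow _ _ (Nat.prime_of_mem_primeFactors hq).pos
      _ = a := Nat.prod_factorization_pow_eq_self ha.ne'
  have h2 : ((Y : ℝ) + 1) ^ s ≤ Q := le_trans (by exact_mod_cast h1) haQ
  have hY' : (1 : ℝ) ≤ Y := by exact_mod_cast hY
  have hl : 0 < Real.log ((Y : ℝ) + 1) := Real.log_pos (by linarith)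
  have h3 : s * Real.log ((Y : ℝ) + 1) ≤ Real.log Q := by
    rw [← Real.log_pow]
    exact Real.log_le_log (by positivity) h2
  have h4 : (s : ℝ) ≤ Real.log Q / Real.log ((Y : ℝ) + 1) := by
    rwa [le_div_iff₀ hl]
  have h5 : Real.log (0.53 : ℝ) ≤ 0 := Real.log_nonpos (by norm_num) (by norm_num)
  have h6 : wt S a = Real.exp (Real.log 0.53 * s) := by
    rw [wt, mul_comm, Real.exp_nat_mul, Real.exp_log (by norm_num)]
  rw [h6]
  apply Real.exp_le_exp.2
  exact mul_le_mul_of_nonpos_left h4 h5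

lemma finite_bd (Q : ℝ) (Y K : ℕ) (hY : 1 ≤ Y) (hK : 0 < K) (hQK : Q < 2 ^ K) (A B : Finset ℕ)
    (hA : ∀ a ∈ A, 0 < a ∧ (a : ℝ) ≤ Q) (hB : ∀ b ∈ B, 0 < b ∧ (b : ℝ) ≤ Q) :
    (A.card : ℝ) * B.card *
      Real.exp (2 * Real.log 0.53 * (Real.log Q / Real.log (Y + 1))) ≤
      (K : ℝ) ^ (2 * (Y + 1)) *
      (((A ×ˢ B).image (fun p => (p.1 : ℚ) / (p.2 : ℚ))).card : ℝ) := by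
  have hf : ∀ a : ℕ, 0 < a → (a : ℝ) ≤ Q → ∀ q, a.factorization q < K := by
    intro a ha haQ q
    by_contra! h
    by_cases hq : q.Prime
    · have h1 : 2 ^ K ≤ a := calc
        2 ^ K ≤ 2 ^ a.factorization q := Nat.pow_le_pow_right (by norm_num) h
        _ ≤ q ^ a.factorization q := Nat.pow_le_pow_left hq.two_le _
        _ ≤ a := Nat.ordProj_le q ha.ne'
      have h2 : (2 : ℝ) ^ K ≤ a := by exact_mod_cast h1
      linarith
    · rw [Nat.factorization_eq_zero_of_not_prime _ hq] at h
      omega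
  obtain ⟨A', sA, eA, cA⟩ := pigeon Y K A (fun a ha => hf a (hA a ha).1 (hA a ha).2) hK
  obtain ⟨B', sB, eB, cB⟩ := pigeon Y K B (fun a ha => hf a (hB a ha).1 (hB a ha).2) hK
  set S := (Finset.range (⌊Q⌋₊ + 1)).filter (fun q => q.Prime ∧ Y < q) with hS
  have hS' : ∀ q ∈ S, q.Prime ∧ Y < q := fun q hq => (mem_filter.1 hq).2
  have out : ∀ C D : Finset ℕ, C ⊆ D → (∀ a ∈ D, 0 < a ∧ (a : ℝ) ≤ Q) →
      (∀ a ∈ C, ∀ a' ∈ C, ∀ q ≤ Y, a.factorization q = a'.factorization q) →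
      ∀ a ∈ C, ∀ a' ∈ C, ∀ q ∉ S, a.factorization q = a'.factorization q := by
    intro C D hCD hD h a ha a' ha' q hq
    by_cases h1 : q ≤ Y
    · exact h a ha a' ha' q h1
    by_cases h2 : q.Prime
    · have h3 : ⌊Q⌋₊ < q := by
        by_contra! h3
        exact hq (mem_filter.2 ⟨mem_range.2 (by omega), h2, by omega⟩)
      have h4 : ∀ a ∈ C, a.factorization q = 0 := by
        intro a ha
        apply Nat.factorization_eq_zero_of_lt
        exact lt_of_le_of_lt (Nat.le_floor (hD a (hCD ha)).2) h3
      rw [h4 a ha, h4 a' ha']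
    · rw [Nat.factorization_eq_zero_of_not_prime _ h2, Nat.factorization_eq_zero_of_not_prime _ h2]
  have hm := main_ind S (fun q hq => (hS' q hq).1) A' B' (fun a ha => (hA a (sA ha)).1.ne')
    (fun a ha => (hB a (sB ha)).1.ne') (out A' A sA hA eA) (out B' B sB hB eB)
  set E := Real.exp (Real.log 0.53 * (Real.log Q / Real.log (Y + 1))) with hE
  have hE0 : 0 < E := Real.exp_pos _
  have hEE : Real.exp (2 * Real.log 0.53 * (Real.log Q / Real.log (Y + 1))) = E * E := by
    rw [hE, ← Real.exp_add]; congr 1; ring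
  have lA : A'.card * E ≤ ∑ a ∈ A', wt S a := by
    rw [← nsmul_eq_mul]
    exact card_nsmul_le_sum _ _ _ fun a ha =>
      wt_lower Q Y hY S hS' a (hA a (sA ha)).1 (hA a (sA ha)).2
  have lB : B'.card * E ≤ ∑ a ∈ B', wt S a := by
    rw [← nsmul_eq_mul]
    exact card_nsmul_le_sum _ _ _ fun a ha =>
      wt_lower Q Y hY S hS' a (hB a (sB ha)).1 (hB a (sB ha)).2
  have hsub : (((A' ×ˢ B').image (fun p => (p.1 : ℚ) / (p.2 : ℚ))).card : ℝ) ≤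
      (((A ×ˢ B).image (fun p => (p.1 : ℚ) / (p.2 : ℚ))).card : ℝ) :=
    Nat.cast_le.2 (card_le_card (image_subset_image (product_subset_product sA sB)))
  have hlow : (A'.card * E) * (B'.card * E) ≤
      (((A ×ˢ B).image (fun p => (p.1 : ℚ) / (p.2 : ℚ))).card : ℝ) :=
    ((mul_le_mul lA lB (by positivity) (le_trans (by positivity) lA)).trans hm).trans hsub
  rw [hEE]
  calc (A.card : ℝ) * B.card * (E * E)
      ≤ ((K : ℝ) ^ (Y + 1) * A'.card) * ((K : ℝ) ^ (Y + 1) * B'.card) * (E * E) := by gcongr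
    _ = (K : ℝ) ^ (2 * (Y + 1)) * ((A'.card * E) * (B'.card * E)) := by
        rw [two_mul, pow_add]; ring
    _ ≤ _ := by gcongr

lemma analytic (x : ℝ) (hx : 3 ≤ x) (hl : Real.log x ≤ 0.01 * x ^ (0.005 : ℝ)) :
    4 * x ^ (0.99 : ℝ) * Real.log (3 * x) ≤ 0.001 * (x / Real.log x) := by
  have hlog : 0 < Real.log x := Real.log_pos (by linarith)
  have h3 : Real.log (3 * x) ≤ 2 * Real.log x := by
    rw [Real.log_mul (by norm_num) (by linarith)]
    linarith [Real.log_le_log (by norm_num) hx]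
  rw [mul_div_assoc', le_div_iff₀ hlog]
  set u := x ^ (0.005 : ℝ) with hu
  have hu2 : x ^ (0.99 : ℝ) * (u * u) = x := by
    rw [hu, ← Real.rpow_add (by linarith), ← Real.rpow_add (by linarith)]
    norm_num
  have hp : 0 < x ^ (0.99 : ℝ) := Real.rpow_pos_of_pos (by linarith) _
  have hu0 : 0 < u := Real.rpow_pos_of_pos (by linarith) _
  have h4 : Real.log x * Real.log x ≤ (0.01 * u) * (0.01 * u) :=
    mul_le_mul hl hl hlog.le (by positivity)
  calc 4 * x ^ (0.99 : ℝ) * Real.log (3 * x) * Real.log x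
      ≤ 4 * x ^ (0.99 : ℝ) * (2 * Real.log x) * Real.log x := by gcongr
    _ = 8 * x ^ (0.99 : ℝ) * (Real.log x * Real.log x) := by ring
    _ ≤ 8 * x ^ (0.99 : ℝ) * ((0.01 * u) * (0.01 * u)) := by gcongr
    _ = 0.0008 * (x ^ (0.99 : ℝ) * (u * u)) := by ring
    _ = 0.0008 * x := by rw [hu2]
    _ ≤ 0.001 * x := by linarith

lemma log053 : 2 * Real.log 2 - 0.098 + 2 * Real.log 0.53 / 0.99 ≥ 0.001 := by
  have h1 : Real.log (0.53 : ℝ) = Real.log 1.06 - Real.log 2 := by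
    rw [← Real.log_div (by norm_num) (by norm_num)]; norm_num
  have h2 := Real.one_sub_inv_le_log_of_pos (show (0 : ℝ) < 1.06 by norm_num)
  have h3 := Real.log_two_lt_d9
  have h4 : (1 : ℝ) - 1.06⁻¹ ≥ 0.0566 := by norm_num
  rw [h1, ge_iff_le, ← sub_nonneg]
  have : 2 * Real.log 2 - 0.098 + 2 * (Real.log 1.06 - Real.log 2) / 0.99 - 0.001
    = (1.98 * Real.log 2 - 0.99 * 0.099 + 2 * Real.log 1.06 - 2 * Real.log 2) / 0.99 := by
    field_simp; ring
  rw [this]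
  apply div_nonneg _ (by norm_num)
  linarith

/-- There is an absolute constant γ > 0 (one may take γ = 0.098): for every ε > 0
there exists Q₀ such that for all real Q ≥ Q₀ and all nonempty finite sets A, B of
positive integers contained in [1, Q], the quotient set A/B ⊆ ℚ satisfies
|A/B| ≥ |A|·|B|·exp((−2·log 2 + 0.098 − ε)·(log Q)/(log log Q)). -/
theorem stmt_0 :
    ∀ ε : ℝ, 0 < ε → ∃ Q₀ : ℝ, ∀ Q : ℝ, Q₀ ≤ Q →
      ∀ A B : Finset ℕ, A.Nonempty → B.Nonempty →
        (∀ a ∈ A, 0 < a ∧ (a : ℝ) ≤ Q) →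
        (∀ b ∈ B, 0 < b ∧ (b : ℝ) ≤ Q) →
        (((A ×ˢ B).image (fun p => (p.1 : ℚ) / (p.2 : ℚ))).card : ℝ) ≥
          (A.card : ℝ) * (B.card : ℝ) *
            Real.exp ((-2 * Real.log 2 + 0.098 - ε) *
              (Real.log Q / Real.log (Real.log Q))) := by
  intro ε hε
  have hev := (isLittleO_log_rpow_atTop (show (0 : ℝ) < 0.005 by norm_num)).bound
    (show (0 : ℝ) < 0.01 by norm_num)
  obtain ⟨X, hX⟩ := Filter.eventually_atTop.1 hev
  refine ⟨Real.exp (max X 3), ?_⟩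
  intro Q hQ A B _ _ hA hB
  have hQ0 : 0 < Q := (Real.exp_pos _).trans_le hQ
  set x := Real.log Q with hx
  have hxm : max X 3 ≤ x := (Real.le_log_iff_exp_le hQ0).2 hQ
  have hx3 : 3 ≤ x := (le_max_right _ _).trans hxm
  have hlog : 0 < Real.log x := Real.log_pos (by linarith)
  have hl : Real.log x ≤ 0.01 * x ^ (0.005 : ℝ) := by
    have := hX x ((le_max_left _ _).trans hxm)
    rwa [Real.norm_of_nonneg hlog.le,
      Real.norm_of_nonneg (Real.rpow_nonneg (by linarith) _)] at this
  have han := analytic x hx3 hl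
  set Y := ⌊x ^ (0.99 : ℝ)⌋₊ with hY
  have hp1 : 1 ≤ x ^ (0.99 : ℝ) := Real.one_le_rpow (by linarith) (by norm_num)
  have hY1 : 1 ≤ Y := Nat.le_floor (by simpa using hp1)
  have hYle : (Y : ℝ) ≤ x ^ (0.99 : ℝ) := Nat.floor_le (by linarith)
  have hYlt : x ^ (0.99 : ℝ) < Y + 1 := Nat.lt_floor_add_one _
  set K := ⌊2 * x⌋₊ + 1 with hK
  have hK3 : (K : ℝ) ≤ 3 * x := by
    have := Nat.floor_le (show 0 ≤ 2 * x by linarith)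
    rw [hK]; push_cast; linarith
  have hK2 : 2 * x < (K : ℝ) := by
    rw [hK]; push_cast; exact Nat.lt_floor_add_one _
  have hKpos : (0 : ℝ) < K := by linarith
  have hQK : Q < 2 ^ K := by
    rw [← Real.log_lt_log_iff hQ0 (by positivity), Real.log_pow, ← hx]
    nlinarith [Real.log_two_gt_d9]
  have hfin := finite_bd Q Y K hY1 (by omega) hQK A B hA hB
  rw [← hx] at hfin
  have hlogY : 0.99 * Real.log x ≤ Real.log ((Y : ℝ) + 1) := by
    rw [← Real.log_rpow (by linarith)]
    exact Real.log_le_log (by linarith) hYlt.le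
  have h53 : Real.log (0.53 : ℝ) ≤ 0 := Real.log_nonpos (by norm_num) (by norm_num)
  have hxl : 0 < x / Real.log x := div_pos (by linarith) hlog
  have e1 : 2 * Real.log 0.53 / 0.99 * (x / Real.log x)
      ≤ 2 * Real.log 0.53 * (x / Real.log (Y + 1)) := by
    have : x / Real.log ((Y : ℝ) + 1) ≤ x / (0.99 * Real.log x) :=
      div_le_div_of_nonneg_left (by linarith) (by positivity) hlogY
    have h2 := mul_le_mul_of_nonpos_left this (show 2 * Real.log (0.53 : ℝ) ≤ 0 by linarith)
    refine le_trans (le_of_eq ?_) h2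
    field_simp
  have hKp : (K : ℝ) ^ (2 * (Y + 1)) ≤ Real.exp (4 * x ^ (0.99 : ℝ) * Real.log (3 * x)) := by
    rw [← Real.log_le_iff_le_exp (by positivity), Real.log_pow]
    have h1 : Real.log K ≤ Real.log (3 * x) := Real.log_le_log hKpos hK3
    have h2 : 0 ≤ Real.log (3 * x) := Real.log_nonneg (by linarith)
    push_cast
    calc 2 * ((Y : ℝ) + 1) * Real.log K ≤ 2 * ((Y : ℝ) + 1) * Real.log (3 * x) := by gcongr
      _ ≤ _ := mul_le_mul_of_nonneg_right (by linarith) h2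
  set R := (((A ×ˢ B).image (fun p => (p.1 : ℚ) / (p.2 : ℚ))).card : ℝ) with hR
  have hR0 : 0 ≤ R := by positivity
  set W := 4 * x ^ (0.99 : ℝ) * Real.log (3 * x) with hW
  have h1 := hfin.trans (mul_le_mul_of_nonneg_right hKp hR0)
  have e2 : (-2 * Real.log 2 + 0.098 - ε) * (x / Real.log x) + W
      ≤ 2 * Real.log 0.53 * (x / Real.log (Y + 1)) := by
    have h5 := mul_le_mul_of_nonneg_right log053 hxl.le
    have h6 := mul_pos hε hxl
    nlinarith
  have h2 : (A.card : ℝ) * B.card * Real.exp ((-2 * Real.log 2 + 0.098 - ε) *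
      (x / Real.log x)) * Real.exp W ≤ R * Real.exp W := by
    rw [mul_assoc, ← Real.exp_add, mul_comm R]
    refine le_trans ?_ h1
    gcongr
  exact le_of_mul_le_mul_right h2 (Real.exp_pos _)
end

section
/- There exists a constant C > 0 such that for all real numbers x, y with x ≥ 16 and 2 ≤ y ≤ x, one has |log ψ(x,y) − Z| ≤ C·Z·(1/log y + 1/log log x), where Z = Z(x,y) = (log x / log y)·log(1 + y/log x) + (y/log y)·log(1 + (log x)/y). -/
namespace DB

open Complex Filter Topology

/-- the entire function `(s-1) ζ(s)` -/
noncomputable def gz : ℂ → ℂ := Function.update (fun s => (s - 1) * riemannZeta s) 1 1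

lemma gz_of_ne {s : ℂ} (hs : s ≠ 1) : gz s = (s - 1) * riemannZeta s := by
  simp [gz, Function.update_of_ne hs]

lemma gz_one : gz 1 = 1 := by simp [gz]

lemma gz_diff : Differentiable ℂ gz := by
  intro s
  by_cases hs : s = 1
  · subst hs
    refine (Complex.analyticAt_of_differentiable_on_punctured_nhds_of_continuousAt ?_ ?_).differentiableAt
    · filter_upwards [self_mem_nhdsWithin] with z hz
      have : gz =ᶠ[𝓝 z] fun s => (s - 1) * riemannZeta s := by
        filter_upwards [isOpen_ne.mem_nhds hz] with w hw using gz_of_ne hw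
      rw [this.differentiableAt_iff]
      exact (by fun_prop : DifferentiableAt ℂ (fun s : ℂ => s - 1) z).mul (differentiableAt_riemannZeta hz)
    · unfold gz
      rw [continuousAt_update_same]
      exact riemannZeta_residue_one
  · have : gz =ᶠ[𝓝 s] fun s => (s - 1) * riemannZeta s := by
        filter_upwards [isOpen_ne.mem_nhds hs] with w hw using gz_of_ne hw
    rw [this.differentiableAt_iff]
    exact (by fun_prop : DifferentiableAt ℂ (fun s : ℂ => s - 1) s).mul (differentiableAt_riemannZeta hs)

lemma gz_ne_zero {s : ℂ} (hs : 1 ≤ s.re) : gz s ≠ 0 := by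
  by_cases h : s = 1
  · simp [h, gz_one]
  · rw [gz_of_ne h]
    exact mul_ne_zero (sub_ne_zero.mpr h) (riemannZeta_ne_zero_of_one_le_re hs)

/-- Euler-Maclaurin term, starting index `n+1`. -/
noncomputable def tz (n : ℕ) (s : ℂ) : ℂ :=
  ((n : ℂ) + 1) ^ (-s) * (s - 1) - ((n : ℂ) + 1) ^ (1 - s) + ((n : ℂ) + 1 + 1) ^ (1 - s)

lemma tz_diff (n : ℕ) : Differentiable ℂ (tz n) := by
  unfold tz
  have h1 : ((n : ℂ) + 1) ≠ 0 := by exact_mod_cast Nat.succ_ne_zero n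
  have h2 : ((n : ℂ) + 1 + 1) ≠ 0 := by exact_mod_cast Nat.succ_ne_zero (n + 1)
  intro s
  refine DifferentiableAt.add (DifferentiableAt.sub (DifferentiableAt.mul ?_ (by fun_prop)) ?_) ?_
  · exact DifferentiableAt.const_cpow (by fun_prop) (Or.inl h1)
  · exact DifferentiableAt.const_cpow (by fun_prop) (Or.inl h1)
  · exact DifferentiableAt.const_cpow (by fun_prop) (Or.inl h2)

lemma tz_bound (n : ℕ) {s : ℂ} (hs : 0 < s.re) :
    ‖tz n s‖ ≤ ‖s‖ * ‖s - 1‖ * ((n : ℝ) + 1) ^ (-s.re - 1) := by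
  set a : ℝ := (n : ℝ) + 1 with ha
  have ha0 : 0 < a := by positivity
  set M := ‖s‖ * ‖s - 1‖ * a ^ (-s.re - 1) with hM
  have hM0 : 0 ≤ M := by positivity
  have hpow : ∀ (c : ℂ) (t : ℝ), 0 < t → c ≠ 0 →
      HasDerivAt (fun t : ℝ => (t : ℂ) ^ c) (c * (t : ℂ) ^ (c - 1)) t := by
    intro c t ht hc
    exact hasDerivAt_ofReal_cpow_const ht.ne' hc |>.congr_deriv rfl
  by_cases h1 : s = 1
  · subst h1
    have e1 : ((n:ℂ)+1+1)^((1:ℂ)-1) = 1 := by simp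
    have e2 : ((n:ℂ)+1)^((1:ℂ)-1) = 1 := by simp
    simp only [tz, e1, e2]
    simp [hM]
  have hs0 : s ≠ 0 := by intro h; simp [h] at hs
  -- derivative difference
  have d1 : ∀ t ∈ Set.Icc a (a + 1),
      ‖(1 - s) * (t : ℂ) ^ (-s) - (1 - s) * (a : ℂ) ^ (-s)‖ ≤ M := by
    intro t ht
    have := Convex.norm_image_sub_le_of_norm_hasDerivWithin_le (s := Set.Icc a (a + 1)) (C := M)
      (f := fun t : ℝ => (1 - s) * (t : ℂ) ^ (-s)) (f' := fun t => (1 - s) * ((-s) * (t : ℂ) ^ (-s - 1)))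
      (x := a) (y := t) ?_ ?_ (convex_Icc _ _) ⟨le_refl _, by linarith⟩ ht
    · refine this.trans ?_
      have : ‖t - a‖ ≤ 1 := by
        rw [Real.norm_eq_abs, abs_le]; constructor <;> linarith [ht.1, ht.2]
      nlinarith
    · intro u hu
      have hu0 : 0 < u := ha0.trans_le hu.1
      exact ((hpow (-s) u hu0 (neg_ne_zero.mpr hs0)).const_mul _).hasDerivWithinAt
    · intro u hu
      have hu0 : 0 < u := ha0.trans_le hu.1
      rw [norm_mul, norm_mul, norm_neg, Complex.norm_cpow_eq_rpow_re_of_pos hu0, norm_sub_rev 1 s, hM]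
      have : u ^ (-s - 1).re ≤ a ^ (-s.re - 1) := by
        have : (-s - 1).re = -s.re - 1 := by simp
        rw [this]
        exact Real.rpow_le_rpow_of_nonpos ha0 hu.1 (by linarith)
      have h3 : 0 ≤ ‖s - 1‖ * ‖s‖ := by positivity
      calc _ = ‖s - 1‖ * ‖s‖ * u ^ (-s - 1).re := by ring
        _ ≤ ‖s - 1‖ * ‖s‖ * a ^ (-s.re - 1) := by gcongr
        _ = _ := by ring
  have := Convex.norm_image_sub_le_of_norm_hasDerivWithin_le (s := Set.Icc a (a + 1)) (C := M)
      (f := fun t : ℝ => (t : ℂ) ^ (1 - s) - (t : ℂ) * ((1 - s) * (a : ℂ) ^ (-s)))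
      (f' := fun t => (1 - s) * (t : ℂ) ^ (-s) - (1 - s) * (a : ℂ) ^ (-s))
      (x := a) (y := a + 1) ?_ d1 (convex_Icc _ _) ⟨le_refl _, by linarith⟩ ⟨by linarith, le_refl _⟩
  · have e : ‖a + 1 - a‖ = 1 := by simp
    rw [e, mul_one] at this
    have e2 : tz n s = (((a + 1 : ℝ) : ℂ) ^ (1 - s) - ((a + 1 : ℝ) : ℂ) * ((1 - s) * (a : ℂ) ^ (-s)))
        - ((a : ℂ) ^ (1 - s) - (a : ℂ) * ((1 - s) * (a : ℂ) ^ (-s))) := by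
      have e3 : (a : ℂ) = (n : ℂ) + 1 := by simp [ha]
      rw [Complex.ofReal_add, e3]
      simp only [tz, Complex.ofReal_one]
      ring
    rw [e2]
    exact this
  · intro u hu
    have hu0 : 0 < u := ha0.trans_le hu.1
    have h2 : (1 - s) ≠ 0 := sub_ne_zero.mpr (Ne.symm h1)
    have k1 := hpow (1 - s) u hu0 h2
    have k2 : HasDerivAt (fun t : ℝ => (t : ℂ) * ((1 - s) * (a : ℂ) ^ (-s))) (1 * ((1 - s) * (a : ℂ) ^ (-s))) u :=
      (hasDerivAt_id u).ofReal_comp.mul_const _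
    have k3 := (k1.sub k2).hasDerivWithinAt (s := Set.Icc a (a + 1))
    refine k3.congr_deriv ?_
    rw [one_mul, show 1 - s - 1 = -s by ring]

/-- finite sum plus tail formula -/
noncomputable def fz (N : ℕ) (s : ℂ) : ℂ :=
  (s - 1) * ∑ n ∈ Finset.range N, ((n : ℂ) + 1) ^ (-s) + ((N : ℂ) + 1) ^ (1 - s) + ∑' n : ℕ, tz (n + N) s

lemma summable_aux {c : ℝ} (hc : 0 < c) : Summable (fun n : ℕ => ((n : ℝ) + 1) ^ (-c - 1)) := by
  have := (summable_nat_add_iff 1).mpr (Real.summable_nat_rpow (p := -c - 1) |>.mpr (by linarith))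
  simpa using this

lemma summable_aux' {c : ℝ} (hc : 0 < c) (N : ℕ) : Summable (fun n : ℕ => (((n + N : ℕ) : ℝ) + 1) ^ (-c - 1)) :=
  (summable_nat_add_iff (f := fun n : ℕ => ((n : ℝ) + 1) ^ (-c - 1)) N).mpr (summable_aux hc)

lemma summable_tz {s : ℂ} (hs : 0 < s.re) (N : ℕ) : Summable (fun n => tz (n + N) s) := by
  refine Summable.of_norm_bounded (g := fun n : ℕ => ‖s‖ * ‖s - 1‖ * (((n + N : ℕ) : ℝ) + 1) ^ (-s.re - 1))
    ((summable_aux' hs N).mul_left _) ?_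
  intro n
  exact tz_bound _ hs

lemma fz_diffAt (N : ℕ) {s : ℂ} (hs : 0 < s.re) : DifferentiableAt ℂ (fz N) s := by
  set U : Set ℂ := {z | s.re / 2 < z.re} ∩ Metric.ball 0 (‖s‖ + 1) with hU
  have hUo : IsOpen U := (isOpen_lt continuous_const Complex.continuous_re).inter Metric.isOpen_ball
  have hsU : s ∈ U := ⟨by show s.re / 2 < s.re; linarith, by simp⟩
  have hd : DifferentiableOn ℂ (fun z => ∑' n : ℕ, tz (n + N) z) U := by
    refine differentiableOn_tsum_of_summable_norm
      (u := fun n : ℕ => (‖s‖ + 1) * (‖s‖ + 2) * (((n + N : ℕ) : ℝ) + 1) ^ (-(s.re / 2) - 1))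
      ((summable_aux' (by linarith) N).mul_left _) (fun n => (tz_diff _).differentiableOn) hUo ?_
    intro n w hw
    have hw1 : s.re / 2 < w.re := hw.1
    have hw2 : ‖w‖ < ‖s‖ + 1 := by simpa using hw.2
    refine (tz_bound _ (by linarith)).trans ?_
    have h3 : ‖w - 1‖ ≤ ‖s‖ + 2 := by
      have := norm_sub_le w 1
      simp at this; linarith
    have h4 : (((n + N : ℕ) : ℝ) + 1) ^ (-w.re - 1) ≤ (((n + N : ℕ) : ℝ) + 1) ^ (-(s.re / 2) - 1) := by
      apply Real.rpow_le_rpow_of_exponent_le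
      · have : (0 : ℝ) ≤ ((n + N : ℕ) : ℝ) := by positivity
        linarith
      · linarith
    gcongr
  unfold fz
  have h2 : ((N : ℂ) + 1) ≠ 0 := by exact_mod_cast Nat.succ_ne_zero N
  refine DifferentiableAt.add (DifferentiableAt.add (DifferentiableAt.mul (by fun_prop) ?_) ?_) ?_
  · apply DifferentiableAt.fun_sum
    intro i _
    have h1 : ((i : ℂ) + 1) ≠ 0 := by exact_mod_cast Nat.succ_ne_zero i
    exact DifferentiableAt.const_cpow (by fun_prop) (Or.inl h1)
  · exact DifferentiableAt.const_cpow (by fun_prop) (Or.inl h2)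
  · exact hd.differentiableAt (hUo.mem_nhds hsU)

lemma gz_eq_fz_of_one_lt (N : ℕ) {s : ℂ} (hs : 1 < s.re) : gz s = fz N s := by
  have hs1 : s ≠ 1 := by intro h; simp [h] at hs
  rw [gz_of_ne hs1, zeta_eq_tsum_one_div_nat_add_one_cpow hs]
  have hsum : Summable (fun n : ℕ => ((n : ℂ) + 1) ^ (-s)) := by
    have := (summable_nat_add_iff 1).mpr (Complex.summable_one_div_nat_cpow.mpr hs)
    refine this.congr fun n => ?_
    rw [Complex.cpow_neg]; simp
  have e1 : ∑' n : ℕ, 1 / ((n : ℂ) + 1) ^ s = ∑' n : ℕ, ((n : ℂ) + 1) ^ (-s) := by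
    refine tsum_congr fun n => ?_
    rw [Complex.cpow_neg]; simp
  rw [e1, ← hsum.sum_add_tsum_nat_add N]
  unfold fz
  rw [mul_add, add_assoc]
  congr 1
  have hsumN : Summable (fun n : ℕ => (((n + N : ℕ) : ℂ) + 1) ^ (-s)) :=
    (summable_nat_add_iff (f := fun n : ℕ => ((n : ℂ) + 1) ^ (-s)) N).mpr hsum
  -- limit of partial sums
  have T1 := (hsumN.hasSum.mul_left (s - 1)).tendsto_sum_nat
  have T2 := (summable_tz (s := s) (by linarith) N).hasSum.tendsto_sum_nat
  have T3 : Tendsto (fun m : ℕ => (((m + N : ℕ) : ℂ) + 1) ^ (1 - s)) atTop (𝓝 0) := by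
    rw [tendsto_zero_iff_norm_tendsto_zero]
    have : ∀ m : ℕ, ‖(((m + N : ℕ) : ℂ) + 1) ^ (1 - s)‖ = (((m + N + 1 : ℕ) : ℝ)) ^ (-(s.re - 1)) := by
      intro m
      have h0 : (0 : ℝ) < ((m + N + 1 : ℕ) : ℝ) := by positivity
      have := Complex.norm_cpow_eq_rpow_re_of_pos h0 (1 - s)
      simp at this
      rw [show -(s.re - 1) = 1 - s.re by ring]
      push_cast
      exact this
    simp_rw [this]
    have k := (tendsto_rpow_neg_atTop (y := s.re - 1) (by linarith)).comp tendsto_natCast_atTop_atTop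
    exact (k.comp (tendsto_add_atTop_nat (N + 1))).congr fun m => by simp [add_assoc]
  have key : ∀ m : ℕ, ∑ i ∈ Finset.range m, (s - 1) * (((i + N : ℕ) : ℂ) + 1) ^ (-s)
      = ((N : ℂ) + 1) ^ (1 - s) + ∑ i ∈ Finset.range m, tz (i + N) s - (((m + N : ℕ) : ℂ) + 1) ^ (1 - s) := by
    intro m
    induction m with
    | zero => simp
    | succ k ih =>
      rw [Finset.sum_range_succ, ih, Finset.sum_range_succ]
      simp only [tz]
      push_cast
      ring_nf
  have T4 := ((tendsto_const_nhds (x := ((N : ℂ) + 1) ^ (1 - s))).add T2).sub T3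
  have := tendsto_nhds_unique (T1.congr key) T4
  rw [sub_zero] at this
  exact this

lemma gz_eq_fz (N : ℕ) {s : ℂ} (hs : 0 < s.re) : gz s = fz N s := by
  have hop : IsOpen {z : ℂ | 0 < z.re} := isOpen_lt continuous_const Complex.continuous_re
  have A1 : AnalyticOnNhd ℂ gz {z : ℂ | 0 < z.re} := gz_diff.differentiableOn.analyticOnNhd hop
  have A2 : AnalyticOnNhd ℂ (fz N) {z : ℂ | 0 < z.re} :=
    DifferentiableOn.analyticOnNhd (fun z hz => (fz_diffAt N hz).differentiableWithinAt) hop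
  have hpc : IsPreconnected {z : ℂ | 0 < z.re} := (convex_halfSpace_re_gt 0).isPreconnected
  refine A1.eqOn_of_preconnected_of_eventuallyEq A2 hpc (z₀ := 2) (by simp) ?_ hs
  have : {z : ℂ | 1 < z.re} ∈ 𝓝 (2 : ℂ) := (isOpen_lt continuous_const Complex.continuous_re).mem_nhds (by simp)
  filter_upwards [this] with z hz using gz_eq_fz_of_one_lt N hz

end DB


namespace DB

open Complex Filter Topology

lemma zeta_bound : ∃ C : ℝ, 0 < C ∧ ∀ s : ℂ, 99 / 100 ≤ s.re → s.re ≤ 3 → 1 ≤ |s.im| →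
    ‖riemannZeta s‖ ≤ C * |s.im| ^ (1 / 50 : ℝ) := by
  set S : ℝ := ∑' n : ℕ, ((n : ℝ) + 1) ^ (-(1 / 100 : ℝ) - 1) with hS
  have hsum := summable_aux (c := 1 / 100) (by norm_num)
  have hS0 : 0 ≤ S := tsum_nonneg fun n => by positivity
  refine ⟨2 * (5 * S + 1), by positivity, ?_⟩
  intro s h1 h2 h3
  set T := |s.im| with hT
  have hs1 : s ≠ 1 := by intro h; simp [h] at hT; linarith
  have hs0 : 0 < s.re := by linarith
  set N := ⌊T⌋₊ with hN
  set M : ℝ := (N : ℝ) + 1 with hM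
  have hM1 : T ≤ M := (Nat.lt_floor_add_one T).le
  have hM2 : M ≤ 2 * T := by
    have := Nat.floor_le (show 0 ≤ T by linarith)
    linarith
  have hM3 : 1 ≤ M := by linarith
  have hM0 : 0 < M := by linarith
  have hsT : T ≤ ‖s - 1‖ := by
    have := Complex.abs_im_le_norm (s - 1)
    simpa using this
  have hsn : ‖s‖ ≤ 4 * M := by
    have := Complex.norm_le_abs_re_add_abs_im s
    rw [abs_of_pos hs0] at this
    linarith
  have hs1pos : 0 < ‖s - 1‖ := by linarith
  set Q := M ^ (1 / 50 : ℝ) with hQ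
  have hQ0 : 0 < Q := by positivity
  have key := gz_eq_fz N hs0
  rw [gz_of_ne hs1] at key
  have b1 : ‖∑ n ∈ Finset.range N, ((n : ℂ) + 1) ^ (-s)‖ ≤ Q * S := by
    calc _ ≤ ∑ n ∈ Finset.range N, Q * ((n : ℝ) + 1) ^ (-(1 / 100 : ℝ) - 1) := by
          refine norm_sum_le_of_le _ fun n hn => ?_
          have hn0 : (0 : ℝ) < (n : ℝ) + 1 := by positivity
          have e := Complex.norm_cpow_eq_rpow_re_of_pos hn0 (-s)
          push_cast at e
          rw [e]
          have : ((n : ℝ) + 1) ^ (-s).re ≤ ((n : ℝ) + 1) ^ (1 / 50 : ℝ) * ((n : ℝ) + 1) ^ (-(1 / 100 : ℝ) - 1) := by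
            rw [← Real.rpow_add hn0]
            apply Real.rpow_le_rpow_of_exponent_le
            · linarith [(Nat.cast_nonneg n : (0 : ℝ) ≤ n)]
            · simp; linarith
          refine this.trans ?_
          have hnN : (n : ℝ) + 1 ≤ M := by
            have := Finset.mem_range.mp hn
            have : (n : ℝ) < N := by exact_mod_cast this
            linarith
          rw [hQ]
          gcongr
      _ = Q * ∑ n ∈ Finset.range N, ((n : ℝ) + 1) ^ (-(1 / 100 : ℝ) - 1) := by rw [Finset.mul_sum]
      _ ≤ Q * S := by
          gcongr
          exact hsum.sum_le_tsum _ fun n _ => by positivity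
  have b2 : ‖((N : ℂ) + 1) ^ (1 - s)‖ ≤ Q := by
    have e := Complex.norm_cpow_eq_rpow_re_of_pos hM0 (1 - s)
    rw [hM] at e
    push_cast at e
    rw [e]
    apply Real.rpow_le_rpow_of_exponent_le hM3
    simp; linarith
  have b3 : ‖∑' n : ℕ, tz (n + N) s‖ ≤ ‖s‖ * ‖s - 1‖ * (M⁻¹ * Q) * S := by
    have hsN := summable_aux' (c := 1 / 100) (by norm_num) N
    have : ‖∑' n : ℕ, tz (n + N) s‖ ≤ ∑' n : ℕ, ‖s‖ * ‖s - 1‖ * (M⁻¹ * Q) * (((n + N : ℕ) : ℝ) + 1) ^ (-(1 / 100 : ℝ) - 1) := by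
      refine tsum_of_norm_bounded (hsN.mul_left _).hasSum fun n => ?_
      refine (tz_bound _ hs0).trans ?_
      rw [mul_assoc (‖s‖ * ‖s - 1‖)]
      gcongr
      set A : ℝ := ((n + N : ℕ) : ℝ) + 1 with hA
      have hAM : M ≤ A := by rw [hA, hM]; push_cast; linarith [(Nat.cast_nonneg n : (0 : ℝ) ≤ n)]
      have hA0 : 0 < A := by linarith
      have : A ^ (-s.re - 1) ≤ A ^ (-1 + 1 / 50 : ℝ) * A ^ (-(1 / 100 : ℝ) - 1) := by
        rw [← Real.rpow_add hA0]
        apply Real.rpow_le_rpow_of_exponent_le (by linarith)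
        linarith
      refine this.trans ?_
      have e : M⁻¹ * Q = M ^ (-1 + 1 / 50 : ℝ) := by
        rw [Real.rpow_add hM0, Real.rpow_neg_one]
      rw [e]
      have : A ^ (-1 + 1 / 50 : ℝ) ≤ M ^ (-1 + 1 / 50 : ℝ) := Real.rpow_le_rpow_of_nonpos hM0 hAM (by norm_num)
      gcongr
    refine this.trans ?_
    rw [tsum_mul_left]
    gcongr
    have := hsum.sum_add_tsum_nat_add N
    rw [← hS] at this
    have h0 : 0 ≤ ∑ n ∈ Finset.range N, ((n : ℝ) + 1) ^ (-(1 / 100 : ℝ) - 1) := Finset.sum_nonneg fun n _ => by positivity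
    linarith
  have hfin : ‖s - 1‖ * ‖riemannZeta s‖ ≤ ‖s - 1‖ * ((5 * S + 1) * Q) := by
    rw [← norm_mul, key, fz]
    refine (norm_add₃_le).trans ?_
    rw [norm_mul]
    have c3 : ‖s‖ * ‖s - 1‖ * (M⁻¹ * Q) * S ≤ (4 * M) * ‖s - 1‖ * (M⁻¹ * Q) * S := by gcongr
    have e3 : (4 * M) * ‖s - 1‖ * (M⁻¹ * Q) * S = ‖s - 1‖ * (4 * S * Q) := by field_simp
    have c2 : Q ≤ ‖s - 1‖ * Q := by nlinarith
    have c1 : ‖s - 1‖ * ‖∑ n ∈ Finset.range N, ((n : ℂ) + 1) ^ (-s)‖ ≤ ‖s - 1‖ * (Q * S) := by gcongr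
    nlinarith
  have hfin2 := le_of_mul_le_mul_left hfin hs1pos
  refine hfin2.trans ?_
  have : Q ≤ 2 * T ^ (1 / 50 : ℝ) := by
    calc Q ≤ (2 * T) ^ (1 / 50 : ℝ) := by rw [hQ]; gcongr
      _ = 2 ^ (1 / 50 : ℝ) * T ^ (1 / 50 : ℝ) := Real.mul_rpow (by norm_num) (by linarith)
      _ ≤ 2 * T ^ (1 / 50 : ℝ) := by
        gcongr
        calc (2 : ℝ) ^ (1 / 50 : ℝ) ≤ 2 ^ (1 : ℝ) := Real.rpow_le_rpow_of_exponent_le (by norm_num) (by norm_num)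
          _ = 2 := by simp
  nlinarith

/-- crude comparison of `T ^ (1/50)`. -/
lemma pow_cmp {T T' : ℝ} (hT : 0 ≤ T) (hT' : 0 ≤ T') (h : T' ≤ 2 * T) :
    T' ^ (1 / 50 : ℝ) ≤ 2 * T ^ (1 / 50 : ℝ) := by
  calc T' ^ (1 / 50 : ℝ) ≤ (2 * T) ^ (1 / 50 : ℝ) := by gcongr
      _ = 2 ^ (1 / 50 : ℝ) * T ^ (1 / 50 : ℝ) := Real.mul_rpow (by norm_num) (by linarith)
      _ ≤ 2 * T ^ (1 / 50 : ℝ) := by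
        gcongr
        calc (2 : ℝ) ^ (1 / 50 : ℝ) ≤ 2 ^ (1 : ℝ) := Real.rpow_le_rpow_of_exponent_le (by norm_num) (by norm_num)
          _ = 2 := by simp

lemma zeta_deriv_bound : ∃ C : ℝ, 0 < C ∧ ∀ s : ℂ, 199 / 200 ≤ s.re → s.re ≤ 5 / 2 → 3 / 2 ≤ |s.im| →
    ‖riemannZeta s‖ ≤ C * |s.im| ^ (1 / 50 : ℝ) ∧ ‖deriv riemannZeta s‖ ≤ C * |s.im| ^ (1 / 50 : ℝ) := by
  obtain ⟨C, hC, h⟩ := zeta_bound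
  refine ⟨400 * C, by positivity, ?_⟩
  intro s h1 h2 h3
  have hP : 0 ≤ C * |s.im| ^ (1 / 50 : ℝ) := by positivity
  constructor
  · refine (h s (by linarith) (by linarith) (by linarith)).trans ?_
    linarith
  · have : ∀ z ∈ Metric.closedBall s (1 / 200), ‖riemannZeta z‖ ≤ C * (2 * |s.im| ^ (1 / 50 : ℝ)) ∧ z ≠ 1 := by
      intro z hz
      rw [Metric.mem_closedBall, dist_eq_norm] at hz
      have r1 := (Complex.abs_re_le_norm (z - s)).trans hz
      have r2 := (Complex.abs_im_le_norm (z - s)).trans hz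
      rw [Complex.sub_re] at r1
      rw [Complex.sub_im] at r2
      have i1 : |z.im| ≤ |s.im| + 1 / 200 := by
        have := abs_sub_abs_le_abs_sub z.im s.im; linarith
      have i2 : |s.im| - 1 / 200 ≤ |z.im| := by
        have := abs_sub_abs_le_abs_sub s.im z.im
        rw [abs_sub_comm] at this; linarith
      rw [abs_le] at r1
      constructor
      · refine (h z (by linarith [r1.1]) (by linarith [r1.2]) (by linarith)).trans ?_
        gcongr
        exact pow_cmp (by positivity) (by positivity) (by linarith)
      · intro hz1
        rw [hz1] at i2; simp at i2; linarith
    have := Complex.norm_deriv_le_of_forall_mem_sphere_norm_le (f := riemannZeta) (c := s) (R := 1 / 200)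
      (C := C * (2 * |s.im| ^ (1 / 50 : ℝ))) (by norm_num) ?_ (fun z hz => (this z (Metric.sphere_subset_closedBall hz)).1)
    · refine this.trans (le_of_eq ?_)
      ring
    · apply DifferentiableOn.diffContOnCl
      intro z hz
      refine (differentiableAt_riemannZeta (this z ?_).2).differentiableWithinAt
      exact Metric.closure_ball_subset_closedBall hz

lemma zeta_near_one : ∃ K : ℝ, 0 < K ∧ ∀ x : ℝ, 0 < x → x ≤ 3 / 2 → ‖riemannZeta (1 + x)‖ ≤ K / x := by
  have hc : ContinuousOn (fun x : ℝ => ‖gz (1 + x)‖) (Set.Icc 0 (3 / 2)) := by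
    have := gz_diff.continuous
    fun_prop
  obtain ⟨K, hK⟩ := (isCompact_Icc.image_of_continuousOn hc).bddAbove
  refine ⟨|K| + 1, by positivity, ?_⟩
  intro x hx hx2
  have h1 : ‖gz (1 + x)‖ ≤ K := hK ⟨x, ⟨hx.le, hx2⟩, rfl⟩
  have hne : (1 + x : ℂ) ≠ 1 := by
    intro h
    have : (x : ℂ) = 0 := by simpa using h
    exact hx.ne' (by exact_mod_cast this)
  rw [gz_of_ne hne, norm_mul] at h1
  have e : ‖(1 + x - 1 : ℂ)‖ = x := by simp [hx.le]
  rw [e] at h1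
  rw [le_div_iff₀ hx]
  have := le_abs_self K
  linarith

lemma zeta341 {x : ℝ} (hx : 0 < x) (y : ℝ) :
    1 ≤ ‖riemannZeta (1 + x)‖ ^ 3 * ‖riemannZeta (1 + x + I * y)‖ ^ 4 * ‖riemannZeta (1 + x + 2 * I * y)‖ := by
  have := DirichletCharacter.norm_LSeries_product_ge_one (1 : DirichletCharacter ℂ 1) hx y
  have e : ∀ s : ℂ, 1 < s.re → LSeries (fun n => (1 : DirichletCharacter ℂ 1) n) s = riemannZeta s := by
    intro s hs
    rw [← LSeries_one_eq_riemannZeta hs, ← DirichletCharacter.LSeries_modOne_eq]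
  have e' : ∀ s : ℂ, 1 < s.re → LSeries (fun n => ((1 : DirichletCharacter ℂ 1)^2) n) s = riemannZeta s := by
    intro s hs
    rw [one_pow, e s hs]
  rw [e _ (by simp [hx]), e _ (by simp [hx]), e' _ (by simp [hx])] at this
  simpa [norm_mul, norm_pow] using this

end DB


namespace DB

open Complex Filter Topology

/-- combined bounds in a region slightly left of the line. -/
lemma zeta_region : ∃ D c c1 : ℝ, 0 < D ∧ 0 < c ∧ 0 < c1 ∧ c1 ≤ 1 / 400 ∧ ∀ s : ℂ,
    2 ≤ |s.im| → 1 - c1 / (|s.im| ^ (1 / 50 : ℝ)) ^ 5 ≤ s.re → s.re ≤ 2 →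
    ‖riemannZeta s‖ ≤ D * |s.im| ^ (1 / 50 : ℝ) ∧ ‖deriv riemannZeta s‖ ≤ D * |s.im| ^ (1 / 50 : ℝ) ∧
    c / (|s.im| ^ (1 / 50 : ℝ)) ^ 4 ≤ ‖riemannZeta s‖ := by
  obtain ⟨D, hD, h⟩ := zeta_deriv_bound
  obtain ⟨K, hK, hK1⟩ := zeta_near_one
  set c0 : ℝ := 1 / (2 * K ^ 3 * D) with hc0
  have hc0pos : 0 < c0 := by positivity
  set c1 : ℝ := min (c0 / (256 * D ^ 4)) (1 / 400) with hc1
  have hc1pos : 0 < c1 := by rw [hc1]; positivity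
  have hc1a : c1 ≤ c0 / (256 * D ^ 4) := min_le_left _ _
  have hc1b : c1 ≤ 1 / 400 := min_le_right _ _
  refine ⟨D, 2 * D * c1, c1, hD, by positivity, hc1pos, hc1b, ?_⟩
  intro s hs1 hs2 hs3
  set T := |s.im| with hT
  set P := T ^ (1 / 50 : ℝ) with hP
  have hP1 : 1 ≤ P := Real.one_le_rpow (by linarith) (by norm_num)
  have hP0 : 0 < P := by linarith
  set x0 := c1 / P ^ 5 with hx0
  have hx0pos : 0 < x0 := by positivity
  have hx0le : x0 ≤ 1 / 400 := by
    rw [hx0]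
    have : c1 / P ^ 5 ≤ c1 / 1 := by
      gcongr
      exact one_le_pow₀ hP1
    linarith
  have hb := h s (by linarith) (by linarith) (by linarith)
  refine ⟨hb.1, hb.2, ?_⟩
  -- the right point
  set x := max (s.re - 1) x0 with hx
  have hxx0 : x0 ≤ x := le_max_right _ _
  have hxpos : 0 < x := by linarith
  have hxle : x ≤ 1 := max_le (by linarith) (by linarith)
  have h341 := zeta341 hxpos s.im
  set w := ‖riemannZeta (1 + x + I * s.im)‖ with hw
  have hk := hK1 x hxpos (by linarith)
  have h2 : ‖riemannZeta (1 + x + 2 * I * s.im)‖ ≤ D * (2 * P) := by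
    have him : (1 + x + 2 * I * s.im : ℂ).im = 2 * s.im := by simp
    have hre : (1 + x + 2 * I * s.im : ℂ).re = 1 + x := by simp
    have habs : |2 * s.im| = 2 * T := by rw [abs_mul]; simp [hT]
    have := (h (1 + x + 2 * I * s.im) (by rw [hre]; linarith) (by rw [hre]; linarith)
      (by rw [him, habs]; linarith)).1
    refine this.trans ?_
    rw [him, habs]
    gcongr
    exact pow_cmp (by linarith) (by linarith) le_rfl
  have h3 : 1 ≤ (K / x) ^ 3 * w ^ 4 * (D * (2 * P)) := by
    refine h341.trans ?_
    gcongr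
  have h4 : c0 * x ^ 3 ≤ w ^ 4 * P := by
    have : (K / x) ^ 3 * w ^ 4 * (D * (2 * P)) = (w ^ 4 * P) * (2 * K ^ 3 * D) / x ^ 3 := by
      field_simp
    rw [this, le_div_iff₀ (by positivity)] at h3
    rw [hc0, div_mul_eq_mul_div, div_le_iff₀ (by positivity)]
    linarith
  have h5 : 4 * D * x0 * P ≤ w := by
    by_contra hcon
    push Not at hcon
    have hw0 : 0 ≤ w := norm_nonneg _
    have h6 : w ^ 4 < (4 * D * x0 * P) ^ 4 := by gcongr
    have h7 : c0 * x0 ^ 3 ≤ c0 * x ^ 3 := by gcongr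
    have h8 : c0 * x0 ^ 3 < (4 * D * x0 * P) ^ 4 * P := by
      calc _ ≤ w ^ 4 * P := h7.trans h4
        _ < _ := by gcongr
    have h9 : (4 * D * x0 * P) ^ 4 * P = x0 ^ 3 * (256 * D ^ 4 * (x0 * P ^ 5)) := by ring
    have h10 : x0 * P ^ 5 = c1 := by rw [hx0]; field_simp
    rw [h9, h10, mul_comm c0] at h8
    have h11 := lt_of_mul_lt_mul_left h8 (by positivity)
    rw [le_div_iff₀ (by positivity)] at hc1a
    linarith
  -- mean value
  have hmv := Convex.norm_image_sub_le_of_norm_deriv_le (𝕜 := ℂ) (f := riemannZeta) (C := D * P)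
    (s := {z : ℂ | 199 / 200 ≤ z.re} ∩ {z | z.re ≤ 5 / 2} ∩ {z | z.im = s.im}) (x := s) (y := 1 + x + I * s.im)
    ?_ ?_ ?_ ?_ ?_
  · have hd : ‖(1 + x + I * s.im : ℂ) - s‖ ≤ 2 * x0 := by
      have : (1 + x + I * s.im : ℂ) - s = ((1 + x - s.re : ℝ) : ℂ) := by
        apply Complex.ext <;> simp
      rw [this, Complex.norm_real, Real.norm_eq_abs, abs_le]
      constructor
      · have : s.re - 1 ≤ x := le_max_left _ _
        linarith
      · have : x ≤ s.re - 1 + 2 * x0 := max_le (by linarith) (by linarith)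
        linarith
    have h12 : w - ‖riemannZeta s‖ ≤ D * P * (2 * x0) := by
      refine (norm_sub_norm_le _ _).trans (hmv.trans ?_)
      gcongr
    have h13 : 2 * D * c1 / P ^ 4 = 2 * D * x0 * P := by
      rw [hx0]; field_simp
    rw [h13]
    linarith
  · rintro z ⟨_, hz⟩
    apply differentiableAt_riemannZeta
    rintro rfl
    have : s.im = 0 := by simpa using hz.symm
    rw [hT, this] at hs1
    simp at hs1
    linarith
  · rintro z ⟨⟨hz1, hz2⟩, hz3⟩
    have hz3 : z.im = s.im := hz3
    have := (h z hz1 hz2 (by rw [hz3]; linarith)).2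
    rwa [hz3] at this
  · exact ((convex_halfSpace_re_ge _).inter (convex_halfSpace_re_le _)).inter
      (by
        have : {z : ℂ | z.im = s.im} = {z : ℂ | z.im ≤ s.im} ∩ {z : ℂ | s.im ≤ z.im} := by
          ext z; simp [le_antisymm_iff]
        rw [this]
        exact (convex_halfSpace_im_le _).inter (convex_halfSpace_im_ge _))
  · refine ⟨⟨?_, ?_⟩, rfl⟩
    · show 199 / 200 ≤ s.re
      linarith
    · show s.re ≤ 5 / 2
      linarith
  · refine ⟨⟨?_, ?_⟩, ?_⟩
    · simp; linarith
    · simp; linarith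
    · simp

noncomputable def Gz (s : ℂ) : ℂ := -dslope gz 1 s - deriv gz s / gz s

noncomputable def Hz (s : ℂ) : ℂ := Gz s / (s * (s + 1))

lemma Gz_eq {s : ℂ} (hs : s ≠ 1) (h0 : riemannZeta s ≠ 0) :
    Gz s = -deriv riemannZeta s / riemannZeta s - riemannZeta s := by
  have hs1 : s - 1 ≠ 0 := sub_ne_zero.mpr hs
  have hd : deriv gz s = riemannZeta s + (s - 1) * deriv riemannZeta s := by
    have : gz =ᶠ[𝓝 s] fun s => (s - 1) * riemannZeta s := by
        filter_upwards [isOpen_ne.mem_nhds hs] with w hw using gz_of_ne hw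
    rw [this.deriv_eq]
    have k := ((hasDerivAt_id s).sub_const 1).mul (differentiableAt_riemannZeta hs).hasDerivAt
    have k2 := k.deriv
    simp only [id, one_mul] at k2
    exact k2
  rw [Gz, dslope_of_ne _ hs, slope_def_field, gz_of_ne hs, gz_one, hd]
  field_simp
  ring

lemma Gz_diffAt {s : ℂ} (h0 : gz s ≠ 0) : DifferentiableAt ℂ Gz s := by
  have h1 : Differentiable ℂ (dslope gz 1) := by
    rw [← differentiableOn_univ]
    exact (Complex.differentiableOn_dslope univ_mem).mpr gz_diff.differentiableOn
  have h2 : Differentiable ℂ (deriv gz) := (gz_diff.contDiff (n := 2)).differentiable_deriv_two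
  exact ((h1 s).neg).sub ((h2 s).div (gz_diff s) h0)

lemma Hz_diffAt {s : ℂ} (h0 : gz s ≠ 0) (h1 : 0 < s.re) : DifferentiableAt ℂ Hz s := by
  refine (Gz_diffAt h0).div (by fun_prop) (mul_ne_zero ?_ ?_)
  · rintro rfl; simp at h1
  · intro h
    have : s.re = -1 := by rw [eq_neg_of_add_eq_zero_left h]; simp
    linarith

lemma Hz_large : ∃ C : ℝ, 0 < C ∧ ∀ s : ℂ, 1 ≤ s.re → s.re ≤ 3 / 2 → 3 ≤ |s.im| → ∀ k ≤ 2,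
    ‖iteratedDeriv k Hz s‖ ≤ C * (1 + |s.im|) ^ (-(3 / 2 : ℝ)) := by
  obtain ⟨D, c, c1, hD, hc, hc1, hc1', h⟩ := zeta_region
  set B : ℝ := 2 * (4 * (32 * (D / c + D))) * (64 / c1) ^ 2 with hB
  refine ⟨B * 4, by positivity, ?_⟩
  intro s hs1 hs2 hs3 k hk
  set T := |s.im| with hT
  set P := T ^ (1 / 50 : ℝ) with hP
  have hP1 : 1 ≤ P := Real.one_le_rpow (by linarith) (by norm_num)
  have hP0 : 0 < P := by linarith
  have hT0 : 0 < T := by linarith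
  set r := c1 / (64 * P ^ 5) with hr
  have hr0 : 0 < r := by positivity
  have hP5 : 1 ≤ P ^ 5 := one_le_pow₀ hP1
  have hr1 : r ≤ 1 / 400 := by
    rw [hr, div_le_iff₀ (by positivity)]
    nlinarith
  have key : ∀ z ∈ Metric.closedBall s r, ‖Hz z‖ ≤ 4 * (32 * (D / c + D)) * P ^ 5 / T ^ 2 ∧ DifferentiableAt ℂ Hz z := by
    intro z hz
    rw [Metric.mem_closedBall, dist_eq_norm] at hz
    have r1 := (Complex.abs_re_le_norm (z - s)).trans hz
    have r2 := (Complex.abs_im_le_norm (z - s)).trans hz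
    rw [Complex.sub_re] at r1
    rw [Complex.sub_im] at r2
    have i1 : |z.im| ≤ 2 * T := by
      have := abs_sub_abs_le_abs_sub z.im s.im; linarith
    have i2 : T / 2 ≤ |z.im| := by
      have := abs_sub_abs_le_abs_sub s.im z.im
      rw [abs_sub_comm] at this; linarith
    have i3 : 2 ≤ |z.im| := by
      have := abs_sub_abs_le_abs_sub s.im z.im
      rw [abs_sub_comm] at this; linarith
    rw [abs_le] at r1
    set P' := |z.im| ^ (1 / 50 : ℝ) with hP'
    have hP'1 : 1 ≤ P' := Real.one_le_rpow (by linarith) (by norm_num)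
    have hP'0 : 0 < P' := by linarith
    have hPP : P' ≤ 2 * P := pow_cmp (by linarith) (by linarith) i1
    have hP'5 : P' ^ 5 ≤ 32 * P ^ 5 := by
      calc P' ^ 5 ≤ (2 * P) ^ 5 := by gcongr
        _ = 32 * P ^ 5 := by ring
    have hreg : r ≤ c1 / P' ^ 5 := by
      rw [hr]
      gcongr
      linarith
    have hz1 := h z i3 (by linarith [r1.1]) (by linarith [r1.2])
    have hzne : z ≠ 1 := by rintro rfl; simp at i3; linarith
    have hzpos : 0 < ‖riemannZeta z‖ := lt_of_lt_of_le (by positivity) hz1.2.2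
    have hz0 : riemannZeta z ≠ 0 := norm_pos_iff.mp hzpos
    refine ⟨?_, Hz_diffAt ?_ (by linarith [r1.1])⟩
    · rw [Hz, Gz_eq hzne hz0, norm_div]
      have g1 : ‖-deriv riemannZeta z / riemannZeta z - riemannZeta z‖ ≤ (D / c + D) * P' ^ 5 := by
        refine (norm_sub_le _ _).trans ?_
        rw [norm_div, norm_neg]
        have a1 : ‖deriv riemannZeta z‖ / ‖riemannZeta z‖ ≤ (D * P') / (c / P' ^ 4) := by
          gcongr
          · exact hz1.2.1
          · exact hz1.2.2
        have a2 : (D * P') / (c / P' ^ 4) = D / c * P' ^ 5 := by field_simp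
        have a3 : D * P' ≤ D * P' ^ 5 := by
          gcongr
          exact le_self_pow₀ hP'1 (by norm_num)
        have := hz1.1
        linarith
      have g2 : (T / 2) ^ 2 ≤ ‖z * (z + 1)‖ := by
        rw [norm_mul, sq]
        have b1 := Complex.abs_im_le_norm z
        have b2 := Complex.abs_im_le_norm (z + 1)
        simp only [Complex.add_im, Complex.one_im, add_zero] at b2
        gcongr <;> linarith
      calc _ ≤ (D / c + D) * P' ^ 5 / ((T / 2) ^ 2) := by gcongr
        _ ≤ (D / c + D) * (32 * P ^ 5) / ((T / 2) ^ 2) := by gcongr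
        _ = _ := by ring
    · rw [gz_of_ne hzne]
      exact mul_ne_zero (sub_ne_zero.mpr hzne) hz0
  have hC := Complex.norm_iteratedDeriv_le_of_forall_mem_sphere_norm_le (F := ℂ) (f := Hz) (c := s) (R := r)
    (C := 4 * (32 * (D / c + D)) * P ^ 5 / T ^ 2) k hr0 ?_ (fun z hz => (key z (Metric.sphere_subset_closedBall hz)).1)
  · refine hC.trans ?_
    have f1 : (k.factorial : ℝ) ≤ 2 := by
      have : k.factorial ≤ Nat.factorial 2 := Nat.factorial_le hk
      exact_mod_cast this
    have f2 : r ^ 2 ≤ r ^ k := pow_le_pow_of_le_one hr0.le (by linarith) hk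
    have f3 : (k.factorial : ℝ) * (4 * (32 * (D / c + D)) * P ^ 5 / T ^ 2) / r ^ k ≤
        2 * (4 * (32 * (D / c + D)) * P ^ 5 / T ^ 2) / r ^ 2 := by gcongr
    refine f3.trans ?_
    have f4 : 2 * (4 * (32 * (D / c + D)) * P ^ 5 / T ^ 2) / r ^ 2 = B * (P ^ 15 / T ^ 2) := by
      rw [hr, hB]; field_simp
    rw [f4, mul_assoc B]
    have f5 : P ^ 15 / T ^ 2 = T ^ (-(17 / 10) : ℝ) := by
      rw [hP, ← Real.rpow_natCast, ← Real.rpow_mul hT0.le, ← Real.rpow_natCast, ← Real.rpow_sub hT0]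
      norm_num
    rw [f5]
    have f6 : T ^ (-(17 / 10) : ℝ) ≤ T ^ (-(3 / 2) : ℝ) :=
      Real.rpow_le_rpow_of_exponent_le (by linarith) (by norm_num)
    have f7 : (2 * T) ^ (-(3 / 2) : ℝ) ≤ (1 + T) ^ (-(3 / 2) : ℝ) :=
      Real.rpow_le_rpow_of_nonpos (by linarith) (by linarith) (by norm_num)
    have f8 : (2 * T) ^ (-(3 / 2) : ℝ) = 2 ^ (-(3 / 2) : ℝ) * T ^ (-(3 / 2) : ℝ) := Real.mul_rpow (by norm_num) hT0.le
    have f9 : (1 / 4 : ℝ) ≤ 2 ^ (-(3 / 2) : ℝ) := by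
      calc (1 / 4 : ℝ) = 2 ^ (-2 : ℝ) := by rw [Real.rpow_neg (by norm_num)]; norm_num
        _ ≤ _ := Real.rpow_le_rpow_of_exponent_le (by norm_num) (by norm_num)
    have f10 : 0 < T ^ (-(3 / 2) : ℝ) := by positivity
    have hB0 : 0 < B := by positivity
    gcongr
    nlinarith
  · apply DifferentiableOn.diffContOnCl
    intro z hz
    exact (key z (Metric.closure_ball_subset_closedBall hz)).2.differentiableWithinAt

lemma Hz_analyticAt {s : ℂ} (hs : 1 ≤ s.re) : AnalyticAt ℂ Hz s := by
  have hop : IsOpen {z : ℂ | gz z ≠ 0 ∧ 0 < z.re} :=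
    (isOpen_ne_fun gz_diff.continuous continuous_const).inter (isOpen_lt continuous_const Complex.continuous_re)
  refine DifferentiableOn.analyticAt (s := {z : ℂ | gz z ≠ 0 ∧ 0 < z.re}) ?_ (hop.mem_nhds ⟨gz_ne_zero hs, by linarith⟩)
  intro z hz
  exact (Hz_diffAt hz.1 hz.2).differentiableWithinAt

lemma Hz_bound : ∃ C : ℝ, 0 < C ∧ ∀ s : ℂ, 1 ≤ s.re → s.re ≤ 3 / 2 → ∀ k ≤ 2,
    ‖iteratedDeriv k Hz s‖ ≤ C * (1 + |s.im|) ^ (-(3 / 2 : ℝ)) := by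
  obtain ⟨C, hC, h⟩ := Hz_large
  have hcpt : IsCompact (Set.Icc (1 : ℝ) (3 / 2) ×ℂ Set.Icc (-3 : ℝ) 3) := isCompact_Icc.reProdIm isCompact_Icc
  have hk : ∀ k : ℕ, ∃ B : ℝ, 0 < B ∧ ∀ z ∈ (Set.Icc (1 : ℝ) (3 / 2) ×ℂ Set.Icc (-3 : ℝ) 3), ‖iteratedDeriv k Hz z‖ ≤ B := by
    intro k
    have hc : ContinuousOn (iteratedDeriv k Hz) (Set.Icc (1 : ℝ) (3 / 2) ×ℂ Set.Icc (-3 : ℝ) 3) := by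
      intro z hz
      have : AnalyticAt ℂ (iteratedDeriv k Hz) z := by
        rw [iteratedDeriv_eq_iterate]
        exact (Hz_analyticAt (Complex.mem_reProdIm.mp hz).1.1).iterated_deriv k
      exact this.continuousAt.continuousWithinAt
    obtain ⟨B, hB⟩ := hcpt.exists_bound_of_continuousOn hc
    exact ⟨|B| + 1, by positivity, fun z hz => (hB z hz).trans (by linarith [le_abs_self B])⟩
  choose B hB0 hB using hk
  refine ⟨C + (B 0 + B 1 + B 2) * 8, by have := hB0 0; have := hB0 1; have := hB0 2; positivity, ?_⟩
  intro s hs1 hs2 k hk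
  have h00 := hB0 0
  have h01 := hB0 1
  have h02 := hB0 2
  have hpos : 0 < (1 + |s.im|) ^ (-(3 / 2 : ℝ)) := by positivity
  rcases le_or_gt 3 |s.im| with h3 | h3
  · refine (h s hs1 hs2 h3 k hk).trans ?_
    gcongr
    linarith
  · have hb := hB k s (Complex.mem_reProdIm.mpr ⟨⟨hs1, hs2⟩, abs_le.mp h3.le⟩)
    have hb2 : B k ≤ B 0 + B 1 + B 2 := by
      interval_cases k <;> linarith
    have h8 : 1 / 8 ≤ (1 + |s.im|) ^ (-(3 / 2 : ℝ)) := by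
      calc (1 / 8 : ℝ) = (2 ^ (2 : ℝ)) ^ (-(3 / 2 : ℝ)) := by
            rw [← Real.rpow_mul (by norm_num)]
            norm_num
        _ = 4 ^ (-(3 / 2 : ℝ)) := by norm_num
        _ ≤ _ := Real.rpow_le_rpow_of_nonpos (by positivity) (by linarith) (by norm_num)
    nlinarith

end DB

namespace DB
open MeasureTheory FourierTransform Complex

/-- point on the vertical line -/
noncomputable def wl (σ ξ : ℝ) : ℂ := (σ : ℂ) + 2 * Real.pi * ξ * I

lemma wl_re (σ ξ : ℝ) : (wl σ ξ).re = σ := by simp [wl]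
lemma wl_im (σ ξ : ℝ) : (wl σ ξ).im = 2 * Real.pi * ξ := by simp [wl]

noncomputable def kk (σ t : ℝ) : ℂ :=
  (1 - cexp (-((max t 0 : ℝ) : ℂ))) * cexp (-(σ * ((max t 0 : ℝ) : ℂ)))

lemma kk_nonpos {σ t : ℝ} (ht : t ≤ 0) : kk σ t = 0 := by
  simp [kk, max_eq_right ht]

lemma kk_pos {σ t : ℝ} (ht : 0 < t) :
    kk σ t = cexp ((-σ : ℂ) * t) - cexp ((-σ - 1 : ℂ) * t) := by
  rw [kk, max_eq_left ht.le, sub_mul, one_mul, ← Complex.exp_add]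
  congr 2 <;> ring_nf

lemma kk_eq (σ : ℝ) : kk σ = Set.indicator (Set.Ioi 0)
    (fun t : ℝ => cexp ((-σ : ℂ) * t) - cexp ((-σ - 1 : ℂ) * t)) := by
  ext t
  by_cases ht : 0 < t
  · rw [Set.indicator_of_mem (by exact ht), kk_pos ht]
  · rw [Set.indicator_of_notMem (by simpa using ht), kk_nonpos (not_lt.mp ht)]

lemma kk_cont (σ : ℝ) : Continuous (kk σ) := by
  unfold kk; fun_prop

lemma kk_int {σ : ℝ} (hσ : 0 < σ) : Integrable (kk σ) := by
  rw [kk_eq, integrable_indicator_iff measurableSet_Ioi]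
  exact (integrableOn_exp_mul_complex_Ioi (by simpa using hσ) 0).sub
    (integrableOn_exp_mul_complex_Ioi (by simp; linarith) 0)

lemma kk_fourier {σ : ℝ} (hσ : 0 < σ) (ξ : ℝ) :
    𝓕 (kk σ) ξ = 1 / (wl σ ξ * (wl σ ξ + 1)) := by
  rw [Real.fourier_real_eq_integral_exp_smul]
  have h1 : (fun t : ℝ => cexp (↑(-2 * Real.pi * t * ξ) * I) • kk σ t) =
      Set.indicator (Set.Ioi 0) (fun t : ℝ => cexp ((-wl σ ξ) * t) - cexp ((-wl σ ξ - 1) * t)) := by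
    ext t
    by_cases ht : 0 < t
    · rw [Set.indicator_of_mem (by exact ht), kk_pos ht, smul_eq_mul, mul_sub, ← Complex.exp_add,
        ← Complex.exp_add]
      congr 2 <;> (simp only [wl]; push_cast; ring)
    · rw [Set.indicator_of_notMem (by simpa using ht), kk_nonpos (not_lt.mp ht), smul_zero]
  rw [h1, integral_indicator measurableSet_Ioi]
  have hr1 : (-wl σ ξ).re < 0 := by rw [neg_re, wl_re]; linarith
  have hr2 : (-wl σ ξ - 1).re < 0 := by rw [sub_re, neg_re, wl_re, one_re]; linarith
  rw [integral_sub (integrableOn_exp_mul_complex_Ioi hr1 0) (integrableOn_exp_mul_complex_Ioi hr2 0),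
    integral_exp_mul_complex_Ioi hr1, integral_exp_mul_complex_Ioi hr2]
  have hw : wl σ ξ ≠ 0 := by
    intro h; rw [h] at hr1; simp at hr1
  have hw1 : wl σ ξ + 1 ≠ 0 := by
    intro h
    have : -wl σ ξ - 1 = 0 := by linear_combination -h
    rw [this] at hr2; simp at hr2
  have hw2 : -wl σ ξ - 1 ≠ 0 := by
    intro h; apply hw1; linear_combination -h
  simp only [ofReal_zero, mul_zero, Complex.exp_zero]
  field_simp
  ring

lemma int_base : Integrable (fun ξ : ℝ => (1 + ‖ξ‖) ^ (-(3 / 2 : ℝ))) :=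
  integrable_one_add_norm (by simp; norm_num)

lemma kern_cont {σ : ℝ} (hσ : 0 < σ) : Continuous (fun ξ : ℝ => 1 / (wl σ ξ * (wl σ ξ + 1))) := by
  have hw : ∀ ξ, wl σ ξ * (wl σ ξ + 1) ≠ 0 := by
    intro ξ h
    rcases mul_eq_zero.mp h with h | h
    · have := wl_re σ ξ; rw [h] at this; simp at this; linarith
    · have := congrArg Complex.re h; rw [add_re, wl_re] at this; simp at this; linarith
  have : Continuous (fun ξ : ℝ => wl σ ξ * (wl σ ξ + 1)) := by unfold wl; fun_prop
  exact continuous_const.div this hw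

lemma kern_int {σ : ℝ} (hσ : 1 ≤ σ) : Integrable (fun ξ : ℝ => 1 / (wl σ ξ * (wl σ ξ + 1))) := by
  have h2 := integrable_inv_one_add_sq
  refine h2.mono' (kern_cont (by linarith)).aestronglyMeasurable (Filter.Eventually.of_forall ?_)
  intro ξ
  rw [norm_div, norm_one, norm_mul, one_div]
  have hpi := Real.pi_gt_three
  have h1 : 1 + ξ ^ 2 ≤ ‖wl σ ξ‖ ^ 2 := by
    rw [← normSq_eq_norm_sq, normSq_apply, wl_re, wl_im]
    nlinarith [sq_nonneg ξ, mul_self_nonneg (Real.pi * ξ), mul_nonneg (sq_nonneg ξ) (by nlinarith : 0 ≤ Real.pi^2 - 1)]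
  have h2 : ‖wl σ ξ‖ ≤ ‖wl σ ξ + 1‖ := by
    rw [← sq_le_sq₀ (norm_nonneg _) (norm_nonneg _), ← normSq_eq_norm_sq, ← normSq_eq_norm_sq,
      normSq_apply, normSq_apply, add_re, add_im, wl_re, wl_im]
    simp; nlinarith
  apply inv_anti₀ (by positivity)
  nlinarith [norm_nonneg (wl σ ξ)]

lemma kern_inv {σ : ℝ} (hσ : 1 ≤ σ) (v : ℝ) :
    ∫ ξ : ℝ, cexp (2 * Real.pi * (ξ * v) * I) * (1 / (wl σ ξ * (wl σ ξ + 1))) = kk σ v := by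
  have h0 : 0 < σ := by linarith
  have hF : 𝓕 (kk σ) = (fun ξ : ℝ => 1 / (wl σ ξ * (wl σ ξ + 1))) := funext (kk_fourier h0)
  have := (kk_int h0).fourierInv_fourier_eq (v := v) (by rw [hF]; exact kern_int hσ)
    (kk_cont σ).continuousAt
  rw [← this, hF, Real.fourierInv_eq']
  congr 1
  ext ξ
  simp only [smul_eq_mul]
  congr 2
  simp
  ring

noncomputable def an (n : ℕ) : ℂ := ((ArithmeticFunction.vonMangoldt n : ℝ) : ℂ) - 1

lemma an_hasSum {s : ℂ} (hs : 1 < s.re) : LSeriesHasSum an s (Gz s) := by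
  have h1 := (ArithmeticFunction.LSeriesSummable_vonMangoldt hs).LSeriesHasSum
  rw [ArithmeticFunction.LSeries_vonMangoldt_eq_deriv_riemannZeta_div hs] at h1
  have h2 := LSeriesHasSum_one hs
  have h3 := h1.sub h2
  rw [Gz_eq (by intro h; rw [h] at hs; simp at hs) (riemannZeta_ne_zero_of_one_lt_re hs)]
  exact h3

lemma term_eq {σ ξ : ℝ} (n : ℕ) (hn : n ≠ 0) :
    LSeries.term an (wl σ ξ) n =
      LSeries.term an σ n * cexp (2 * Real.pi * (ξ * (-Real.log n)) * I) := by
  have hn' : (n : ℂ) ≠ 0 := by exact_mod_cast hn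
  rw [LSeries.term_of_ne_zero hn, LSeries.term_of_ne_zero hn, wl, Complex.cpow_add _ _ hn',
    Complex.cpow_def_of_ne_zero hn' (2 * Real.pi * ξ * I), Complex.natCast_log,
    div_mul_eq_div_div, div_eq_mul_inv _ (cexp _), ← Complex.exp_neg]
  congr 2
  push_cast
  ring

lemma perron {σ x : ℝ} (hσ : 1 < σ) (hx : 1 < x) :
    HasSum (fun n : ℕ => LSeries.term an σ n * kk σ (Real.log x - Real.log n))
      (∫ ξ : ℝ, cexp (2 * Real.pi * (ξ * Real.log x) * I) * Hz (wl σ ξ)) := by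
  let F : ℕ → ℝ → ℂ := fun n ξ => LSeries.term an (wl σ ξ) n *
    (cexp (2 * Real.pi * (ξ * Real.log x) * I) * (1 / (wl σ ξ * (wl σ ξ + 1))))
  have hF : ∀ n ξ, F n ξ = LSeries.term an σ n *
      (cexp (2 * Real.pi * (ξ * ((Real.log x - Real.log n : ℝ) : ℂ)) * I) * (1 / (wl σ ξ * (wl σ ξ + 1)))) := by
    intro n ξ
    rcases eq_or_ne n 0 with rfl | hn
    · simp [F]
    · simp only [F]
      rw [term_eq n hn]
      have : cexp (2 * Real.pi * (ξ * ((Real.log x - Real.log n : ℝ) : ℂ)) * I) =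
          cexp (2 * Real.pi * (ξ * (-Real.log n)) * I) * cexp (2 * Real.pi * (ξ * Real.log x) * I) := by
        rw [← Complex.exp_add]; congr 1; push_cast; ring
      rw [this]; ring
  have hnormexp : ∀ ξ v : ℝ, ‖cexp (2 * Real.pi * (ξ * (v : ℂ)) * I)‖ = 1 := by
    intro ξ v
    rw [show (2 * Real.pi * (ξ * (v : ℂ)) * I : ℂ) = ((2 * Real.pi * (ξ * v) : ℝ) : ℂ) * I by push_cast; ring]
    exact norm_exp_ofReal_mul_I _
  have hFi : ∀ n, Integrable (F n) := by
    intro n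
    have : F n = fun ξ : ℝ => LSeries.term an σ n *
      (cexp (2 * Real.pi * (ξ * ((Real.log x - Real.log n : ℝ) : ℂ)) * I) * (1 / (wl σ ξ * (wl σ ξ + 1)))) :=
      funext (hF n)
    rw [this]
    apply Integrable.const_mul
    apply (kern_int hσ.le).bdd_mul (c := 1) (Continuous.aestronglyMeasurable (by fun_prop))
    exact Filter.Eventually.of_forall (fun ξ => (hnormexp ξ _).le)
  have hsum : Summable (fun n => ‖LSeries.term an σ n‖) :=
    ((an_hasSum (s := (σ : ℂ)) (by simpa using hσ)).LSeriesSummable).norm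
  have hFs : Summable (fun n => ∫ ξ, ‖F n ξ‖) := by
    have : (fun n => ∫ ξ, ‖F n ξ‖) = fun n => ‖LSeries.term an σ n‖ *
        ∫ ξ, ‖(1 / (wl σ ξ * (wl σ ξ + 1)))‖ := by
      ext n
      rw [← integral_const_mul]
      congr 1
      ext ξ
      rw [hF, norm_mul, norm_mul, hnormexp, one_mul]
    rw [this]
    exact hsum.mul_right _
  have key := hasSum_integral_of_summable_integral_norm hFi hFs
  have e1 : (fun n => ∫ ξ, F n ξ) = (fun n : ℕ => LSeries.term an σ n * kk σ (Real.log x - Real.log n)) := by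
    ext n
    rw [← kern_inv hσ.le, ← integral_const_mul]
    congr 1
    ext ξ
    exact hF n ξ
  have e2 : (∫ ξ, ∑' n, F n ξ) = (∫ ξ : ℝ, cexp (2 * Real.pi * (ξ * Real.log x) * I) * Hz (wl σ ξ)) := by
    congr 1
    ext ξ
    have := an_hasSum (s := wl σ ξ) (by rw [wl_re]; exact hσ)
    have h2 := (this.mul_right (cexp (2 * Real.pi * (ξ * Real.log x) * I) * (1 / (wl σ ξ * (wl σ ξ + 1))))).tsum_eq
    simp only [F]
    rw [h2, Hz]; ring
  rw [← e1, ← e2]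
  exact key

lemma wl_hasDerivAt (σ ξ : ℝ) : HasDerivAt (wl σ) (2 * Real.pi * I) ξ := by
  unfold wl
  have := ((hasDerivAt_id ξ).ofReal_comp.const_mul (2 * Real.pi * I : ℂ)).const_add (σ : ℂ)
  convert! this using 1
  · ext x; simp; ring
  · simp

lemma iter_deriv {σ : ℝ} (hσ : 1 ≤ σ) (k : ℕ) (ξ : ℝ) :
    HasDerivAt (fun ξ => iteratedDeriv k Hz (wl σ ξ))
      (2 * Real.pi * I * iteratedDeriv (k + 1) Hz (wl σ ξ)) ξ := by
  have h1 : AnalyticAt ℂ Hz (wl σ ξ) := Hz_analyticAt (by rw [wl_re]; exact hσ)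
  have h2 : AnalyticAt ℂ (iteratedDeriv k Hz) (wl σ ξ) := by
    rw [iteratedDeriv_eq_iterate]; exact h1.iterated_deriv k
  have h3 := h2.differentiableAt.hasDerivAt
  rw [← iteratedDeriv_succ] at h3
  have := HasDerivAt.comp_of_eq (h₂ := iteratedDeriv k Hz) ξ h3 (wl_hasDerivAt σ ξ) rfl
  convert! this using 1
  ring

lemma fourier_decay : ∃ C : ℝ, 0 < C ∧ ∀ σ v : ℝ, 1 ≤ σ → σ ≤ 3 / 2 → 0 < v →
    ‖∫ ξ : ℝ, cexp (2 * Real.pi * (ξ * v) * I) * Hz (wl σ ξ)‖ ≤ C / v ^ 2 := by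
  obtain ⟨C, hC, hb⟩ := Hz_bound
  set J : ℝ := ∫ ξ : ℝ, (1 + ‖ξ‖) ^ (-(3 / 2 : ℝ)) with hJ
  have hJ0 : 0 ≤ J := integral_nonneg (fun ξ => by positivity)
  refine ⟨C * J + 1, by positivity, ?_⟩
  intro σ v h1 h2 hv
  have hbd : ∀ k ≤ 2, ∀ ξ : ℝ, ‖iteratedDeriv k Hz (wl σ ξ)‖ ≤ C * (1 + ‖ξ‖) ^ (-(3 / 2 : ℝ)) := by
    intro k hk ξ
    refine (hb (wl σ ξ) (by rw [wl_re]; exact h1) (by rw [wl_re]; exact h2) k hk).trans ?_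
    apply mul_le_mul_of_nonneg_left _ hC.le
    apply Real.rpow_le_rpow_of_nonpos (by positivity) _ (by norm_num)
    rw [wl_im, abs_mul, Real.norm_eq_abs, abs_of_pos Real.two_pi_pos]
    nlinarith [abs_nonneg ξ, Real.pi_gt_three]
  let h : ℕ → ℝ → ℂ := fun k ξ => iteratedDeriv k Hz (wl σ ξ)
  have hd : ∀ k ξ, HasDerivAt (h k) (2 * Real.pi * I * h (k + 1) ξ) ξ := fun k ξ => iter_deriv h1 k ξ
  have hcont : ∀ k, Continuous (h k) := fun k =>
    continuous_iff_continuousAt.mpr fun ξ => (hd k ξ).continuousAt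
  have hintg : ∀ k ≤ 2, Integrable (h k) := fun k hk =>
    (int_base.const_mul C).mono' (hcont k).aestronglyMeasurable
      (Filter.Eventually.of_forall (hbd k hk))
  have hder : ∀ k, deriv (h k) = fun ξ => 2 * Real.pi * I * h (k + 1) ξ :=
    fun k => funext fun ξ => (hd k ξ).deriv
  have hstep : ∀ k ≤ 1, ∀ w : ℝ, 𝓕 (h (k + 1)) w = w * 𝓕 (h k) w := by
    intro k hk w
    have e1 := Real.fourier_deriv (hintg k (by omega)) (fun ξ => (hd k ξ).differentiableAt)
      (by rw [hder]; exact (hintg (k + 1) (by omega)).const_mul _)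
    have e2 := congrFun e1 w
    rw [hder] at e2
    have e3 : 𝓕 (fun ξ => 2 * Real.pi * I * h (k + 1) ξ) w = 2 * Real.pi * I * 𝓕 (h (k + 1)) w := by
      rw [Real.fourier_real_eq_integral_exp_smul, Real.fourier_real_eq_integral_exp_smul,
        ← integral_const_mul]
      congr 1
      ext ξ
      simp only [smul_eq_mul]; ring
    rw [e3, smul_eq_mul] at e2
    exact mul_left_cancel₀ two_pi_I_ne_zero (e2.trans (by ring))
  have hfin : (∫ ξ : ℝ, cexp (2 * Real.pi * (ξ * v) * I) * Hz (wl σ ξ)) = 𝓕 (h 0) (-v) := by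
    rw [Real.fourier_real_eq_integral_exp_smul]
    congr 1
    ext ξ
    simp only [smul_eq_mul, h, iteratedDeriv_zero]
    congr 2
    push_cast; ring
  have hv2 : 𝓕 (h 2) (-v) = v ^ 2 * 𝓕 (h 0) (-v) := by
    rw [hstep 1 le_rfl, hstep 0 (by norm_num)]
    push_cast; ring
  have hbound : ‖𝓕 (h 2) (-v)‖ ≤ C * J := by
    rw [Real.fourier_real_eq_integral_exp_smul]
    refine (norm_integral_le_integral_norm _).trans ?_
    rw [hJ, ← integral_const_mul]
    apply integral_mono_of_nonneg (Filter.Eventually.of_forall (fun _ => norm_nonneg _))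
      (int_base.const_mul C)
    apply Filter.Eventually.of_forall
    intro ξ
    simp only [norm_smul]
    rw [norm_exp_ofReal_mul_I, one_mul]
    exact hbd 2 le_rfl ξ
  rw [hfin, le_div_iff₀ (by positivity), mul_comm]
  have : ‖𝓕 (h 2) (-v)‖ = v ^ 2 * ‖𝓕 (h 0) (-v)‖ := by
    rw [hv2, norm_mul, norm_pow, norm_real, Real.norm_eq_abs, abs_of_pos hv]
  linarith

lemma term_kk {σ x : ℝ} (hx : 1 < x) (n : ℕ) :
    LSeries.term an σ n * kk σ (Real.log x - Real.log n) =
      if n ∈ Finset.Icc 1 ⌊x⌋₊ then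
        ((x ^ (-σ) * ((ArithmeticFunction.vonMangoldt n - 1) * (1 - n / x)) : ℝ) : ℂ) else 0 := by
  have hx0 : 0 < x := by linarith
  rcases eq_or_ne n 0 with rfl | hn
  · simp
  have hn0 : (0 : ℝ) < n := by exact_mod_cast Nat.pos_of_ne_zero hn
  split_ifs with h
  · rw [Finset.mem_Icc, Nat.le_floor_iff hx0.le] at h
    have hk : kk σ (Real.log x - Real.log n) =
        ((x ^ (-σ) * (n : ℝ) ^ σ * (1 - n / x) : ℝ) : ℂ) := by
      have h0 : 0 ≤ Real.log x - Real.log n := sub_nonneg.mpr (Real.log_le_log hn0 h.2)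
      rw [kk, max_eq_left h0]
      have : (1 - cexp (-((Real.log x - Real.log n : ℝ) : ℂ))) *
          cexp (-(σ * ((Real.log x - Real.log n : ℝ) : ℂ))) =
        (((1 - Real.exp (-(Real.log x - Real.log n))) * Real.exp (-(σ * (Real.log x - Real.log n))) : ℝ) : ℂ) := by
        push_cast; rfl
      rw [this]
      congr 1
      have a1 : Real.exp (-(Real.log x - Real.log n)) = n / x := by
        rw [neg_sub, Real.exp_sub, Real.exp_log hn0, Real.exp_log hx0]
      have a2 : Real.exp (-(σ * (Real.log x - Real.log n))) = x ^ (-σ) * (n : ℝ) ^ σ := by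
        rw [Real.rpow_def_of_pos hx0, Real.rpow_def_of_pos hn0, ← Real.exp_add]
        congr 1; ring
      rw [a1, a2]; ring
    rw [hk, LSeries.term_of_ne_zero hn, an]
    have : ((n : ℂ) ^ (σ : ℂ)) = (((n : ℝ) ^ σ : ℝ) : ℂ) := by
      rw [Complex.ofReal_cpow hn0.le]; simp
    rw [this]
    have hne : (((n : ℝ) ^ σ : ℝ) : ℂ) ≠ 0 := by
      exact_mod_cast (Real.rpow_pos_of_pos hn0 σ).ne'
    push_cast at hne ⊢
    field_simp
  · rw [Finset.mem_Icc, Nat.le_floor_iff hx0.le] at h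
    have : x < n := by
      by_contra h2
      exact h ⟨Nat.pos_of_ne_zero hn, not_lt.mp h2⟩
    rw [kk_nonpos, mul_zero]
    have := Real.log_lt_log hx0 this
    linarith

lemma riesz_bound : ∃ C : ℝ, 0 < C ∧ ∀ x : ℝ, 1 < x →
    |∑ n ∈ Finset.Icc 1 ⌊x⌋₊, (ArithmeticFunction.vonMangoldt n - 1) * (x - n)| ≤
      C * x ^ 2 / (Real.log x) ^ 2 := by
  obtain ⟨C, hC, hb⟩ := fourier_decay
  refine ⟨C, hC, ?_⟩
  intro x hx
  have hx0 : 0 < x := by linarith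
  have hl : 0 < Real.log x := Real.log_pos hx
  set S := ∑ n ∈ Finset.Icc 1 ⌊x⌋₊, (ArithmeticFunction.vonMangoldt n - 1) * (1 - n / x) with hS
  have h1 : ∀ σ : ℝ, 1 < σ → σ ≤ 3 / 2 → |S| ≤ C / Real.log x ^ 2 * x ^ σ := by
    intro σ h1 h2
    have hp := perron h1 hx
    simp_rw [term_kk hx] at hp
    have hs := hp.unique (hasSum_sum_of_ne_finset_zero (s := Finset.Icc 1 ⌊x⌋₊)
      (fun b hb => if_neg hb))
    have hs2 : (∑ b ∈ Finset.Icc 1 ⌊x⌋₊, if b ∈ Finset.Icc 1 ⌊x⌋₊ then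
        ((x ^ (-σ) * ((ArithmeticFunction.vonMangoldt b - 1) * (1 - b / x)) : ℝ) : ℂ) else 0) =
        ((x ^ (-σ) * S : ℝ) : ℂ) := by
      rw [Finset.sum_congr rfl (fun b hb => if_pos hb), hS, Finset.mul_sum, ofReal_sum]
    have hb1 := hb σ (Real.log x) h1.le h2 hl
    rw [hs, hs2, norm_real, Real.norm_eq_abs, abs_mul, abs_of_pos (Real.rpow_pos_of_pos hx0 _),
      Real.rpow_neg hx0.le, inv_mul_le_iff₀ (Real.rpow_pos_of_pos hx0 _)] at hb1
    linarith
  have h2 : |S| ≤ C / Real.log x ^ 2 * x ^ (1 : ℝ) := by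
    have ht : Filter.Tendsto (fun σ : ℝ => C / Real.log x ^ 2 * x ^ σ) (nhdsWithin 1 (Set.Ioi 1))
        (nhds (C / Real.log x ^ 2 * x ^ (1 : ℝ))) := by
      apply Filter.Tendsto.mono_left _ nhdsWithin_le_nhds
      exact ((Real.continuous_const_rpow hx0.ne').tendsto 1).const_mul _
    apply ge_of_tendsto ht
    filter_upwards [Ioo_mem_nhdsGT (show (1 : ℝ) < 3 / 2 by norm_num)] with σ hσ
    exact h1 σ hσ.1 hσ.2.le
  have h3 : ∑ n ∈ Finset.Icc 1 ⌊x⌋₊, (ArithmeticFunction.vonMangoldt n - 1) * (x - n) = x * S := by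
    rw [hS, Finset.mul_sum]
    refine Finset.sum_congr rfl fun n _ => ?_
    field_simp
  rw [h3, abs_mul, abs_of_pos hx0]
  rw [Real.rpow_one] at h2
  calc x * |S| ≤ x * (C / Real.log x ^ 2 * x) := by gcongr
    _ = _ := by ring

end DB

namespace DB
open ArithmeticFunction

noncomputable def psiOne (x : ℝ) : ℝ := ∑ n ∈ Finset.Icc 1 ⌊x⌋₊, vonMangoldt n * (x - n)

lemma log_sq_le {x : ℝ} (hx : 1 ≤ x) : Real.log x ^ 2 ≤ 4 * x := by
  have h := Real.log_le_sub_one_of_pos (x := Real.sqrt x) (by positivity)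
  rw [Real.log_sqrt (by linarith)] at h
  have h0 := Real.log_nonneg hx
  have hs := Real.sq_sqrt (show 0 ≤ x by linarith)
  have : Real.log x ≤ 2 * Real.sqrt x := by linarith
  nlinarith [Real.sqrt_nonneg x]

lemma sum_id_bound {x : ℝ} (hx : 1 ≤ x) :
    |∑ n ∈ Finset.Icc 1 ⌊x⌋₊, (x - (n : ℝ)) - x ^ 2 / 2| ≤ x := by
  have h1 : ∀ N : ℕ, ∑ n ∈ Finset.Icc 1 N, (x - (n : ℝ)) = x * N - N * (N + 1) / 2 := by
    intro N
    induction N with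
    | zero => simp
    | succ k ih => rw [Finset.sum_Icc_succ_top (by omega), ih]; push_cast; ring
  rw [h1]
  have a := Nat.floor_le (show 0 ≤ x by linarith)
  have b := Nat.lt_floor_add_one x
  set N : ℝ := (⌊x⌋₊ : ℝ)
  have hN : 0 ≤ N := Nat.cast_nonneg _
  rw [abs_le]; constructor <;> nlinarith

lemma psiOne_bound : ∃ C : ℝ, 0 < C ∧ ∀ x : ℝ, 1 < x →
    |psiOne x - x ^ 2 / 2| ≤ C * x ^ 2 / Real.log x ^ 2 := by
  obtain ⟨C, hC, h⟩ := riesz_bound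
  refine ⟨C + 4, by positivity, ?_⟩
  intro x hx
  have h1 := h x hx
  have h2 := sum_id_bound hx.le
  have hl := Real.log_pos hx
  have e : ∑ n ∈ Finset.Icc 1 ⌊x⌋₊, (vonMangoldt n - 1) * (x - n) =
      psiOne x - ∑ n ∈ Finset.Icc 1 ⌊x⌋₊, (x - (n : ℝ)) := by
    rw [psiOne, ← Finset.sum_sub_distrib]
    exact Finset.sum_congr rfl fun n _ => by ring
  rw [e] at h1
  have h3 : x ≤ 4 * x ^ 2 / Real.log x ^ 2 := by
    rw [le_div_iff₀ (by positivity)]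
    nlinarith [log_sq_le hx.le]
  have e2 : (C + 4) * x ^ 2 / Real.log x ^ 2 = C * x ^ 2 / Real.log x ^ 2 + 4 * x ^ 2 / Real.log x ^ 2 := by ring
  rw [e2]
  rw [abs_le] at *
  constructor <;> linarith [h1.1, h1.2, h2.1, h2.2]

lemma psi_Icc (x : ℝ) : Chebyshev.psi x = ∑ n ∈ Finset.Icc 1 ⌊x⌋₊, vonMangoldt n := rfl

lemma psiOne_mono_aux {x y : ℝ} (hx : 0 ≤ x) (hxy : x ≤ y) :
    (y - x) * Chebyshev.psi x ≤ psiOne y - psiOne x ∧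
    psiOne y - psiOne x ≤ (y - x) * Chebyshev.psi y := by
  have hsub : Finset.Icc 1 ⌊x⌋₊ ⊆ Finset.Icc 1 ⌊y⌋₊ :=
    Finset.Icc_subset_Icc_right (Nat.floor_le_floor hxy)
  have key : psiOne y - psiOne x = (y - x) * Chebyshev.psi x +
      ∑ n ∈ Finset.Icc 1 ⌊y⌋₊ \ Finset.Icc 1 ⌊x⌋₊, vonMangoldt n * (y - n) := by
    rw [psiOne, psiOne, psi_Icc, ← Finset.sum_sdiff hsub, Finset.mul_sum, add_sub_assoc,
      ← Finset.sum_sub_distrib, add_comm]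
    congr 1
    exact Finset.sum_congr rfl fun n _ => by ring
  have hmem : ∀ n ∈ Finset.Icc 1 ⌊y⌋₊ \ Finset.Icc 1 ⌊x⌋₊, x ≤ n ∧ (n : ℝ) ≤ y := by
    intro n hn
    simp only [Finset.mem_sdiff, Finset.mem_Icc, not_and, not_le] at hn
    constructor
    · exact (Nat.lt_of_floor_lt (hn.2 hn.1.1)).le
    · exact (Nat.le_floor_iff (hx.trans hxy)).mp hn.1.2
  constructor
  · rw [key]
    have : 0 ≤ ∑ n ∈ Finset.Icc 1 ⌊y⌋₊ \ Finset.Icc 1 ⌊x⌋₊, vonMangoldt n * (y - n) :=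
      Finset.sum_nonneg fun n hn => mul_nonneg vonMangoldt_nonneg (by linarith [(hmem n hn).2])
    linarith
  · rw [key, psi_Icc, psi_Icc, ← Finset.sum_sdiff hsub, mul_add, add_comm ]
    gcongr
    rw [Finset.mul_sum]
    refine Finset.sum_le_sum fun n hn => ?_
    rw [mul_comm]
    exact mul_le_mul_of_nonneg_right (by linarith [(hmem n hn).1]) vonMangoldt_nonneg

lemma psi_pnt : ∃ C : ℝ, 0 < C ∧ ∀ x : ℝ, 2 ≤ x →
    |Chebyshev.psi x - x| ≤ C * x / Real.log x := by
  obtain ⟨C, hC, h⟩ := psiOne_bound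
  refine ⟨20 * C + 32, by positivity, ?_⟩
  intro x hx
  have hl : 0 < Real.log x := Real.log_pos (by linarith)
  have hx0 : 0 < x := by linarith
  rcases lt_or_ge (Real.log x) 2 with h2 | h2
  · have h1 := Chebyshev.psi_le_const_mul_self hx0.le
    have h0 := Chebyshev.psi_nonneg x
    have h4 : Real.log 4 ≤ 3 := by
      have := Real.log_le_sub_one_of_pos (x := 4) (by norm_num); linarith
    have h5 : |Chebyshev.psi x - x| ≤ 8 * x := by
      rw [abs_le]; constructor <;> nlinarith
    refine h5.trans ?_
    rw [le_div_iff₀ hl]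
    nlinarith [mul_pos hC hx0]
  · set l := Real.log x with hl_def
    set δ := x / (2 * l) with hδ
    have hδ0 : 0 < δ := by positivity
    have hδl : δ * l = x / 2 := by rw [hδ]; field_simp
    have hδ4 : δ ≤ x / 4 := by nlinarith
    have hx4 : 4 ≤ x := by
      have := Real.add_one_le_exp l
      have e : Real.exp l = x := Real.exp_log hx0
      have := Real.exp_one_gt_d9
      have h6 : Real.exp 2 ≤ x := by rw [← e]; exact Real.exp_le_exp.mpr h2
      have h7 : Real.exp 2 = Real.exp 1 * Real.exp 1 := by rw [← Real.exp_add]; norm_num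
      nlinarith
    have b0 := h x (by linarith)
    have b1 := h (x + δ) (by linarith)
    have b2 := h (x - δ) (by linarith)
    have l1 : l ≤ Real.log (x + δ) := Real.log_le_log hx0 (by linarith)
    have l2 : l / 2 ≤ Real.log (x - δ) := by
      rw [hl_def, ← Real.log_sqrt hx0.le]
      apply Real.log_le_log (Real.sqrt_pos.mpr hx0)
      rw [Real.sqrt_le_left (by linarith)]
      nlinarith
    have c1 : C * (x + δ) ^ 2 / Real.log (x + δ) ^ 2 ≤ 4 * (C * x ^ 2 / l ^ 2) := by
      calc C * (x + δ) ^ 2 / Real.log (x + δ) ^ 2 ≤ C * (2 * x) ^ 2 / l ^ 2 := by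
            gcongr; linarith
        _ = _ := by ring
    have c2 : C * (x - δ) ^ 2 / Real.log (x - δ) ^ 2 ≤ 4 * (C * x ^ 2 / l ^ 2) := by
      calc C * (x - δ) ^ 2 / Real.log (x - δ) ^ 2 ≤ C * x ^ 2 / (l / 2) ^ 2 := by
            gcongr <;> linarith
        _ = _ := by field_simp; norm_num
    have m1 := (psiOne_mono_aux hx0.le (show x ≤ x + δ by linarith)).1
    have m2 := (psiOne_mono_aux (show 0 ≤ x - δ by linarith) (show x - δ ≤ x by linarith)).2
    rw [abs_le] at b0 b1 b2
    set B := C * x ^ 2 / l ^ 2 with hB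
    have hBδ : B = (2 * C * x / l) * δ := by
      rw [hB, hδ]; field_simp
    have hδδ : δ = (x / l) / 2 := by rw [hδ]; field_simp
    have g1 : δ * Chebyshev.psi x ≤ δ * (x + δ / 2 + 10 * C * x / l) := by
      have : δ * (x + δ / 2 + 10 * C * x / l) = x * δ + δ ^ 2 / 2 + 5 * ((2 * C * x / l) * δ) := by ring
      rw [this, ← hBδ]
      nlinarith
    have g2 : δ * (x - δ / 2 - 10 * C * x / l) ≤ δ * Chebyshev.psi x := by
      have : δ * (x - δ / 2 - 10 * C * x / l) = x * δ - δ ^ 2 / 2 - 5 * ((2 * C * x / l) * δ) := by ring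
      rw [this, ← hBδ]
      nlinarith
    have g1 := le_of_mul_le_mul_left g1 hδ0
    have g2 := le_of_mul_le_mul_left g2 hδ0
    have e3 : (20 * C + 32) * x / l = 2 * (10 * C * x / l) + 32 * (x / l) := by ring
    have p1 : 0 < 10 * C * x / l := by positivity
    have p2 : 0 < x / l := by positivity
    rw [e3, abs_le]; constructor <;> linarith

lemma theta_pnt : ∃ C : ℝ, 0 < C ∧ ∀ x : ℝ, 2 ≤ x →
    |Chebyshev.theta x - x| ≤ C * x / Real.log x := by
  obtain ⟨C, hC, h⟩ := psi_pnt
  obtain ⟨D, hD⟩ := Chebyshev.psi_sub_theta_le_mul_sqrt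
  refine ⟨C + 2 * |D|, by positivity, ?_⟩
  intro x hx
  have hl : 0 < Real.log x := Real.log_pos (by linarith)
  have h1 := h x hx
  have h2 := hD x
  have h3 := Chebyshev.theta_le_psi x
  have h4 : D * Real.sqrt x ≤ 2 * |D| * x / Real.log x := by
    rw [le_div_iff₀ hl]
    have h5 := log_sq_le (show 1 ≤ x by linarith)
    have h6 : Real.log x ≤ 2 * Real.sqrt x := by
      have : Real.log x ^ 2 ≤ (2 * Real.sqrt x) ^ 2 := by
        rw [mul_pow, Real.sq_sqrt (by linarith)]; linarith
      exact le_of_sq_le_sq this (by positivity)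
    have hs := Real.mul_self_sqrt (show 0 ≤ x by linarith)
    have h7 : D * Real.sqrt x ≤ |D| * Real.sqrt x := by gcongr; exact le_abs_self D
    calc D * Real.sqrt x * Real.log x ≤ |D| * Real.sqrt x * (2 * Real.sqrt x) := by gcongr
      _ = 2 * |D| * (Real.sqrt x * Real.sqrt x) := by ring
      _ = _ := by rw [hs]
  have e : (C + 2 * |D|) * x / Real.log x = C * x / Real.log x + 2 * |D| * x / Real.log x := by ring
  have h8 : 0 ≤ 2 * |D| * x / Real.log x := by positivity
  rw [e]
  rw [abs_le] at *
  constructor <;> linarith [h1.1, h1.2]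

lemma pi_pnt : ∃ C : ℝ, 0 < C ∧ ∀ x : ℝ, 2 ≤ x →
    |(Nat.primeCounting ⌊x⌋₊ : ℝ) - x / Real.log x| ≤ C * x / Real.log x ^ 2 := by
  obtain ⟨C, hC, h⟩ := theta_pnt
  obtain ⟨D, hD⟩ := Chebyshev.primeCounting_sub_theta_div_log_isBigO.bound
  rw [Filter.eventually_atTop] at hD
  obtain ⟨X, hX⟩ := hD
  set M := Real.log (max X 2) with hM
  refine ⟨C + |D| + 2 * M ^ 2 + 2 * M, ?_, ?_⟩
  · have : 0 < M := Real.log_pos (by rw [lt_max_iff]; right; norm_num)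
    positivity
  intro x hx
  have hl : 0 < Real.log x := Real.log_pos (by linarith)
  have hx0 : 0 < x := by linarith
  have hM0 : 0 < M := Real.log_pos (by rw [lt_max_iff]; right; norm_num)
  rcases le_total X x with hXx | hXx
  · have h1 := hX x hXx
    have h2 := h x hx
    rw [Real.norm_eq_abs, Real.norm_eq_abs, abs_of_pos (by positivity : 0 < x / Real.log x ^ 2)] at h1
    have h3 : |Chebyshev.theta x / Real.log x - x / Real.log x| ≤ C * (x / Real.log x ^ 2) := by
      rw [← sub_div, abs_div, abs_of_pos hl, div_le_iff₀ hl]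
      refine h2.trans (le_of_eq ?_)
      field_simp
    have h4 : D * (x / Real.log x ^ 2) ≤ |D| * (x / Real.log x ^ 2) := by
      gcongr; exact le_abs_self D
    have e : (C + |D| + 2 * M ^ 2 + 2 * M) * x / Real.log x ^ 2 = C * (x / Real.log x ^ 2) +
        |D| * (x / Real.log x ^ 2) + (2 * M ^ 2 + 2 * M) * (x / Real.log x ^ 2) := by ring
    have h5 : 0 ≤ (2 * M ^ 2 + 2 * M) * (x / Real.log x ^ 2) := by positivity
    rw [e]
    rw [abs_le] at *
    constructor <;> linarith [h1.1, h1.2, h3.1, h3.2]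
  · have hlM : Real.log x ≤ M := Real.log_le_log hx0 (hXx.trans (le_max_left _ _))
    have hp : (Nat.primeCounting ⌊x⌋₊ : ℝ) ≤ x := by
      have : Nat.primeCounting ⌊x⌋₊ ≤ ⌊x⌋₊ := by
        rw [← Nat.primesLE_card_eq_primeCounting, Nat.primesLE_eq_filter_Icc_one]
        refine (Finset.card_filter_le _ _).trans ?_
        simp
      exact le_trans (by exact_mod_cast this) (Nat.floor_le hx0.le)
    have hp0 : (0 : ℝ) ≤ Nat.primeCounting ⌊x⌋₊ := Nat.cast_nonneg _
    have h1 : x ≤ M ^ 2 * x / Real.log x ^ 2 := by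
      rw [le_div_iff₀ (by positivity)]
      have : Real.log x ^ 2 ≤ M ^ 2 := by gcongr
      nlinarith
    have h2 : x / Real.log x ≤ M * x / Real.log x ^ 2 := by
      rw [div_le_div_iff₀ hl (by positivity)]
      nlinarith [mul_pos hx0 hl]
    have h3 : 0 < x / Real.log x := by positivity
    have h4 : 0 ≤ (C + |D|) * x / Real.log x ^ 2 := by positivity
    have e : (C + |D| + 2 * M ^ 2 + 2 * M) * x / Real.log x ^ 2 = (C + |D|) * x / Real.log x ^ 2 +
      2 * (M ^ 2 * x / Real.log x ^ 2) + 2 * (M * x / Real.log x ^ 2) := by ring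
    rw [e, abs_le]; constructor <;> linarith

end DB

namespace DB

noncomputable def sm (x y : ℝ) : Finset ℕ := (Finset.Icc 1 ⌊x⌋₊).filter
  (fun n => ∀ p : ℕ, p ∈ n.primeFactors → (p : ℝ) ≤ y)

lemma mem_sm {x y : ℝ} {n : ℕ} : n ∈ sm x y ↔ (1 ≤ n ∧ n ≤ ⌊x⌋₊) ∧
    ∀ p : ℕ, p ∈ n.primeFactors → (p : ℝ) ≤ y := by
  rw [sm, Finset.mem_filter, Finset.mem_Icc]

lemma sm_mono {x y y' : ℝ} (h : y ≤ y') : sm x y ⊆ sm x y' := by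
  intro n hn
  rw [mem_sm] at *
  exact ⟨hn.1, fun p hp => (hn.2 p hp).trans h⟩

lemma one_mem_sm {x y : ℝ} (hx : 1 ≤ x) : 1 ∈ sm x y := by
  rw [mem_sm]
  refine ⟨⟨le_rfl, (Nat.one_le_floor_iff x).mpr hx⟩, by simp⟩

lemma sm_card_pos {x y : ℝ} (hx : 1 ≤ x) : 0 < (sm x y).card :=
  Finset.card_pos.mpr ⟨1, one_mem_sm hx⟩

lemma sm_card_le {x y : ℝ} (hx : 1 ≤ x) : ((sm x y).card : ℝ) ≤ x := by
  have : (sm x y).card ≤ ⌊x⌋₊ := by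
    refine (Finset.card_filter_le _ _).trans ?_
    simp
  exact le_trans (by exact_mod_cast this) (Nat.floor_le (by linarith))

lemma fact_lower (m : ℕ) : (m : ℝ) * Real.log m - m ≤ Real.log (m.factorial : ℝ) := by
  induction m with
  | zero => simp
  | succ k ih =>
    rcases Nat.eq_zero_or_pos k with rfl | hk
    · simp
    have hk0 : (0 : ℝ) < k := by exact_mod_cast hk
    rw [Nat.factorial_succ, Nat.cast_mul, Real.log_mul (by positivity) (by positivity)]
    push_cast
    have h := Real.log_le_sub_one_of_pos (x := ((k : ℝ) + 1) / k) (by positivity)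
    rw [Real.log_div (by positivity) (by positivity)] at h
    have h2 : ((k : ℝ) + 1) / k - 1 = 1 / k := by field_simp; ring
    rw [h2] at h
    have h3 : (k : ℝ) * (Real.log (k + 1) - Real.log k) ≤ 1 := by
      calc (k : ℝ) * (Real.log (k + 1) - Real.log k) ≤ k * (1 / k) := by gcongr
        _ = 1 := by field_simp
    nlinarith

lemma fact_upper (m : ℕ) : Real.log (m.factorial : ℝ) ≤ (m + 1 : ℝ) * Real.log m + 1 - m := by
  induction m with
  | zero => simp
  | succ k ih =>
    rcases Nat.eq_zero_or_pos k with rfl | hk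
    · simp
    have hk0 : (0 : ℝ) < k := by exact_mod_cast hk
    rw [Nat.factorial_succ, Nat.cast_mul, Real.log_mul (by positivity) (by positivity)]
    push_cast
    have h := Real.log_le_sub_one_of_pos (x := (k : ℝ) / (k + 1)) (by positivity)
    rw [Real.log_div (by positivity) (by positivity)] at h
    have h2 : (k : ℝ) / (k + 1) - 1 = -(1 / (k + 1)) := by field_simp; ring
    rw [h2] at h
    have h3 : ((k : ℝ) + 1) * (Real.log k - Real.log (k + 1)) ≤ -1 := by
      calc ((k : ℝ) + 1) * (Real.log k - Real.log (k + 1)) ≤ (k + 1) * (-(1 / (k + 1))) := by gcongr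
        _ = -1 := by field_simp
    nlinarith

noncomputable def FF (u v : ℝ) : ℝ := u * Real.log (1 + v / u) + v * Real.log (1 + u / v)

lemma FF_eq {u v : ℝ} (hu : 0 < u) (hv : 0 < v) :
    FF u v = (u + v) * Real.log (u + v) - u * Real.log u - v * Real.log v := by
  have e1 : 1 + v / u = (u + v) / u := by field_simp
  have e2 : 1 + u / v = (u + v) / v := by field_simp; ring
  rw [FF, e1, e2, Real.log_div (by positivity) (by positivity),
    Real.log_div (by positivity) (by positivity)]
  ring

lemma FF_nonneg {u v : ℝ} (hu : 0 < u) (hv : 0 < v) : 0 ≤ FF u v := by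
  have h1 : 0 ≤ Real.log (1 + v / u) := Real.log_nonneg (by have : 0 < v / u := by positivity
                                                            linarith)
  have h2 : 0 ≤ Real.log (1 + u / v) := Real.log_nonneg (by have : 0 < u / v := by positivity
                                                            linarith)
  rw [FF]; positivity

lemma FF_symm (u v : ℝ) : FF u v = FF v u := by rw [FF, FF]; ring

lemma FF_smul {c u v : ℝ} (hc : 0 < c) (hu : 0 < u) (hv : 0 < v) :
    FF (c * u) (c * v) = c * FF u v := by
  rw [FF, FF, mul_div_mul_left _ _ hc.ne', mul_div_mul_left _ _ hc.ne']; ring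

lemma FF_gibbs {u v a b : ℝ} (hu : 0 < u) (hv : 0 < v) (ha : 0 < a) (hb : 0 < b) :
    FF u v ≤ u * Real.log (1 + b / a) + v * Real.log (1 + a / b) := by
  have e1 : 1 + b / a = (a + b) / a := by field_simp
  have e2 : 1 + a / b = (a + b) / b := by field_simp; ring
  have e3 : 1 + v / u = (u + v) / u := by field_simp
  have e4 : 1 + u / v = (u + v) / v := by field_simp; ring
  rw [FF]
  have h1 := Real.log_le_sub_one_of_pos (x := (1 + v / u) / (1 + b / a)) (by positivity)
  have h2 := Real.log_le_sub_one_of_pos (x := (1 + u / v) / (1 + a / b)) (by positivity)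
  rw [Real.log_div (by positivity) (by positivity)] at h1 h2
  have h3 : u * ((1 + v / u) / (1 + b / a) - 1) + v * ((1 + u / v) / (1 + a / b) - 1) = 0 := by
    rw [e1, e2, e3, e4]; field_simp; ring
  nlinarith

lemma FF_mono_left {u u' v : ℝ} (hu : 0 < u) (huu : u ≤ u') (hv : 0 < v) : FF u v ≤ FF u' v := by
  have hu' : 0 < u' := by linarith
  refine (FF_gibbs hu hv hu' hv).trans ?_
  rw [FF]
  have h1 : 0 ≤ Real.log (1 + v / u') := Real.log_nonneg (by have : 0 < v / u' := by positivity
                                                             linarith)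
  gcongr

lemma FF_mono {u u' v v' : ℝ} (hu : 0 < u) (huu : u ≤ u') (hv : 0 < v) (hvv : v ≤ v') :
    FF u v ≤ FF u' v' := by
  refine (FF_mono_left hu huu hv).trans ?_
  rw [FF_symm, FF_symm u']
  exact FF_mono_left hv hvv (by linarith)

lemma choose_lower {n k : ℕ} (hn : 1 ≤ n) (hk : 1 ≤ k) :
    FF k n - 2 * Real.log (n + k) - 2 ≤ Real.log ((n + k - 1).choose k : ℝ) := by
  have hn0 : (0 : ℝ) < n := by exact_mod_cast hn
  have hk0 : (0 : ℝ) < k := by exact_mod_cast hk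
  obtain ⟨m, rfl⟩ : ∃ m, n = m + 1 := ⟨n - 1, by omega⟩
  have hc : ((m + 1 + k - 1).choose k) * k.factorial * m.factorial = (m + k).factorial := by
    have := Nat.choose_mul_factorial_mul_factorial (show k ≤ m + k by omega)
    rw [show m + 1 + k - 1 = m + k by omega]
    rwa [show m + k - k = m by omega] at this
  have hc0 : 0 < (m + 1 + k - 1).choose k := Nat.choose_pos (by omega)
  have hcR := congrArg (fun t : ℕ => Real.log (t : ℝ)) hc
  simp only [Nat.cast_mul] at hcR
  rw [Real.log_mul (by positivity) (by positivity), Real.log_mul (by positivity) (by positivity)] at hcR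
  have f1 := fact_lower (m + k + 1)
  have f2 := fact_upper k
  have f3 := fact_upper (m + 1)
  rw [Nat.factorial_succ, Nat.cast_mul, Real.log_mul (by positivity) (by positivity)] at f1 f3
  have hle : Real.log k ≤ Real.log ((m + 1 : ℕ) + k : ℝ) := Real.log_le_log hk0 (by linarith)
  rw [FF_eq hk0 hn0]
  have e : ((m + k + 1 : ℕ) : ℝ) = (k : ℝ) + ((m + 1 : ℕ) : ℝ) := by push_cast; ring
  have e2 : (((m + 1 : ℕ) : ℝ) + (k : ℝ)) = (k : ℝ) + ((m + 1 : ℕ) : ℝ) := by ring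
  rw [e2] at hle ⊢
  rw [e] at f1
  nlinarith

lemma choose_le_card {x y : ℝ} {k : ℕ} (hy : 2 ≤ y) (hx : 1 ≤ x) (hk : y ^ k ≤ x) :
    (Nat.primeCounting ⌊y⌋₊ + k - 1).choose k ≤ (sm x y).card := by
  classical
  let A := {p // p ∈ Nat.primesLE ⌊y⌋₊}
  have hcard : Fintype.card A = Nat.primeCounting ⌊y⌋₊ := by
    rw [Fintype.card_coe, Nat.primesLE_card_eq_primeCounting]
  rw [← hcard, ← Sym.card_sym_eq_choose, ← Finset.card_univ]
  let f : Sym A k → ℕ := fun m => ((m : Multiset A).map Subtype.val).prod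
  have hpr : ∀ m : Sym A k, ∀ p ∈ (m : Multiset A).map Subtype.val, p.Prime ∧ (p : ℝ) ≤ y := by
    intro m p hp
    obtain ⟨a, _, rfl⟩ := Multiset.mem_map.mp hp
    refine ⟨Nat.prime_of_mem_primesLE a.2, ?_⟩
    exact (Nat.le_floor_iff (by linarith)).mp (Nat.le_of_mem_primesLE a.2)
  have hfac : ∀ m : Sym A k, ((f m).primeFactorsList : Multiset ℕ) = (m : Multiset A).map Subtype.val := by
    intro m
    have h1 : ((m : Multiset A).map Subtype.val).toList.prod = f m := by
      rw [Multiset.prod_toList]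
    have h2 := Nat.primeFactorsList_unique h1
      (fun p hp => (hpr m p (Multiset.mem_toList.mp hp)).1)
    rw [← Multiset.coe_eq_coe.mpr h2, Multiset.coe_toList]
  apply Finset.card_le_card_of_injOn f
  · intro m _
    rw [Finset.mem_coe, mem_sm]
    have hne : f m ≠ 0 := by
      apply Multiset.prod_ne_zero
      intro h0
      exact Nat.not_prime_zero (hpr m 0 h0).1
    have hle : (f m : ℝ) ≤ x := by
      refine le_trans ?_ hk
      have h3 : ((f m : ℕ) : ℝ) = (((m : Multiset A).map Subtype.val).map (Nat.cast : ℕ → ℝ)).prod := by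
        have := map_multiset_prod (Nat.castRingHom ℝ) ((m : Multiset A).map Subtype.val)
        exact this
      have h4 : Multiset.card (((m : Multiset A).map Subtype.val).map (Nat.cast : ℕ → ℝ)) = k := by
        simp
      rw [h3]
      conv_rhs => rw [← h4]
      have h5 : ∀ s : Multiset ℝ, (∀ t ∈ s, 0 ≤ t ∧ t ≤ y) → s.prod ≤ y ^ Multiset.card s ∧ 0 ≤ s.prod := by
        intro s
        induction s using Multiset.induction_on with
        | empty => simp
        | cons a s ih =>
          intro h
          have ih' := ih (fun t ht => h t (Multiset.mem_cons_of_mem ht))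
          have ha := h a (Multiset.mem_cons_self a s)
          rw [Multiset.prod_cons, Multiset.card_cons, pow_succ']
          exact ⟨mul_le_mul ha.2 ih'.1 ih'.2 (by linarith), mul_nonneg ha.1 ih'.2⟩
      refine (h5 _ ?_).1
      intro t ht
      obtain ⟨p, hp, rfl⟩ := Multiset.mem_map.mp ht
      exact ⟨Nat.cast_nonneg _, (hpr m p hp).2⟩
    refine ⟨⟨Nat.pos_of_ne_zero hne, (Nat.le_floor_iff (by linarith)).mpr hle⟩, ?_⟩
    intro p hp
    have : p ∈ ((f m).primeFactorsList : Multiset ℕ) := by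
      rw [Multiset.mem_coe]; exact List.mem_toFinset.mp hp
    rw [hfac] at this
    exact (hpr m p this).2
  · intro m _ m' _ h
    have h1 := hfac m
    have h2 := hfac m'
    have h : f m = f m' := h
    rw [h, h2] at h1
    exact Subtype.ext (Multiset.map_injective Subtype.val_injective h1).symm

end DB

namespace DB

noncomputable def ZZ (L y : ℝ) : ℝ :=
  (L / Real.log y) * Real.log (1 + y / L) + (y / Real.log y) * Real.log (1 + L / y)

section
variable {L y : ℝ}

lemma ZZ_eq_FF (hL : Real.exp 1 ≤ L) (hy : 2 ≤ y) :
    ZZ L y = FF (L / Real.log y) (y / Real.log y) := by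
  have hl : 0 < Real.log y := Real.log_pos (by linarith)
  have hL0 : 0 < L := (Real.exp_pos 1).trans_le hL
  rw [ZZ, FF]
  congr 3
  · congr 1; field_simp
  · congr 1; field_simp

lemma t1_nonneg (hL : Real.exp 1 ≤ L) (hy : 2 ≤ y) :
    0 ≤ (L / Real.log y) * Real.log (1 + y / L) := by
  have hl : 0 < Real.log y := Real.log_pos (by linarith)
  have hL0 : 0 < L := (Real.exp_pos 1).trans_le hL
  have : 0 ≤ Real.log (1 + y / L) := Real.log_nonneg (by
    have : 0 < y / L := by positivity
    linarith)
  positivity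

lemma t2_nonneg (hL : Real.exp 1 ≤ L) (hy : 2 ≤ y) :
    0 ≤ (y / Real.log y) * Real.log (1 + L / y) := by
  have hl : 0 < Real.log y := Real.log_pos (by linarith)
  have hL0 : 0 < L := (Real.exp_pos 1).trans_le hL
  have : 0 ≤ Real.log (1 + L / y) := Real.log_nonneg (by
    have : 0 < L / y := by positivity
    linarith)
  positivity

lemma Z_ge1 (hL : Real.exp 1 ≤ L) (hy : 2 ≤ y) :
    (L / Real.log y) * Real.log (1 + y / L) ≤ ZZ L y := by
  have := t2_nonneg hL hy
  rw [ZZ]; linarith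

lemma Z_ge2 (hL : Real.exp 1 ≤ L) (hy : 2 ≤ y) :
    (y / Real.log y) * Real.log (1 + L / y) ≤ ZZ L y := by
  have := t1_nonneg hL hy
  rw [ZZ]; linarith

lemma ZZ_nonneg (hL : Real.exp 1 ≤ L) (hy : 2 ≤ y) : 0 ≤ ZZ L y :=
  (t1_nonneg hL hy).trans (Z_ge1 hL hy)

lemma L_ge (hL : Real.exp 1 ≤ L) : 2.7 ≤ L := by
  have := Real.exp_one_gt_d9
  norm_num at *; linarith

lemma ell_ge (hL : Real.exp 1 ≤ L) : 1 ≤ Real.log L := by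
  rw [Real.le_log_iff_exp_le ((Real.exp_pos 1).trans_le hL)]; exact hL

lemma sig_lt (hL : Real.exp 1 ≤ L) (hy : 2 ≤ y) : 1 + y / L < y := by
  have h1 := L_ge hL
  have : y / L ≤ y / 2.7 := by gcongr
  norm_num at *; linarith

lemma Z_le (hL : Real.exp 1 ≤ L) (hy : 2 ≤ y) : ZZ L y ≤ L + L / Real.log y := by
  have hl : 0 < Real.log y := Real.log_pos (by linarith)
  have hL0 : 0 < L := (Real.exp_pos 1).trans_le hL
  have a : (L / Real.log y) * Real.log (1 + y / L) ≤ (L / Real.log y) * Real.log y := by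
    gcongr; exact (sig_lt hL hy).le
  have b : (y / Real.log y) * Real.log (1 + L / y) ≤ (y / Real.log y) * (L / y) := by
    gcongr
    have := Real.log_le_sub_one_of_pos (x := 1 + L / y) (by positivity)
    linarith
  have e1 : (L / Real.log y) * Real.log y = L := by field_simp
  have e2 : (y / Real.log y) * (L / y) = L / Real.log y := by
    have : y ≠ 0 := by linarith
    field_simp
  rw [ZZ]; linarith

lemma Z_ge3 (hL : Real.exp 1 ≤ L) (hy : 2 ≤ y) : L - (L / Real.log y) * Real.log L ≤ ZZ L y := by
  have hl : 0 < Real.log y := Real.log_pos (by linarith)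
  have hL0 : 0 < L := (Real.exp_pos 1).trans_le hL
  refine le_trans ?_ (Z_ge1 hL hy)
  have h : Real.log y - Real.log L ≤ Real.log (1 + y / L) := by
    rw [← Real.log_div (by linarith) hL0.ne']
    apply Real.log_le_log (by positivity); linarith
  have e1 : (L / Real.log y) * Real.log y = L := by field_simp
  calc L - (L / Real.log y) * Real.log L = (L / Real.log y) * (Real.log y - Real.log L) := by
        rw [mul_sub, e1]
    _ ≤ _ := by gcongr

lemma log_sqrt_bound {t : ℝ} (ht : 1 ≤ t) : Real.log t ≤ 0.741 * Real.sqrt t := by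
  have ht0 : 0 < t := by linarith
  have h := Real.add_one_le_exp (Real.log t / 2 - 1)
  rw [Real.exp_sub] at h
  have h2 : Real.exp (Real.log t / 2) = Real.sqrt t := by
    rw [← Real.log_sqrt ht0.le, Real.exp_log (Real.sqrt_pos.mpr ht0)]
  rw [h2, le_div_iff₀ (Real.exp_pos 1)] at h
  have := Real.exp_one_gt_d9
  have h0 := Real.log_nonneg ht
  norm_num at *
  nlinarith

lemma log_sq_bound {t : ℝ} (ht : 1 ≤ t) : Real.log t ^ 2 ≤ 0.55 * t := by
  have h := log_sqrt_bound ht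
  have h0 := Real.log_nonneg ht
  have h2 := Real.sq_sqrt (show 0 ≤ t by linarith)
  calc Real.log t ^ 2 ≤ (0.741 * Real.sqrt t) ^ 2 := by gcongr
    _ = 0.741 ^ 2 * t := by rw [mul_pow, h2]
    _ ≤ _ := by norm_num; linarith

lemma log_pow_bound {t : ℝ} (ht : 1 ≤ t) (n : ℕ) : Real.log t ^ n ≤ n.factorial * t := by
  have := Real.pow_div_factorial_le_exp (Real.log t) (Real.log_nonneg ht) n
  rw [Real.exp_log (by linarith), div_le_iff₀ (by positivity)] at this
  linarith

lemma log2_le_log (hy : 2 ≤ y) : 0.69 ≤ Real.log y := by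
  have := Real.log_two_gt_d9
  have h2 := Real.log_le_log (by norm_num) hy
  norm_num at *; linarith

lemma key_lower (hL : Real.exp 1 ≤ L) (hy : 2 ≤ y) (h : Real.log y ≤ L / Real.log L) :
    Real.log L * Real.log y ≤ 40 * ZZ L y := by
  have hl : 0 < Real.log y := Real.log_pos (by linarith)
  have hL0 : 0 < L := (Real.exp_pos 1).trans_le hL
  have hl1 := ell_ge hL
  have hL1 := L_ge hL
  have hL1' : 1 ≤ L := by norm_num at hL1; linarith
  have hy0 : 0 < y := by linarith
  have hz := ZZ_nonneg hL hy
  set l := Real.log L with hl_def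
  have hlog2 : 0.69 ≤ Real.log 2 := log2_le_log le_rfl
  rcases le_total L y with hLy | hLy
  · have z1 := Z_ge1 hL hy
    rcases le_total (L ^ 2) y with h2 | h2
    · have h3 : Real.log y / 2 ≤ Real.log (1 + y / L) := by
        rw [← Real.log_sqrt hy0.le]
        apply Real.log_le_log (Real.sqrt_pos.mpr hy0)
        have : L ≤ Real.sqrt y := Real.le_sqrt_of_sq_le h2
        have h4 : Real.sqrt y ≤ y / L := by
          rw [le_div_iff₀ hL0]
          have := Real.mul_self_sqrt hy0.le
          nlinarith [Real.sqrt_nonneg y]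
        linarith
      have h5 : L / 2 ≤ ZZ L y := by
        refine le_trans ?_ z1
        calc L / 2 = (L / Real.log y) * (Real.log y / 2) := by field_simp
          _ ≤ _ := by gcongr
      have h6 : Real.log y * l ≤ L := by rwa [le_div_iff₀ (by linarith)] at h
      linarith
    · have h3 : Real.log y ≤ 2 * l := by
        have := Real.log_le_log hy0 h2
        rwa [Real.log_pow, Nat.cast_ofNat] at this
      have h4 : Real.log 2 ≤ Real.log (1 + y / L) := by
        apply Real.log_le_log (by norm_num)
        have : 1 ≤ y / L := by rwa [le_div_iff₀ hL0, one_mul]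
        linarith
      have h5 : (L / (2 * l)) * 0.69 ≤ ZZ L y := by
        refine le_trans ?_ z1
        gcongr
        linarith
      have h6 := log_pow_bound hL1' 3
      rw [← hl_def] at h6
      norm_num [Nat.factorial] at h6
      have h7 : l ^ 2 ≤ 6 * (L / l) := by
        rw [mul_div_assoc', le_div_iff₀ (by linarith)]
        nlinarith
      have h8 : (L / (2 * l)) * 0.69 = 0.345 * (L / l) := by field_simp; norm_num
      rw [h8] at h5
      norm_num at h5
      nlinarith
  · have z2 := Z_ge2 hL hy
    rcases le_total L (y ^ 2) with h2 | h2
    · have h3 : l ≤ 2 * Real.log y := by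
        have := Real.log_le_log hL0 h2
        rwa [Real.log_pow, Nat.cast_ofNat] at this
      have h4 : Real.log 2 ≤ Real.log (1 + L / y) := by
        apply Real.log_le_log (by norm_num)
        have : 1 ≤ L / y := by rwa [le_div_iff₀ hy0, one_mul]
        linarith
      have h5 : (y / Real.log y) * 0.69 ≤ ZZ L y := by
        refine le_trans ?_ z2
        gcongr
        linarith
      have h6 := log_pow_bound (show 1 ≤ y by linarith) 3
      norm_num [Nat.factorial] at h6
      have h7 : Real.log y ^ 2 ≤ 6 * (y / Real.log y) := by
        rw [mul_div_assoc', le_div_iff₀ hl]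
        nlinarith
      norm_num at h5
      nlinarith
    · have h3 : l / 2 ≤ Real.log (1 + L / y) := by
        rw [hl_def, ← Real.log_sqrt hL0.le]
        apply Real.log_le_log (Real.sqrt_pos.mpr hL0)
        have : y ≤ Real.sqrt L := Real.le_sqrt_of_sq_le h2
        have h4 : Real.sqrt L ≤ L / y := by
          rw [le_div_iff₀ hy0]
          have := Real.mul_self_sqrt hL0.le
          nlinarith [Real.sqrt_nonneg L]
        linarith
      have h5 : (y / Real.log y) * (l / 2) ≤ ZZ L y := by
        refine le_trans ?_ z2
        gcongr
      have h6 := log_sq_le (show 1 ≤ y by linarith)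
      have h7 : Real.log y ≤ 4 * (y / Real.log y) := by
        rw [mul_div_assoc', le_div_iff₀ hl]
        nlinarith
      have h8 : l * Real.log y ≤ l * (4 * (y / Real.log y)) := by gcongr
      linarith

end

lemma exp_one_le_log {x : ℝ} (hx : 16 ≤ x) : Real.exp 1 ≤ Real.log x := by
  have h1 : Real.log 16 ≤ Real.log x := Real.log_le_log (by norm_num) hx
  have h2 : Real.log 16 = 4 * Real.log 2 := by
    rw [show (16 : ℝ) = 2 ^ 4 by norm_num, Real.log_pow]; norm_num
  have := Real.log_two_gt_d9
  have := Real.exp_one_lt_d9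
  norm_num at *
  linarith

lemma lower_raw : ∃ C : ℝ, 0 < C ∧ ∀ x y : ℝ, 16 ≤ x → 2 ≤ y → y ≤ x →
    ZZ (Real.log x) y * (1 - Real.log y / Real.log x - C / Real.log y) -
      2 * (Real.log y + Real.log (Real.log x)) - 3 ≤ Real.log ((sm x y).card) := by
  obtain ⟨C, hC, hpi⟩ := pi_pnt
  refine ⟨C, hC, ?_⟩
  intro x y hx hy hyx
  have hL := exp_one_le_log hx
  have hx0 : 0 < x := by linarith
  set L := Real.log x with hLdef
  have hl : 0 < Real.log y := Real.log_pos (by linarith)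
  have hL0 : 0 < L := (Real.exp_pos 1).trans_le hL
  have hl1 := ell_ge hL
  have hL1 := L_ge hL
  have hl2 := log2_le_log hy
  norm_num at hL1 hl2
  have hz := ZZ_nonneg hL hy
  have hcard : (1 : ℝ) ≤ (sm x y).card := by
    exact_mod_cast sm_card_pos (x := x) (y := y) (by linarith)
  set c := 1 - Real.log y / L - C / Real.log y with hc
  rcases le_total c 0 with hc0 | hc0'
  · have h1 := Real.log_nonneg hcard
    nlinarith
  rcases hc0'.eq_or_lt with hc0 | hc0
  · have h1 := Real.log_nonneg hcard
    rw [← hc0]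
    linarith
  have hly : Real.log y ≤ L := Real.log_le_log (by linarith) hyx
  set u := L / Real.log y with hu
  set v := y / Real.log y with hv
  have hu1 : 1 ≤ u := by rwa [hu, le_div_iff₀ hl, one_mul]
  have hv0 : 0 < v := by positivity
  set k := ⌊u⌋₊ with hk
  set n := Nat.primeCounting ⌊y⌋₊ with hn
  have hk1 : 1 ≤ k := (Nat.one_le_floor_iff u).mpr hu1
  have hku : (k : ℝ) ≤ u := Nat.floor_le (by linarith)
  have hku2 : u - 1 < k := by have := Nat.lt_floor_add_one u; linarith
  have hcp : 0 < C / Real.log y := by positivity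
  have hcp2 : 0 < Real.log y / L := by positivity
  have hkc : c * u ≤ k := by
    have : (Real.log y / L) * u = 1 := by rw [hu]; field_simp
    have h2 : c * u = u - (Real.log y / L) * u - (C / Real.log y) * u := by rw [hc]; ring
    rw [h2, this]
    have : 0 < (C / Real.log y) * u := by positivity
    linarith
  have hnc : c * v ≤ n := by
    have h1 := (abs_le.mp (hpi y hy)).1
    have h2 : c * v = v - (Real.log y / L) * v - (C / Real.log y) * v := by rw [hc]; ring
    have h3 : (C / Real.log y) * v = C * y / Real.log y ^ 2 := by rw [hv]; field_simp
    rw [h2, h3]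
    have : 0 < (Real.log y / L) * v := by positivity
    linarith
  have hu0 : 0 < u := by linarith
  have hn0 : (0 : ℝ) < n := lt_of_lt_of_le (by positivity) hnc
  have hn1 : 1 ≤ n := by exact_mod_cast hn0
  have hny : (n : ℝ) ≤ y := by
    have : n ≤ ⌊y⌋₊ := by
      rw [hn, ← Nat.primesLE_card_eq_primeCounting, Nat.primesLE_eq_filter_Icc_one]
      refine (Finset.card_filter_le _ _).trans ?_
      simp
    exact le_trans (by exact_mod_cast this) (Nat.floor_le (by linarith))
  have hFF : c * ZZ L y ≤ FF k n := by
    rw [ZZ_eq_FF hL hy, ← FF_smul hc0 hu0 hv0]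
    exact FF_mono (by positivity) hkc (by positivity) hnc
  have hyk : y ^ k ≤ x := by
    rw [← Real.log_le_log_iff (by positivity) hx0, Real.log_pow]
    calc (k : ℝ) * Real.log y ≤ u * Real.log y := by gcongr
      _ = L := by rw [hu]; field_simp
  have h1 := choose_le_card hy (by linarith) hyk
  have h2 := choose_lower hn1 hk1
  have h3 : Real.log ((n + k - 1).choose k : ℝ) ≤ Real.log ((sm x y).card) := by
    apply Real.log_le_log
    · have : 0 < (n + k - 1).choose k := Nat.choose_pos (by omega)
      exact_mod_cast this
    · exact_mod_cast h1
  have h4 : Real.log (n + k) ≤ Real.log y + Real.log L + 1 / 2 := by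
    have hu2 : u ≤ 1.5 * L := by
      rw [hu, div_le_iff₀ hl]; norm_num; nlinarith
    have h5 : (n : ℝ) + k ≤ 1.5 * (y * L) := by
      norm_num at hu2 ⊢
      nlinarith
    have h6 : Real.log 1.5 ≤ 1 / 2 := by
      have := Real.log_le_sub_one_of_pos (x := 1.5) (by norm_num)
      norm_num at *; linarith
    calc Real.log (n + k) ≤ Real.log (1.5 * (y * L)) := Real.log_le_log (by positivity) h5
      _ = Real.log 1.5 + (Real.log y + Real.log L) := by
        rw [Real.log_mul (by norm_num) (by positivity), Real.log_mul (by positivity) (by positivity)]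
      _ ≤ _ := by linarith
  linarith

lemma lower_small : ∃ C : ℝ, 0 < C ∧ ∀ x y : ℝ, 16 ≤ x → 2 ≤ y → y ≤ x →
    Real.log y ≤ Real.log x / Real.log (Real.log x) →
    ZZ (Real.log x) y - C * ZZ (Real.log x) y * (1 / Real.log y + 1 / Real.log (Real.log x)) ≤
      Real.log ((sm x y).card) := by
  obtain ⟨C, hC, h⟩ := lower_raw
  refine ⟨C + 201, by positivity, ?_⟩
  intro x y hx hy hyx hyl
  have h1 := h x y hx hy hyx
  have hL := exp_one_le_log hx
  set L := Real.log x with hLdef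
  have hl : 0 < Real.log y := Real.log_pos (by linarith)
  have hL0 : 0 < L := (Real.exp_pos 1).trans_le hL
  have hl1 := ell_ge hL
  have hz := ZZ_nonneg hL hy
  have hk := key_lower hL hy hyl
  set l := Real.log L with hldef
  have hl0 : 0 < l := by linarith
  have h2 : Real.log y / L ≤ 1 / l := by
    rw [div_le_div_iff₀ hL0 hl0]
    rw [le_div_iff₀ hl0] at hyl
    linarith
  have e1 : Real.log y + l = (l * Real.log y) * (1 / Real.log y + 1 / l) := by field_simp; ring
  have hE : 0 < 1 / Real.log y + 1 / l := by positivity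
  have h3 : Real.log y + l ≤ 40 * ZZ L y * (1 / Real.log y + 1 / l) := by
    rw [e1]; gcongr
  have h4 : ZZ L y * (Real.log y / L) ≤ ZZ L y * (1 / l) := by gcongr
  have h5 : ZZ L y * (1 - Real.log y / L - C / Real.log y) = ZZ L y - ZZ L y * (Real.log y / L) -
    C * (ZZ L y * (1 / Real.log y)) := by ring
  rw [h5] at h1
  have p1 : 0 ≤ ZZ L y * (1 / Real.log y) := by positivity
  have p2 : 0 ≤ ZZ L y * (1 / l) := by positivity
  have p3 : 0 ≤ C * (ZZ L y * (1 / l)) := by positivity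
  have e2 : (C + 201) * ZZ L y * (1 / Real.log y + 1 / l) = C * (ZZ L y * (1 / Real.log y)) +
    C * (ZZ L y * (1 / l)) + 5 * (40 * ZZ L y * (1 / Real.log y + 1 / l)) +
      (ZZ L y * (1 / Real.log y) + ZZ L y * (1 / l)) := by ring
  rw [e2]
  linarith

lemma lower : ∃ C : ℝ, 0 < C ∧ ∀ x y : ℝ, 16 ≤ x → 2 ≤ y → y ≤ x →
    ZZ (Real.log x) y - C * ZZ (Real.log x) y * (1 / Real.log y + 1 / Real.log (Real.log x)) ≤
      Real.log ((sm x y).card) := by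
  obtain ⟨C, hC, h⟩ := lower_small
  refine ⟨10 * C + 20, by positivity, ?_⟩
  intro x y hx hy hyx
  have hL := exp_one_le_log hx
  have hll : 0 < Real.log y := Real.log_pos (by linarith)
  have hz := ZZ_nonneg hL hy
  have hl1 := ell_ge hL
  have hL1 := L_ge hL
  rcases le_or_gt (Real.log y) (Real.log x / Real.log (Real.log x)) with hyl | hyl
  · have h1 := h x y hx hy hyx hyl
    refine le_trans ?_ h1
    have : 0 ≤ ZZ (Real.log x) y * (1 / Real.log y + 1 / Real.log (Real.log x)) := by positivity
    nlinarith
  · set L := Real.log x with hLdef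
    have hL0 : 0 < L := (Real.exp_pos 1).trans_le hL
    set l := Real.log L with hldef
    have hl0 : 0 < l := by linarith
    have hL1' : 1 ≤ L := by norm_num at hL1; linarith
    have q2 := log_sq_bound hL1'
    have q3 := log_pow_bound hL1' 3
    rw [← hldef] at q2 q3
    norm_num [Nat.factorial] at q3 q2
    have hq : 1 ≤ L / l := by rw [le_div_iff₀ hl0]; nlinarith
    set y0 := Real.exp (L / l) with hy0
    have hly0 : Real.log y0 = L / l := Real.log_exp _
    have hy02 : 2 ≤ y0 := by
      have := Real.add_one_le_exp (L / l); linarith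
    have hy0y : y0 ≤ y := by
      rw [← Real.exp_log (show 0 < y by linarith)]
      exact Real.exp_le_exp.mpr hyl.le
    have h1 := h x y0 hx hy02 (hy0y.trans hyx) (by rw [hly0])
    have hmono : Real.log ((sm x y0).card) ≤ Real.log ((sm x y).card) := by
      apply Real.log_le_log
      · exact_mod_cast sm_card_pos (x := x) (y := y0) (by linarith)
      · exact_mod_cast Finset.card_le_card (sm_mono hy0y)
    have z0 := Z_le hL hy02
    have z0' := Z_ge3 hL hy02
    have z1 := Z_le hL hy
    have z1' := Z_ge3 hL hy
    rw [← hLdef] at h1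
    rw [hly0] at z0 z0' h1
    rw [← hldef] at z0' z1' h1
    have e1 : L / (L / l) = l := by field_simp
    rw [e1] at z0 z0'
    have hu : L / Real.log y ≤ l := by
      rw [div_le_iff₀ hll]
      rw [div_lt_iff₀ hl0] at hyl
      linarith
    have r1 : l ≤ L / l := by rw [le_div_iff₀ hl0]; nlinarith
    have r2 : l * l ≤ 6 * (L / l) := by
      rw [mul_div_assoc', le_div_iff₀ hl0]; nlinarith
    have r3 : 1 / (L / l) ≤ 1 / l := by
      exact one_div_le_one_div_of_le hl0 r1
    have r4 : L / Real.log y * l ≤ l * l := by gcongr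
    have hz0 := ZZ_nonneg hL hy02
    have r5 : C * ZZ L y0 * (1 / (L / l) + 1 / l) ≤ C * (2 * L) * (2 * (1 / l)) := by
      gcongr
      · nlinarith
      · linarith
    have r6 : C * (2 * L) * (2 * (1 / l)) = 4 * C * (L / l) := by ring
    have r7 : L ≤ 2.5 * ZZ L y := by norm_num; nlinarith
    have r8 : L / l ≤ 2.5 * (ZZ L y * (1 / l)) := by
      calc L / l ≤ (2.5 * ZZ L y) / l := by gcongr
        _ = _ := by ring
    have r9 : 0 ≤ ZZ L y * (1 / Real.log y) := by positivity
    have r10 : (4 * C + 8) * (L / l) ≤ (4 * C + 8) * (2.5 * (ZZ L y * (1 / l))) := by gcongr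
    have e5 : (10 * C + 20) * ZZ L y * (1 / Real.log y + 1 / l) =
      (10 * C + 20) * (ZZ L y * (1 / Real.log y)) + (4 * C + 8) * (2.5 * (ZZ L y * (1 / l))) := by ring
    have r11 : 0 ≤ (10 * C + 20) * (ZZ L y * (1 / Real.log y)) := by positivity
    rw [e5]
    linarith

end DB

namespace DB

noncomputable def powHom (σ : ℝ) : ℕ →* ℝ where
  toFun n := (n : ℝ) ^ (-σ)
  map_one' := by simp
  map_mul' a b := by
    push_cast
    rw [Real.mul_rpow (by positivity) (by positivity)]

lemma rpow_neg_lt_one {σ : ℝ} (hσ : 0 < σ) {t : ℝ} (ht : 1 < t) : t ^ (-σ) < 1 :=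
  Real.rpow_lt_one_of_one_lt_of_neg ht (by linarith)

/-- Rankin bound. -/
lemma rankin {x y σ : ℝ} (hx : 1 ≤ x) (hσ : 0 < σ) :
    Real.log ((sm x y).card) ≤ σ * Real.log x +
      ∑ p ∈ Nat.primesLE ⌊y⌋₊, (-Real.log (1 - (p : ℝ) ^ (-σ))) := by
  have hx0 : 0 < x := by linarith
  have hlt : ∀ {p : ℕ}, p.Prime → ‖powHom σ p‖ < 1 := by
    intro p hp
    have h1 : (1 : ℝ) < p := by exact_mod_cast hp.one_lt
    change ‖(p : ℝ) ^ (-σ)‖ < 1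
    rw [Real.norm_of_nonneg (by positivity)]
    exact rpow_neg_lt_one hσ h1
  have hE := (EulerProduct.summable_and_hasSum_smoothNumbers_prod_primesBelow_geometric
    hlt (⌊y⌋₊ + 1)).2
  have hsub : ∀ n ∈ sm x y, n ∈ Nat.smoothNumbers (⌊y⌋₊ + 1) := by
    intro n hn
    rw [mem_sm] at hn
    rw [Nat.mem_smoothNumbers']
    intro p hp hd
    have := hn.2 p (Nat.mem_primeFactors.mpr ⟨hp, hd, by omega⟩)
    have := Nat.le_floor this
    omega
  have h1 : ∑ n ∈ sm x y, powHom σ n ≤ ∏ p ∈ (⌊y⌋₊ + 1).primesBelow, (1 - powHom σ p)⁻¹ := by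
    have := sum_le_hasSum ((sm x y).subtype (fun n => n ∈ Nat.smoothNumbers (⌊y⌋₊ + 1)))
      (fun i _ => by change 0 ≤ ((i : ℕ) : ℝ) ^ (-σ); positivity) hE
    refine le_trans (le_of_eq ?_) this
    rw [Finset.sum_subtype_of_mem (fun n => powHom σ n) hsub]
  have h2 : ((sm x y).card : ℝ) * x ^ (-σ) ≤ ∑ n ∈ sm x y, powHom σ n := by
    rw [← nsmul_eq_mul, ← Finset.sum_const]
    refine Finset.sum_le_sum ?_
    intro n hn
    rw [mem_sm] at hn
    have hn0 : (0 : ℝ) < n := by exact_mod_cast hn.1.1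
    have hnx : (n : ℝ) ≤ x := (Nat.le_floor_iff hx0.le).mp hn.1.2
    exact Real.rpow_le_rpow_of_nonpos hn0 hnx (by linarith)
  have hc : (0 : ℝ) < (sm x y).card := by exact_mod_cast sm_card_pos hx
  have h3 := Real.log_le_log (by positivity) (h2.trans h1)
  rw [Real.log_mul hc.ne' (by positivity), Real.log_rpow hx0, Real.log_prod] at h3
  · have e : ∑ p ∈ (⌊y⌋₊ + 1).primesBelow, Real.log ((1 - powHom σ p)⁻¹) =
        ∑ p ∈ Nat.primesLE ⌊y⌋₊, (-Real.log (1 - (p : ℝ) ^ (-σ))) := by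
      refine Finset.sum_congr rfl fun p _ => ?_
      rw [Real.log_inv]; rfl
    rw [e] at h3
    linarith
  · intro p hp
    have hp' : p.Prime := Nat.prime_of_mem_primesBelow hp
    have := hlt hp'
    rw [Real.norm_eq_abs, abs_lt] at this
    exact inv_ne_zero (by linarith [this.2])

lemma abel_major (a b : ℕ → ℝ) (c : ℝ) (hb : ∀ n, 1 ≤ n → b (n + 1) ≤ b n) (hb0 : ∀ n, 0 ≤ b n)
    (ha : ∀ N : ℕ, ∑ n ∈ Finset.Icc 1 N, a n ≤ c * N) (N : ℕ) :
    ∑ n ∈ Finset.Icc 1 N, a n * b n ≤ c * ∑ n ∈ Finset.Icc 1 N, b n := by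
  have key : ∀ N : ℕ, b N * (c * N - ∑ n ∈ Finset.Icc 1 N, a n) ≤
      c * ∑ n ∈ Finset.Icc 1 N, b n - ∑ n ∈ Finset.Icc 1 N, a n * b n := by
    intro N
    induction N with
    | zero => simp
    | succ k ih =>
      rw [Finset.sum_Icc_succ_top (by omega), Finset.sum_Icc_succ_top (by omega),
        Finset.sum_Icc_succ_top (by omega)]
      have h2 : b (k + 1) * (c * k - ∑ n ∈ Finset.Icc 1 k, a n) ≤
          b k * (c * k - ∑ n ∈ Finset.Icc 1 k, a n) := by
        rcases Nat.eq_zero_or_pos k with rfl | hk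
        · simp
        · exact mul_le_mul_of_nonneg_right (hb k hk) (by linarith [ha k])
      push_cast
      nlinarith
  have := key N
  have h2 := mul_nonneg (hb0 N) (show 0 ≤ c * N - ∑ n ∈ Finset.Icc 1 N, a n by linarith [ha N])
  linarith

lemma sum_rpow_le {τ : ℝ} (h0 : 0 < τ) (h1 : τ < 1) (N : ℕ) :
    ∑ n ∈ Finset.Icc 1 N, (n : ℝ) ^ (-τ) ≤ (N : ℝ) ^ (1 - τ) / (1 - τ) := by
  have hd : 0 < 1 - τ := by linarith
  induction N with
  | zero => simp; positivity
  | succ k ih =>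
    rw [Finset.sum_Icc_succ_top (by omega)]
    refine (add_le_add_left ih _).trans ?_
    rw [div_add' _ _ _ hd.ne', div_le_div_iff_of_pos_right hd]
    have hM : (0 : ℝ) < ((k + 1 : ℕ) : ℝ) := by positivity
    have hM1 : (1 : ℝ) ≤ ((k + 1 : ℕ) : ℝ) := by push_cast; linarith [(Nat.cast_nonneg k : (0:ℝ) ≤ k)]
    set M : ℝ := ((k + 1 : ℕ) : ℝ) with hMd
    have hk : (k : ℝ) = M * (1 + (-(1 / M))) := by rw [hMd]; push_cast; field_simp; ring
    have hi : 1 / M ≤ 1 := by rw [div_le_one hM]; exact hM1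
    have hB := rpow_one_add_le_one_add_mul_self (s := -(1 / M)) (by linarith) hd.le
      (by linarith)
    rw [hk, Real.mul_rpow hM.le (by linarith)]
    have e1 : M ^ (-τ) = M ^ (1 - τ) * (1 / M) := by
      rw [show -τ = (1 - τ) - 1 by ring, Real.rpow_sub_one hM.ne']; ring
    rw [e1]
    have hp : 0 < M ^ (1 - τ) := by positivity
    nlinarith [mul_le_mul_of_nonneg_left hB hp.le]

lemma sum_log_rpow {τ y : ℝ} (h0 : 0 < τ) (h1 : τ < 1) (hy : 2 ≤ y) :
    ∑ p ∈ Nat.primesLE ⌊y⌋₊, Real.log p * (p : ℝ) ^ (-τ) ≤ 1.5 * (y ^ (1 - τ) / (1 - τ)) := by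
  have hd : 0 < 1 - τ := by linarith
  have hset : ∀ N : ℕ, Nat.primesLE N = (Finset.Icc 1 N).filter Nat.Prime := by
    intro N; ext p
    rw [Nat.mem_primesLE, Finset.mem_filter, Finset.mem_Icc]
    constructor
    · rintro ⟨h, hp⟩; exact ⟨⟨hp.one_le, h⟩, hp⟩
    · rintro ⟨h, hp⟩; exact ⟨h.2, hp⟩
  have hl4 : Real.log 4 ≤ 1.5 := by
    have := Real.log_two_lt_d9
    rw [show (4 : ℝ) = 2 ^ 2 by norm_num, Real.log_pow]; norm_num at *; linarith
  have hA := abel_major (fun n => if n.Prime then Real.log n else 0) (fun n => (n : ℝ) ^ (-τ)) 1.5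
    (fun n hn => Real.rpow_le_rpow_of_nonpos (by exact_mod_cast hn) (by push_cast; linarith)
      (by linarith)) (fun n => by positivity) (by
        intro N
        rw [← Finset.sum_filter, ← hset, ← Chebyshev.theta_eq_sum_primesLE_log]
        refine (Chebyshev.theta_le_log4_mul_x (by positivity)).trans ?_
        gcongr) ⌊y⌋₊
  rw [hset, Finset.sum_filter]
  refine le_trans (le_of_eq ?_) (hA.trans ?_)
  · refine Finset.sum_congr rfl fun n _ => ?_
    split_ifs <;> simp
  · refine mul_le_mul_of_nonneg_left ?_ (by norm_num)
    refine (sum_rpow_le h0 h1 _).trans ?_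
    gcongr
    exact Nat.floor_le (by linarith)

/-- primes in `(√y, y]`. -/
noncomputable def PB (y : ℝ) : Finset ℕ := (Nat.primesLE ⌊y⌋₊).filter (fun p => y < (p : ℝ) ^ 2)
/-- primes up to `√y`. -/
noncomputable def PS (y : ℝ) : Finset ℕ := (Nat.primesLE ⌊y⌋₊).filter (fun p => ¬ y < (p : ℝ) ^ 2)

lemma sum_split (y : ℝ) (f : ℕ → ℝ) :
    ∑ p ∈ Nat.primesLE ⌊y⌋₊, f p = ∑ p ∈ PB y, f p + ∑ p ∈ PS y, f p :=
  (Finset.sum_filter_add_sum_filter_not _ _ _).symm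

lemma mem_LE {y : ℝ} (hy : 2 ≤ y) {p : ℕ} (hp : p ∈ Nat.primesLE ⌊y⌋₊) :
    (2 : ℝ) ≤ p ∧ (p : ℝ) ≤ y := by
  rw [Nat.mem_primesLE] at hp
  exact ⟨by exact_mod_cast hp.2.two_le, (Nat.le_floor_iff (by linarith)).mp hp.1⟩

lemma mem_PB {y : ℝ} (hy : 2 ≤ y) {p : ℕ} (hp : p ∈ PB y) :
    (2 : ℝ) ≤ p ∧ (p : ℝ) ≤ y ∧ Real.log y ≤ 2 * Real.log p := by
  rw [PB, Finset.mem_filter] at hp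
  obtain ⟨h1, h2⟩ := mem_LE hy hp.1
  refine ⟨h1, h2, ?_⟩
  have := Real.log_le_log (by linarith) hp.2.le
  rw [Real.log_pow] at this
  exact_mod_cast this

lemma mem_PS {y : ℝ} (hy : 2 ≤ y) {p : ℕ} (hp : p ∈ PS y) :
    (2 : ℝ) ≤ p ∧ (p : ℝ) ≤ y ∧ (p : ℝ) ≤ Real.sqrt y := by
  rw [PS, Finset.mem_filter] at hp
  obtain ⟨h1, h2⟩ := mem_LE hy hp.1
  exact ⟨h1, h2, Real.le_sqrt_of_sq_le (not_lt.mp hp.2)⟩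

lemma PS_sub {y : ℝ} (hy : 2 ≤ y) : PS y ⊆ Finset.Icc 1 ⌊Real.sqrt y⌋₊ := by
  intro p hp
  obtain ⟨h1, _, h3⟩ := mem_PS hy hp
  rw [Finset.mem_Icc]
  refine ⟨?_, Nat.le_floor h3⟩
  have : (1 : ℝ) ≤ p := by linarith
  exact_mod_cast this

lemma PS_card {y : ℝ} (hy : 2 ≤ y) : ((PS y).card : ℝ) ≤ Real.sqrt y := by
  have := Finset.card_le_card (PS_sub hy)
  rw [Nat.card_Icc, Nat.add_sub_cancel] at this
  exact le_trans (by exact_mod_cast this) (Nat.floor_le (Real.sqrt_nonneg y))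

lemma PB_sum {τ y : ℝ} (h0 : 0 < τ) (h1 : τ < 1) (hy : 2 ≤ y) :
    ∑ p ∈ PB y, (p : ℝ) ^ (-τ) ≤ 3 / Real.log y * (y ^ (1 - τ) / (1 - τ)) := by
  have hl : 0 < Real.log y := Real.log_pos (by linarith)
  have h := sum_log_rpow h0 h1 hy
  have h2 : ∑ p ∈ PB y, (p : ℝ) ^ (-τ) ≤ ∑ p ∈ PB y, 2 / Real.log y * (Real.log p * (p : ℝ) ^ (-τ)) := by
    refine Finset.sum_le_sum fun p hp => ?_
    obtain ⟨_, _, h3⟩ := mem_PB hy hp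
    have : 1 ≤ 2 / Real.log y * Real.log p := by
      rw [div_mul_eq_mul_div, le_div_iff₀ hl]; linarith
    have hp0 : 0 ≤ (p : ℝ) ^ (-τ) := by positivity
    nlinarith
  have h3 : ∑ p ∈ PB y, Real.log p * (p : ℝ) ^ (-τ) ≤
      ∑ p ∈ Nat.primesLE ⌊y⌋₊, Real.log p * (p : ℝ) ^ (-τ) := by
    refine Finset.sum_le_sum_of_subset_of_nonneg (Finset.filter_subset _ _) fun p _ _ => ?_
    have := Real.log_natCast_nonneg p
    positivity
  rw [← Finset.mul_sum] at h2
  calc _ ≤ _ := h2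
    _ ≤ 2 / Real.log y * (1.5 * (y ^ (1 - τ) / (1 - τ))) := by gcongr; exact h3.trans h
    _ = _ := by ring
end DB

namespace DB

noncomputable def sg (L y : ℝ) : ℝ := Real.log (1 + y / L) / Real.log y
noncomputable def gg (σ t : ℝ) : ℝ := -Real.log (1 - t ^ (-σ))

section
variable {L y : ℝ}

lemma sg_mul (hy : 2 ≤ y) : sg L y * Real.log y = Real.log (1 + y / L) := by
  have hl : 0 < Real.log y := Real.log_pos (by linarith)
  rw [sg]; field_simp

lemma sg_pos (hL : Real.exp 1 ≤ L) (hy : 2 ≤ y) : 0 < sg L y := by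
  have hl : 0 < Real.log y := Real.log_pos (by linarith)
  have hL0 : 0 < L := (Real.exp_pos 1).trans_le hL
  have : 0 < y / L := by positivity
  exact div_pos (Real.log_pos (by linarith)) hl

lemma sg_lt_one (hL : Real.exp 1 ≤ L) (hy : 2 ≤ y) : sg L y < 1 := by
  have hl : 0 < Real.log y := Real.log_pos (by linarith)
  have hL0 : 0 < L := (Real.exp_pos 1).trans_le hL
  rw [sg, div_lt_one hl]
  exact Real.log_lt_log (by positivity) (sig_lt hL hy)

lemma rpow_sg (hL : Real.exp 1 ≤ L) (hy : 2 ≤ y) : y ^ (sg L y) = 1 + y / L := by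
  have hL0 : 0 < L := (Real.exp_pos 1).trans_le hL
  rw [Real.rpow_def_of_pos (by linarith), mul_comm, sg_mul hy, Real.exp_log (by positivity)]

lemma gg_y (hL : Real.exp 1 ≤ L) (hy : 2 ≤ y) : gg (sg L y) y = Real.log (1 + L / y) := by
  have hL0 : 0 < L := (Real.exp_pos 1).trans_le hL
  have hy0 : 0 < y := by linarith
  rw [gg, Real.rpow_neg hy0.le, rpow_sg hL hy, ← Real.log_inv]
  congr 1
  have : 1 - (1 + y / L)⁻¹ = y / (L + y) := by field_simp; ring
  rw [this, inv_div]; field_simp; ring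

lemma rpow_one_sub_sg (hL : Real.exp 1 ≤ L) (hy : 2 ≤ y) : y ^ (1 - sg L y) ≤ L := by
  have hL0 : 0 < L := (Real.exp_pos 1).trans_le hL
  have hy0 : 0 < y := by linarith
  rw [Real.rpow_sub hy0, rpow_sg hL hy, Real.rpow_one, div_le_iff₀ (by positivity)]
  have : L * (1 + y / L) = L + y := by field_simp
  linarith

lemma one_sub_sg (hL : Real.exp 1 ≤ L) (hy : 2 ≤ y) (hLy : L ≤ y) :
    0.3 * Real.log L ≤ (1 - sg L y) * Real.log y := by
  have hL0 : 0 < L := (Real.exp_pos 1).trans_le hL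
  have hy0 : 0 < y := by linarith
  rw [sub_mul, sg_mul hy, one_mul]
  have h1 : 1 + y / L ≤ 2 * (y / L) := by
    have : 1 ≤ y / L := by rw [le_div_iff₀ hL0]; linarith
    linarith
  have h2 := Real.log_le_log (by positivity) h1
  rw [Real.log_mul (by norm_num) (by positivity), Real.log_div hy0.ne' hL0.ne'] at h2
  have h3 := Real.log_two_lt_d9
  have h4 := ell_ge hL
  norm_num at *
  linarith

lemma gg_diff {σ t : ℝ} (hσ : 0 < σ) (ht : 2 ≤ t) (hty : t ≤ y) :
    gg σ t - gg σ y ≤ Real.log (Real.log y / Real.log t) := by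
  have ht0 : 0 < t := by linarith
  have hy0 : 0 < y := by linarith
  have hlt : 0 < Real.log t := Real.log_pos (by linarith)
  have hly : 0 < Real.log y := Real.log_pos (by linarith)
  have hr := rpow_neg_lt_one hσ (show 1 < t by linarith)
  have hs := rpow_neg_lt_one hσ (show 1 < y by linarith)
  have e : gg σ t - gg σ y = Real.log ((1 - y ^ (-σ)) / (1 - t ^ (-σ))) := by
    rw [gg, gg, Real.log_div (by linarith) (by linarith)]; ring
  rw [e]
  apply Real.log_le_log (div_pos (by linarith) (by linarith))
  rw [div_le_div_iff₀ (by linarith) hlt]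
  have hlty := Real.log_le_log ht0 hty
  have hc := convexOn_exp.2 (Set.mem_univ (-σ * Real.log y)) (Set.mem_univ 0)
    (show 0 ≤ Real.log t / Real.log y by positivity)
    (show 0 ≤ 1 - Real.log t / Real.log y by rw [sub_nonneg, div_le_one hly]; exact hlty) (by ring)
  simp only [smul_eq_mul, mul_zero, add_zero, Real.exp_zero, mul_one] at hc
  have e1 : Real.log t / Real.log y * (-σ * Real.log y) = Real.log t * (-σ) := by field_simp
  rw [e1, ← Real.rpow_def_of_pos ht0, mul_comm (-σ), ← Real.rpow_def_of_pos hy0] at hc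
  have h2 := mul_le_mul_of_nonneg_right hc hly.le
  have e2 : (Real.log t / Real.log y * y ^ (-σ) + (1 - Real.log t / Real.log y)) * Real.log y =
    Real.log t * y ^ (-σ) + Real.log y - Real.log t := by field_simp; ring
  rw [e2] at h2
  linarith

lemma PS_diff {σ : ℝ} (hσ : 0 < σ) (hy : 2 ≤ y) :
    ∑ p ∈ PS y, (gg σ p - gg σ y) ≤ 1.5 * (Real.sqrt y * Real.log y) := by
  have hly : 0 < Real.log y := Real.log_pos (by linarith)
  have h : ∀ p ∈ PS y, (gg σ p - gg σ y) ≤ 1.5 * Real.log y := by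
    intro p hp
    obtain ⟨h1, h2, _⟩ := mem_PS hy hp
    have hlp := log2_le_log h1
    have hlp0 : 0 < Real.log p := Real.log_pos (by linarith)
    refine (gg_diff hσ h1 h2).trans ?_
    refine (Real.log_le_sub_one_of_pos (by positivity)).trans ?_
    have : Real.log y / Real.log p ≤ 1.5 * Real.log y := by
      rw [div_le_iff₀ hlp0]
      norm_num at *
      nlinarith
    linarith
  refine (Finset.sum_le_card_nsmul _ _ _ h).trans ?_
  rw [nsmul_eq_mul]
  have := mul_le_mul_of_nonneg_right (PS_card hy) (show 0 ≤ 1.5 * Real.log y by positivity)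
  linarith

lemma caseA (hL : Real.exp 1 ≤ L) (hy : 2 ≤ y) (hyL : y ≤ L) :
    ∑ p ∈ Nat.primesLE ⌊y⌋₊, (gg (sg L y) p - gg (sg L y) y) ≤ 100 * (ZZ L y * (1 / Real.log y)) := by
  have hL0 : 0 < L := (Real.exp_pos 1).trans_le hL
  have hy0 : 0 < y := by linarith
  have hly : 0 < Real.log y := Real.log_pos (by linarith)
  have hσ := sg_pos hL hy
  rw [sum_split]
  have hsq := Real.sq_sqrt hy0.le
  have hsq0 := Real.sqrt_pos.mpr hy0
  have h1 : ∑ p ∈ PB y, (gg (sg L y) p - gg (sg L y) y) ≤ 24 * (y / Real.log y ^ 2) := by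
    have h : ∀ p ∈ PB y, (gg (sg L y) p - gg (sg L y) y) ≤
        4 / Real.log y * Real.sqrt y * (p : ℝ) ^ (-(1 / 2 : ℝ)) := by
      intro p hp
      obtain ⟨h1, h2, h3⟩ := mem_PB hy hp
      have hlp0 : 0 < Real.log p := Real.log_pos (by linarith)
      have hp0 : (0 : ℝ) < p := by linarith
      refine (gg_diff hσ h1 h2).trans ?_
      refine (Real.log_le_sub_one_of_pos (by positivity)).trans ?_
      have a1 : Real.log y / Real.log p - 1 = Real.log (y / p) / Real.log p := by
        rw [Real.log_div hy0.ne' hp0.ne']; field_simp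
      have a2 := Real.log_le_rpow_div (x := y / p) (by positivity) (show (0 : ℝ) < 1 / 2 by norm_num)
      have a3 : (y / p) ^ (1 / 2 : ℝ) = Real.sqrt y * (p : ℝ) ^ (-(1 / 2 : ℝ)) := by
        rw [Real.div_rpow hy0.le hp0.le, Real.rpow_neg hp0.le, Real.sqrt_eq_rpow]; rfl
      have a4 : 0 ≤ Real.log (y / p) := Real.log_nonneg (by rw [le_div_iff₀ hp0]; linarith)
      rw [a1]
      calc Real.log (y / p) / Real.log p ≤ Real.log (y / p) / (Real.log y / 2) := by
            gcongr; linarith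
        _ ≤ ((y / p) ^ (1 / 2 : ℝ) / (1 / 2)) / (Real.log y / 2) := by gcongr
        _ = _ := by rw [a3]; field_simp; ring
    refine (Finset.sum_le_sum h).trans ?_
    rw [← Finset.mul_sum]
    have := PB_sum (τ := 1 / 2) (by norm_num) (by norm_num) hy
    calc _ ≤ 4 / Real.log y * Real.sqrt y * (3 / Real.log y * (y ^ (1 - 1 / 2 : ℝ) / (1 - 1 / 2))) := by
          gcongr
      _ = 24 * (Real.sqrt y ^ 2 / Real.log y ^ 2) := by
          rw [show (1 - 1 / 2 : ℝ) = 1 / 2 by norm_num, ← Real.sqrt_eq_rpow]; field_simp; ring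
      _ = _ := by rw [hsq]
  have h2 := PS_diff hσ hy
  have h3 : Real.log y ^ 3 ≤ 27 * Real.sqrt y := by
    have := log_pow_bound (show 1 ≤ y by linarith) 6
    norm_num [Nat.factorial] at this
    refine le_of_sq_le_sq ?_ (by positivity)
    nlinarith
  have h4 : Real.sqrt y * Real.log y ≤ 27 * (y / Real.log y ^ 2) := by
    rw [mul_div_assoc', le_div_iff₀ (by positivity)]
    nlinarith
  have h5 : 0.69 ≤ Real.log (1 + L / y) := log2_le_log (by
    have : 1 ≤ L / y := by rw [le_div_iff₀ hy0]; linarith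
    linarith)
  have h6 := Z_ge2 hL hy
  have h7 : y / Real.log y * 0.69 ≤ ZZ L y := le_trans (by gcongr) h6
  have h8 : y / Real.log y ^ 2 = y / Real.log y * (1 / Real.log y) := by field_simp
  have h9 := mul_le_mul_of_nonneg_right h7 (show 0 ≤ 1 / Real.log y by positivity)
  rw [h8] at h1 h4
  refine (add_le_add h1 (h2.trans (mul_le_mul_of_nonneg_left h4 (by norm_num)))).trans ?_
  have h10 : 0.69 * (y / Real.log y * (1 / Real.log y)) ≤ ZZ L y * (1 / Real.log y) :=
    le_trans (le_of_eq (by ring)) h9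
  generalize y / Real.log y * (1 / Real.log y) = w at *
  generalize ZZ L y * (1 / Real.log y) = z at *
  have hw : 0 ≤ w := by
    have : 0 ≤ Real.sqrt y * Real.log y := by positivity
    linarith
  clear h1 h2 h3 h5 h6 h7 h8 h9
  norm_num at h10 ⊢
  linarith

lemma PB_diff2 {σ : ℝ} (hσ : 0 < σ) (hσ1 : σ < 1) (hy : 2 ≤ y) (h2 : 2 ≤ y ^ σ) :
    ∑ p ∈ PB y, (gg σ p - gg σ y) ≤ 48 * σ * y ^ (1 - σ) / (Real.log y * (1 - σ) ^ 2) := by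
  have hy0 : 0 < y := by linarith
  have hly : 0 < Real.log y := Real.log_pos (by linarith)
  have hd : 0 < 1 - σ := by linarith
  set η := (1 - σ) / 2 with hη
  have hη0 : 0 < η := by positivity
  have h : ∀ p ∈ PB y, (gg σ p - gg σ y) ≤ 4 * σ * y ^ η / η * (p : ℝ) ^ (-(σ + η)) := by
    intro p hp
    obtain ⟨h1, hpy, h3⟩ := mem_PB hy hp
    have hlp0 : 0 < Real.log p := Real.log_pos (by linarith)
    have hp0 : (0 : ℝ) < p := by linarith
    set r := (p : ℝ) ^ (-σ) with hr
    have hr0 : 0 < r := by positivity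
    have hr1 := rpow_neg_lt_one hσ (show 1 < (p : ℝ) by linarith)
    have hs1 := rpow_neg_lt_one hσ (show 1 < y by linarith)
    rw [← hr] at hr1
    -- r^2 ≤ 1/2
    have hrsq : r ^ 2 ≤ 1 / 2 := by
      have e1 : r ^ 2 = ((p : ℝ) ^ 2) ^ (-σ) := by
        rw [hr, ← Real.rpow_natCast, ← Real.rpow_natCast, ← Real.rpow_mul hp0.le,
          ← Real.rpow_mul hp0.le, mul_comm]
      have hyp : y ≤ (p : ℝ) ^ 2 := by
        rw [← Real.log_le_log_iff hy0 (by positivity), Real.log_pow]; exact_mod_cast h3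
      rw [e1]
      calc ((p : ℝ) ^ 2) ^ (-σ) ≤ y ^ (-σ) :=
            Real.rpow_le_rpow_of_nonpos hy0 hyp (by linarith)
        _ = (y ^ σ)⁻¹ := Real.rpow_neg hy0.le _
        _ ≤ 2⁻¹ := by gcongr
        _ = _ := by norm_num
    have hr3 : r ≤ 3 / 4 := by nlinarith
    have e : gg σ p - gg σ y = Real.log ((1 - y ^ (-σ)) / (1 - r)) := by
      rw [gg, gg, Real.log_div (by linarith) (by linarith)]; ring
    have hs : r * (1 - σ * Real.log (y / p)) ≤ y ^ (-σ) := by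
      have : y ^ (-σ) = r * (y / p) ^ (-σ) := by
        rw [hr, ← Real.mul_rpow hp0.le (by positivity)]; congr 1; field_simp
      rw [this, Real.rpow_def_of_pos (by positivity : 0 < y / (p : ℝ))]
      have := Real.add_one_le_exp (Real.log (y / p) * -σ)
      gcongr
      linarith
    have a4 : 0 ≤ Real.log (y / p) := Real.log_nonneg (by rw [le_div_iff₀ hp0]; linarith)
    have a2 := Real.log_le_rpow_div (x := y / p) (by positivity) hη0
    have a3 : r * (y / p) ^ η = y ^ η * (p : ℝ) ^ (-(σ + η)) := by
      rw [hr, Real.div_rpow hy0.le hp0.le, neg_add, Real.rpow_add hp0, Real.rpow_neg hp0.le η]; ring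
    rw [e]
    refine (Real.log_le_sub_one_of_pos (div_pos (by linarith) (by linarith))).trans ?_
    have b1 : (1 - y ^ (-σ)) / (1 - r) - 1 ≤ 4 * (r * (σ * Real.log (y / p))) := by
      rw [sub_le_iff_le_add, div_le_iff₀ (by linarith)]
      have : 0 ≤ r * (σ * Real.log (y / p)) := by positivity
      nlinarith
    refine b1.trans ?_
    calc 4 * (r * (σ * Real.log (y / p))) ≤ 4 * (r * (σ * ((y / p) ^ η / η))) := by gcongr
      _ = 4 * σ * (r * (y / p) ^ η) / η := by ring
      _ = _ := by rw [a3]; ring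
  refine (Finset.sum_le_sum h).trans ?_
  rw [← Finset.mul_sum]
  have := PB_sum (τ := σ + η) (by positivity) (by rw [hη]; linarith) hy
  have e1 : 1 - (σ + η) = η := by rw [hη]; ring
  rw [e1] at this
  calc _ ≤ 4 * σ * y ^ η / η * (3 / Real.log y * (y ^ η / η)) := by gcongr
    _ = 12 * σ * (y ^ η * y ^ η) / (Real.log y * η ^ 2) := by field_simp; ring
    _ = _ := by
      rw [← Real.rpow_add hy0, show η + η = 1 - σ by rw [hη]; ring, hη]; field_simp; ring

lemma caseB1 (hL : Real.exp 1 ≤ L) (hy : 2 ≤ y) (hyL : L ≤ y)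
    (hyl : Real.log y ≤ 1.25 * Real.log L) :
    ∑ p ∈ Nat.primesLE ⌊y⌋₊, (gg (sg L y) p - gg (sg L y) y) ≤
      4000 * (ZZ L y * (1 / Real.log y)) := by
  have hL0 : 0 < L := (Real.exp_pos 1).trans_le hL
  have hy0 : 0 < y := by linarith
  have hly : 0 < Real.log y := Real.log_pos (by linarith)
  have hl1 := ell_ge hL
  have hσ := sg_pos hL hy
  have hσ1 := sg_lt_one hL hy
  rw [sum_split]
  have hyL1 : 1 ≤ y / L := by rw [le_div_iff₀ hL0]; linarith
  have h1 := PB_diff2 hσ hσ1 hy (by rw [rpow_sg hL hy]; linarith)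
  have h2 := PS_diff hσ hy
  have h3 : 0.24 ≤ 1 - sg L y := by
    have := one_sub_sg hL hy hyL
    norm_num at *
    by_contra hc
    push Not at hc
    nlinarith
  have hZ1 := Z_ge1 hL hy
  have e1 : L / Real.log y * Real.log (1 + y / L) = sg L y * L := by rw [sg]; ring
  have h4 : 48 * sg L y * y ^ (1 - sg L y) / (Real.log y * (1 - sg L y) ^ 2) ≤
      1000 * (ZZ L y * (1 / Real.log y)) := by
    calc _ ≤ 48 * sg L y * L / (Real.log y * 0.24 ^ 2) := by
          gcongr
          exact rpow_one_sub_sg hL hy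
      _ = (48 / 0.24 ^ 2) * ((sg L y * L) * (1 / Real.log y)) := by field_simp
      _ ≤ 1000 * (ZZ L y * (1 / Real.log y)) := by
          have : (48 / 0.24 ^ 2 : ℝ) ≤ 1000 := by norm_num
          rw [e1] at hZ1
          gcongr
  have h5 : Real.sqrt y * Real.log y ^ 3 ≤ 1000 * L := by
    set q := L ^ (1 / 8 : ℝ) with hq
    have hq0 : 0 < q := by positivity
    have hq8 : q ^ 8 = L := by
      rw [hq, ← Real.rpow_natCast, ← Real.rpow_mul hL0.le]; norm_num
    have hlq : Real.log L = 8 * Real.log q := by rw [← hq8, Real.log_pow]; norm_num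
    have a1 : Real.log q ≤ q := (Real.log_le_sub_one_of_pos hq0).trans (by linarith)
    have a2 : Real.log y ≤ 10 * Real.log q := by rw [hlq] at hyl; norm_num at *; linarith
    have a3 : Real.sqrt y ≤ q ^ 5 := by
      rw [Real.sqrt_le_left (by positivity), ← Real.log_le_log_iff hy0 (by positivity),
        ← pow_mul, Real.log_pow]
      norm_num; linarith
    calc Real.sqrt y * Real.log y ^ 3 ≤ q ^ 5 * (10 * q) ^ 3 := by gcongr; linarith
      _ = 1000 * q ^ 8 := by ring
      _ = _ := by rw [hq8]
  have h6 : Real.sqrt y * Real.log y ≤ 1000 * (L / Real.log y * (1 / Real.log y)) := by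
    have : 1000 * (L / Real.log y * (1 / Real.log y)) = 1000 * L / Real.log y ^ 2 := by field_simp
    rw [this, le_div_iff₀ (by positivity)]
    nlinarith
  have h7 : 0.69 ≤ Real.log (1 + y / L) := log2_le_log (by linarith)
  have h8 : L / Real.log y * 0.69 ≤ ZZ L y := le_trans (by gcongr) hZ1
  have h9 := mul_le_mul_of_nonneg_right h8 (show 0 ≤ 1 / Real.log y by positivity)
  refine (add_le_add (h1.trans h4) (h2.trans (mul_le_mul_of_nonneg_left h6 (by norm_num)))).trans ?_
  have h10 : 0.69 * (L / Real.log y * (1 / Real.log y)) ≤ ZZ L y * (1 / Real.log y) :=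
    le_trans (le_of_eq (by ring)) h9
  have hw : 0 ≤ L / Real.log y * (1 / Real.log y) := by positivity
  generalize L / Real.log y * (1 / Real.log y) = w at *
  generalize ZZ L y * (1 / Real.log y) = z at *
  clear h1 h2 h3 h5 h7 h8 h9
  norm_num at h10 ⊢
  linarith

lemma caseB2 (hL : Real.exp 1 ≤ L) (hy : 2 ≤ y) (hyl : 1.25 * Real.log L ≤ Real.log y)
    (hyL : Real.log y ≤ Real.sqrt L) :
    ∑ p ∈ Nat.primesLE ⌊y⌋₊, gg (sg L y) p ≤ 600 * (ZZ L y * (1 / Real.log L)) := by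
  have hL0 : 0 < L := (Real.exp_pos 1).trans_le hL
  have hy0 : 0 < y := by linarith
  have hly : 0 < Real.log y := Real.log_pos (by linarith)
  have hl1 := ell_ge hL
  have hl0 : 0 < Real.log L := by linarith
  have hσ := sg_pos hL hy
  have hσ1 := sg_lt_one hL hy
  have hLy : L ≤ y := by
    rw [← Real.log_le_log_iff hL0 hy0]; norm_num at *; linarith
  have hd : 0 < 1 - sg L y := by linarith
  have hσ5 : 1 / 5 ≤ sg L y := by
    rw [sg, le_div_iff₀ hly]
    have h : Real.log y - Real.log L ≤ Real.log (1 + y / L) := by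
      rw [← Real.log_div (by linarith) hL0.ne']
      apply Real.log_le_log (by positivity); linarith
    norm_num at *
    linarith
  have hZ1 := Z_ge1 hL hy
  have e1 : L / Real.log y * Real.log (1 + y / L) = sg L y * L := by rw [sg]; ring
  have hZ : L / 5 ≤ ZZ L y := by
    rw [e1] at hZ1
    nlinarith
  have hg : ∀ p : ℕ, (2 : ℝ) ≤ p → gg (sg L y) p ≤ 9 * (p : ℝ) ^ (-sg L y) := by
    intro p hp
    have hp0 : (0 : ℝ) < p := by linarith
    set r := (p : ℝ) ^ (-sg L y) with hr
    have hr0 : 0 < r := by positivity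
    have hr1 : r ≤ 0.88 := by
      have b1 : r ≤ (2 : ℝ) ^ (-(1 / 5) : ℝ) :=
        (Real.rpow_le_rpow_of_nonpos (by norm_num) hp (by linarith)).trans
          (Real.rpow_le_rpow_of_exponent_le (by norm_num) (by linarith))
      refine b1.trans ?_
      have b2 : ((2 : ℝ) ^ (-(1 / 5) : ℝ)) ^ 5 = 1 / 2 := by
        rw [← Real.rpow_natCast, ← Real.rpow_mul (by norm_num)]; norm_num
      refine le_of_pow_le_pow_left₀ (n := 5) (by norm_num) (by norm_num) ?_
      rw [b2]; norm_num
    have h1r : 0 < 1 - r := by norm_num at *; linarith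
    rw [gg, ← hr, ← Real.log_inv]
    refine (Real.log_le_sub_one_of_pos (by positivity)).trans ?_
    rw [sub_le_iff_le_add, inv_le_iff_one_le_mul₀ h1r]
    norm_num at *
    nlinarith
  have hinv : 1 / (1 - sg L y) ≤ Real.log y / (0.3 * Real.log L) := by
    rw [div_le_div_iff₀ hd (by positivity)]
    have := one_sub_sg hL hy hLy
    linarith
  rw [sum_split]
  have h1 : ∑ p ∈ PB y, gg (sg L y) p ≤ 90 * (L * (1 / Real.log L)) := by
    refine (Finset.sum_le_sum fun p hp => hg p (mem_PB hy hp).1).trans ?_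
    rw [← Finset.mul_sum]
    have := PB_sum hσ hσ1 hy
    calc _ ≤ 9 * (3 / Real.log y * (y ^ (1 - sg L y) / (1 - sg L y))) := by gcongr
      _ = 27 / Real.log y * (y ^ (1 - sg L y) * (1 / (1 - sg L y))) := by ring
      _ ≤ 27 / Real.log y * (L * (Real.log y / (0.3 * Real.log L))) := by
          gcongr
          exact rpow_one_sub_sg hL hy
      _ = _ := by field_simp; norm_num
  have h2 : ∑ p ∈ PS y, gg (sg L y) p ≤ 30 * (L * (1 / Real.log L)) := by
    refine (Finset.sum_le_sum fun p hp => hg p (mem_PS hy hp).1).trans ?_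
    rw [← Finset.mul_sum]
    have h3 : ∑ p ∈ PS y, (p : ℝ) ^ (-sg L y) ≤
        Real.sqrt y ^ (1 - sg L y) * (1 / (1 - sg L y)) := by
      refine (Finset.sum_le_sum_of_subset_of_nonneg (PS_sub hy) fun p _ _ => by positivity).trans ?_
      refine (sum_rpow_le hσ hσ1 _).trans ?_
      rw [div_eq_mul_one_div]
      gcongr
      exact Nat.floor_le (Real.sqrt_nonneg y)
    have h4 : Real.sqrt y ^ (1 - sg L y) ≤ Real.sqrt L := by
      have : Real.sqrt y ^ (1 - sg L y) = Real.sqrt (y ^ (1 - sg L y)) := by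
        rw [Real.sqrt_eq_rpow, Real.sqrt_eq_rpow, ← Real.rpow_mul hy0.le, ← Real.rpow_mul hy0.le,
          mul_comm]
      rw [this]
      exact Real.sqrt_le_sqrt (rpow_one_sub_sg hL hy)
    calc _ ≤ 9 * (Real.sqrt L * (Real.sqrt L / (0.3 * Real.log L))) := by
          refine mul_le_mul_of_nonneg_left ?_ (by norm_num)
          refine h3.trans ?_
          refine mul_le_mul h4 (hinv.trans ?_) (by positivity) (by positivity)
          gcongr
      _ = 9 * ((Real.sqrt L ^ 2) / (0.3 * Real.log L)) := by ring
      _ = 9 * (L / (0.3 * Real.log L)) := by rw [Real.sq_sqrt hL0.le]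
      _ = _ := by field_simp; norm_num
  have h9 := mul_le_mul_of_nonneg_right hZ (show 0 ≤ 1 / Real.log L by positivity)
  linarith

end
end DB

namespace DB

lemma upper_large {x y : ℝ} (hx : 16 ≤ x) (hy : 2 ≤ y)
    (h : Real.sqrt (Real.log x) ≤ Real.log y) :
    Real.log ((sm x y).card) ≤ ZZ (Real.log x) y +
      20 * (ZZ (Real.log x) y * (1 / Real.log (Real.log x))) := by
  have hL := exp_one_le_log hx
  have hc : (0 : ℝ) < (sm x y).card := by exact_mod_cast sm_card_pos (by linarith)
  have h1 := Real.log_le_log hc (sm_card_le (y := y) (show 1 ≤ x by linarith))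
  set L := Real.log x with hLd
  have hL0 : 0 < L := (Real.exp_pos 1).trans_le hL
  have hly : 0 < Real.log y := Real.log_pos (by linarith)
  have hl1 := ell_ge hL
  have hL1 : 1 ≤ L := by have := L_ge hL; norm_num at this; linarith
  have h3 := Z_ge3 hL hy
  have h4 := log_sqrt_bound hL1
  have h5 := log_pow_bound hL1 4
  set l := Real.log L with hl
  set s := Real.sqrt L with hs
  have hs2 : s ^ 2 = L := Real.sq_sqrt hL0.le
  have hs0 : 0 < s := Real.sqrt_pos.mpr hL0
  have h6 : L / Real.log y ≤ s := by
    rw [div_le_iff₀ hly]; nlinarith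
  have h7 : L - s * l ≤ ZZ L y := by nlinarith
  have h8 : l ^ 2 ≤ 5 * s := by
    norm_num [Nat.factorial] at h5
    refine le_of_sq_le_sq ?_ (by positivity)
    nlinarith
  have hl0 : 0 < l := by linarith
  have h9 : s * l ≤ 5 * (L * (1 / l)) := by
    have : 5 * (L * (1 / l)) = 5 * L / l := by ring
    rw [this, le_div_iff₀ hl0]; nlinarith
  have h10 : L ≤ 4 * ZZ L y := by norm_num at h4; nlinarith
  have h11 := mul_le_mul_of_nonneg_right h10 (show 0 ≤ 1 / l by positivity)
  linarith

lemma upper : ∃ C : ℝ, 0 < C ∧ ∀ x y : ℝ, 16 ≤ x → 2 ≤ y → y ≤ x →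
    Real.log ((sm x y).card) ≤ ZZ (Real.log x) y +
      C * ZZ (Real.log x) y * (1 / Real.log y + 1 / Real.log (Real.log x)) := by
  obtain ⟨C, hC, hpi⟩ := pi_pnt
  refine ⟨C + 4000, by positivity, ?_⟩
  intro x y hx hy hyx
  have hL := exp_one_le_log hx
  have hx1 : 1 ≤ x := by linarith
  by_cases hcase : Real.sqrt (Real.log x) ≤ Real.log y
  · have h := upper_large hx hy hcase
    have hz := ZZ_nonneg hL hy
    have hl1 := ell_ge hL
    have hly : 0 < Real.log y := Real.log_pos (by linarith)
    set L := Real.log x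
    have p1 : 0 ≤ ZZ L y * (1 / Real.log y) := by positivity
    have p2 : 0 ≤ ZZ L y * (1 / Real.log L) := by positivity
    have p3 := mul_nonneg hC.le p1
    have p4 := mul_nonneg hC.le p2
    nlinarith
  push Not at hcase
  have hR := rankin hx1 (sg_pos hL hy) (y := y)
  have hz := ZZ_nonneg hL hy
  have hl1 := ell_ge hL
  have hly : 0 < Real.log y := Real.log_pos (by linarith)
  set L := Real.log x
  have hy0 : 0 < y := by linarith
  have hL0 : 0 < L := (Real.exp_pos 1).trans_le hL
  have p1 : 0 ≤ ZZ L y * (1 / Real.log y) := by positivity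
  have p2 : 0 ≤ ZZ L y * (1 / Real.log L) := by positivity
  have p3 := mul_nonneg hC.le p1
  have p4 := mul_nonneg hC.le p2
  have e1 : L / Real.log y * Real.log (1 + y / L) = sg L y * L := by rw [sg]; ring
  change _ ≤ sg L y * L + ∑ p ∈ Nat.primesLE ⌊y⌋₊, gg (sg L y) p at hR
  have hgoal : (C + 4000) * ZZ L y * (1 / Real.log y + 1 / Real.log L) =
    C * (ZZ L y * (1 / Real.log y)) + C * (ZZ L y * (1 / Real.log L)) +
    4000 * (ZZ L y * (1 / Real.log y)) + 4000 * (ZZ L y * (1 / Real.log L)) := by ring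
  rw [hgoal]
  by_cases hB2 : 1.25 * Real.log L ≤ Real.log y
  · have h1 := caseB2 hL hy hB2 hcase.le
    have h2 := Z_ge1 hL hy
    rw [e1] at h2
    linarith
  push Not at hB2
  have hD : ∑ p ∈ Nat.primesLE ⌊y⌋₊, (gg (sg L y) p - gg (sg L y) y) ≤
      4000 * (ZZ L y * (1 / Real.log y)) := by
    rcases le_total y L with h | h
    · have := caseA hL hy h
      linarith
    · exact caseB1 hL hy h hB2.le
  rw [Finset.sum_sub_distrib, Finset.sum_const, Nat.primesLE_card_eq_primeCounting,
    nsmul_eq_mul] at hD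
  have hp := (abs_le.mp (hpi y hy)).2
  have hg : gg (sg L y) y = Real.log (1 + L / y) := gg_y hL hy
  have hg0 : 0 ≤ Real.log (1 + L / y) := Real.log_nonneg (by
    have : 0 < L / y := by positivity
    linarith)
  rw [hg] at hD
  have h2 := Z_ge2 hL hy
  have h3 : (Nat.primeCounting ⌊y⌋₊ : ℝ) * Real.log (1 + L / y) ≤
      y / Real.log y * Real.log (1 + L / y) + C * (ZZ L y * (1 / Real.log y)) := by
    have a1 : (Nat.primeCounting ⌊y⌋₊ : ℝ) * Real.log (1 + L / y) ≤
        (y / Real.log y + C * y / Real.log y ^ 2) * Real.log (1 + L / y) := by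
      gcongr; linarith
    have a2 : (y / Real.log y + C * y / Real.log y ^ 2) * Real.log (1 + L / y) =
      y / Real.log y * Real.log (1 + L / y) +
        C * ((y / Real.log y * Real.log (1 + L / y)) * (1 / Real.log y)) := by field_simp
    rw [a2] at a1
    refine a1.trans ?_
    gcongr
  have h4 : ZZ L y = sg L y * L + y / Real.log y * Real.log (1 + L / y) := by rw [ZZ, e1]
  linarith

end DB

open Finset

/-- There exists C > 0 such that for all real x, y with x ≥ 16 and 2 ≤ y ≤ x, one has
|log ψ(x,y) − Z| ≤ C·Z·(1/log y + 1/log log x), where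
ψ(x,y) = #{n ≤ x : every prime divisor of n is ≤ y} and
Z = (log x / log y)·log(1 + y/log x) + (y/log y)·log(1 + (log x)/y). -/
theorem stmt_6 :
    ∃ C : ℝ, 0 < C ∧ ∀ x y : ℝ, 16 ≤ x → 2 ≤ y → y ≤ x →
      |Real.log (((Finset.Icc 1 ⌊x⌋₊).filter
            (fun n => ∀ p : ℕ, p ∈ n.primeFactors → (p : ℝ) ≤ y)).card) -
          ((Real.log x / Real.log y) * Real.log (1 + y / Real.log x) +
            (y / Real.log y) * Real.log (1 + Real.log x / y))| ≤
        C * ((Real.log x / Real.log y) * Real.log (1 + y / Real.log x) +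
            (y / Real.log y) * Real.log (1 + Real.log x / y)) *
          (1 / Real.log y + 1 / Real.log (Real.log x)) := by
  obtain ⟨C1, hC1, h1⟩ := DB.lower
  obtain ⟨C2, hC2, h2⟩ := DB.upper
  refine ⟨C1 + C2, by positivity, ?_⟩
  intro x y hx hy hyx
  have a1 := h1 x y hx hy hyx
  have a2 := h2 x y hx hy hyx
  have hL := DB.exp_one_le_log hx
  have hz := DB.ZZ_nonneg hL hy
  have hl1 := DB.ell_ge hL
  have hly : 0 < Real.log y := Real.log_pos (by linarith)
  change |Real.log ((DB.sm x y).card) - DB.ZZ (Real.log x) y| ≤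
    (C1 + C2) * DB.ZZ (Real.log x) y * (1 / Real.log y + 1 / Real.log (Real.log x))
  have hE : 0 ≤ DB.ZZ (Real.log x) y * (1 / Real.log y + 1 / Real.log (Real.log x)) := by
    have : 0 ≤ 1 / Real.log y + 1 / Real.log (Real.log x) := by positivity
    positivity
  have p1 := mul_nonneg hC1.le hE
  have p2 := mul_nonneg hC2.le hE
  rw [abs_le]
  constructor <;> nlinarith
end
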